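/- Let Ω ⊂ ℝ be an open bounded interval, let f satisfy hypothesis (F), let the data satisfy the smooth-data hypothesis (I∞), and for ε ∈ (0,1) let (v_ε,u_ε,Θ_ε) be the classical solution of the regularized problem (P_ε). Then there exist a sequence (ε_j)_{j∈ℕ} ⊂ (0,1) with ε_j ↓ 0 as j → ∞ and a global weak solution (u,Θ) of system (P) with data (u₀,u_{0t},Θ₀)=(u₀,v₀,Θ₀) such that, along ε = ε_j ↓ 0, u_ε ⇀ u, u_{εx} ⇀ u_x, v_ε ⇀ u_t, Θ_ε ⇀ Θ and Θ_{εx} ⇀ Θ_x weakly in L²_loc(Ω̄×[0,∞)). -/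

import Mathlib

open MeasureTheory Filter Set Function

noncomputable section

/-- Integral over `Ω = (a,b)`. -/
def intOm (a b : ℝ) (g : ℝ → ℝ) : ℝ := ∫ x in Ioo a b, g x

/-- Double integral over `Ω × (0,T)`. -/
def intOmT (a b T : ℝ) (F : ℝ → ℝ → ℝ) : ℝ :=
  ∫ p in (Ioo a b) ×ˢ (Ioo 0 T), F p.1 p.2

/-- Squared `L²(Ω)` integral of `g`. -/
def sqOm (a b : ℝ) (g : ℝ → ℝ) : ℝ := ∫ x in Ioo a b, (g x) ^ 2

/-- `L²(Ω)` norm. -/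
def nrmL2 (a b : ℝ) (g : ℝ → ℝ) : ℝ := (∫ x in Ioo a b, (g x) ^ 2) ^ (1 / 2 : ℝ)

/-- `L¹(Ω)` norm. -/
def nrmL1 (a b : ℝ) (g : ℝ → ℝ) : ℝ := ∫ x in Ioo a b, |g x|

/-- Membership in `L²(Ω)`. -/
def MemL2 (a b : ℝ) (g : ℝ → ℝ) : Prop :=
  AEStronglyMeasurable g (volume.restrict (Ioo a b)) ∧
    IntegrableOn (fun x => (g x) ^ 2) (Ioo a b)

/-- Zero-trace weak derivative on `(a,b)`: `g ∈ W₀^{1,1}(a,b)` with weak derivative `g'`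
(integration by parts against all smooth test functions, with no boundary terms). -/
def WeakDerivZ (a b : ℝ) (g g' : ℝ → ℝ) : Prop :=
  ∀ ψ : ℝ → ℝ, ContDiff ℝ (⊤ : ℕ∞) ψ →
    ∫ x in Ioo a b, g x * deriv ψ x = - ∫ x in Ioo a b, g' x * ψ x

/-- Interior weak derivative on `(a,b)`: `g ∈ W^{1,1}(a,b)` with weak derivative `g'`. -/
def WeakDerivI (a b : ℝ) (g g' : ℝ → ℝ) : Prop :=
  ∀ ψ : ℝ → ℝ, ContDiff ℝ (⊤ : ℕ∞) ψ → tsupport ψ ⊆ Ioo a b →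
    ∫ x in Ioo a b, g x * deriv ψ x = - ∫ x in Ioo a b, g' x * ψ x

/-- Hypothesis (F) on the nonlinearity `f`, where `f'`, `f''` denote its first and second
derivatives on `[0,∞)`: `f ∈ C²([0,∞))`, `f(0)=0`, `f' > 0` on `[0,∞)`,
and `f' ∈ W^{1,∞}((0,∞))` (i.e. `f'` and `f''` are bounded). -/
structure HypF (f f' f'' : ℝ → ℝ) : Prop where
  hasDeriv₁ : ∀ x ∈ Ici (0 : ℝ), HasDerivWithinAt f (f' x) (Ici 0) x
  hasDeriv₂ : ∀ x ∈ Ici (0 : ℝ), HasDerivWithinAt f' (f'' x) (Ici 0) x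
  cont₂ : ContinuousOn f'' (Ici 0)
  zero : f 0 = 0
  pos : ∀ x ∈ Ici (0 : ℝ), 0 < f' x
  bdd : ∃ M : ℝ, ∀ x ∈ Ici (0 : ℝ), |f' x| ≤ M ∧ |f'' x| ≤ M

/-- Partial derivative in the first (spatial) variable. -/
def pdx (w : ℝ → ℝ → ℝ) : ℝ → ℝ → ℝ := fun x t => deriv (fun y => w y t) x

/-- Partial derivative in the second (time) variable. -/
def pdt (w : ℝ → ℝ → ℝ) : ℝ → ℝ → ℝ := fun x t => deriv (fun s => w x s) t

/-- Test functions in `C₀^∞(Ω × [0,T))`. -/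
structure TestU (a b T : ℝ) (φ : ℝ → ℝ → ℝ) : Prop where
  smooth : ContDiff ℝ (⊤ : ℕ∞) (uncurry φ)
  suppx : ∃ K : Set ℝ, IsCompact K ∧ K ⊆ Ioo a b ∧ ∀ x t, x ∉ K → φ x t = 0
  suppt : ∃ T' : ℝ, T' < T ∧ ∀ x t, T' ≤ t → φ x t = 0

/-- Test functions in `C^∞(Ω̄ × [0,T))`, compactly supported in time. -/
structure TestT (T : ℝ) (φ : ℝ → ℝ → ℝ) : Prop where
  smooth : ContDiff ℝ (⊤ : ℕ∞) (uncurry φ)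
  suppt : ∃ T' : ℝ, T' < T ∧ ∀ x t, T' ≤ t → φ x t = 0

/-- Test functions in `C₀^∞(Ω × (0,T))`. -/
structure TestInt (a b T : ℝ) (φ : ℝ → ℝ → ℝ) : Prop where
  smooth : ContDiff ℝ (⊤ : ℕ∞) (uncurry φ)
  suppx : ∃ K : Set ℝ, IsCompact K ∧ K ⊆ Ioo a b ∧ ∀ x t, x ∉ K → φ x t = 0
  supptime : ∃ K : Set ℝ, IsCompact K ∧ K ⊆ Ioo 0 T ∧ ∀ x t, t ∉ K → φ x t = 0

/-- Definition (W): weak solution of (P) on `Ω × (0,T)`.  Here `ut`, `ux`, `Θx` denote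
the weak derivatives of `u` (in time and space) and of `Θ` (in space). -/
structure IsWeakSol (a b T : ℝ) (f f' : ℝ → ℝ) (u0 u0t Θ0 : ℝ → ℝ)
    (u ut ux Θ Θx : ℝ → ℝ → ℝ) : Prop where
  u_sliceL1 : ∀ t ∈ Icc 0 T, IntegrableOn (fun x => u x t) (Ioo a b)
  u_contL1 : ∀ t₀ ∈ Icc 0 T,
    Tendsto (fun t => ∫ x in Ioo a b, |u x t - u x t₀|) (nhdsWithin t₀ (Icc 0 T)) (nhds 0)
  u_int : IntegrableOn (fun p : ℝ × ℝ => u p.1 p.2) ((Ioo a b) ×ˢ (Ioo 0 T))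
  ux_int : IntegrableOn (fun p : ℝ × ℝ => ux p.1 p.2) ((Ioo a b) ×ˢ (Ioo 0 T))
  u_W0 : ∀ᵐ t ∂volume.restrict (Ioo 0 T), WeakDerivZ a b (fun x => u x t) (fun x => ux x t)
  Θ_int : IntegrableOn (fun p : ℝ × ℝ => Θ p.1 p.2) ((Ioo a b) ×ˢ (Ioo 0 T))
  Θx_int : IntegrableOn (fun p : ℝ × ℝ => Θx p.1 p.2) ((Ioo a b) ×ˢ (Ioo 0 T))
  Θ_W : ∀ᵐ t ∂volume.restrict (Ioo 0 T), WeakDerivI a b (fun x => Θ x t) (fun x => Θx x t)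
  Θ_nonneg : ∀ᵐ p ∂volume.restrict ((Ioo a b) ×ˢ (Ioo 0 T)), 0 ≤ Θ p.1 p.2
  ut_weak : ∀ φ : ℝ → ℝ → ℝ, TestInt a b T φ →
    intOmT a b T (fun x t => u x t * pdt φ x t) = - intOmT a b T (fun x t => ut x t * φ x t)
  ut_int : IntegrableOn (fun p : ℝ × ℝ => ut p.1 p.2) ((Ioo a b) ×ˢ (Ioo 0 T))
  g1_int : IntegrableOn (fun p : ℝ × ℝ => f' (Θ p.1 p.2) * Θx p.1 p.2)
    ((Ioo a b) ×ˢ (Ioo 0 T))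
  g2_int : IntegrableOn (fun p : ℝ × ℝ => f' (Θ p.1 p.2) * Θx p.1 p.2 * ut p.1 p.2)
    ((Ioo a b) ×ˢ (Ioo 0 T))
  g3_int : IntegrableOn (fun p : ℝ × ℝ => f (Θ p.1 p.2) * ut p.1 p.2)
    ((Ioo a b) ×ˢ (Ioo 0 T))
  weak_u : ∀ φ : ℝ → ℝ → ℝ, TestU a b T φ →
    intOmT a b T (fun x t => u x t * pdt (pdt φ) x t)
        - intOm a b (fun x => u0t x * φ x 0) + intOm a b (fun x => u0 x * pdt φ x 0)
      = - intOmT a b T (fun x t => ux x t * pdx φ x t)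
        - intOmT a b T (fun x t => f' (Θ x t) * Θx x t * φ x t)
  weak_Θ : ∀ φ : ℝ → ℝ → ℝ, TestT T φ →
    - intOmT a b T (fun x t => Θ x t * pdt φ x t) - intOm a b (fun x => Θ0 x * φ x 0)
      = - intOmT a b T (fun x t => Θx x t * pdx φ x t)
        + intOmT a b T (fun x t => f' (Θ x t) * Θx x t * ut x t * φ x t)
        + intOmT a b T (fun x t => f (Θ x t) * ut x t * pdx φ x t)

/-- Continuity of `t ↦ w(·,t)` as a map `J → L²(Ω)` (with slices in `L²(Ω)`). -/
def ContL2 (a b : ℝ) (J : Set ℝ) (w : ℝ → ℝ → ℝ) : Prop :=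
  (∀ t ∈ J, MemL2 a b (fun x => w x t)) ∧
    ∀ t₀ ∈ J, Tendsto (fun t => ∫ x in Ioo a b, (w x t - w x t₀) ^ 2)
      (nhdsWithin t₀ J) (nhds 0)

/-- The regularity class (R_T):  `u ∈ C⁰([0,T];W₀^{1,2})`, `u_t ∈ C⁰([0,T];L²)`,
`Θ ∈ C⁰([0,T];L²) ∩ L²((0,T);W^{1,2})`. -/
structure RegT (a b T : ℝ) (u ut ux Θ Θx : ℝ → ℝ → ℝ) : Prop where
  u_cont : ContL2 a b (Icc 0 T) u
  ux_cont : ContL2 a b (Icc 0 T) ux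
  u_W0 : ∀ t ∈ Icc (0 : ℝ) T, WeakDerivZ a b (fun x => u x t) (fun x => ux x t)
  ut_cont : ContL2 a b (Icc 0 T) ut
  Θ_cont : ContL2 a b (Icc 0 T) Θ
  Θ_sq_int : IntegrableOn (fun p : ℝ × ℝ => (Θ p.1 p.2) ^ 2) ((Ioo a b) ×ˢ (Ioo 0 T))
  Θx_sq_int : IntegrableOn (fun p : ℝ × ℝ => (Θx p.1 p.2) ^ 2) ((Ioo a b) ×ˢ (Ioo 0 T))

/-- Data hypothesis (I), with `u0x` the weak derivative of `u0 ∈ W₀^{1,2}(Ω)`. -/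
structure DataI (a b : ℝ) (u0 u0x u0t Θ0 : ℝ → ℝ) : Prop where
  u0_L2 : MemL2 a b u0
  u0x_L2 : MemL2 a b u0x
  u0_W0 : WeakDerivZ a b u0 u0x
  u0t_L2 : MemL2 a b u0t
  Θ0_L2 : MemL2 a b Θ0
  Θ0_nonneg : ∀ᵐ x ∂volume.restrict (Ioo a b), 0 ≤ Θ0 x

/-- Smooth-data hypothesis (I∞). -/
structure SmoothData (a b : ℝ) (v0 u0 Θ0 : ℝ → ℝ) : Prop where
  v0_smooth : ContDiff ℝ (⊤ : ℕ∞) v0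
  v0_supp : ∃ K : Set ℝ, IsCompact K ∧ K ⊆ Ioo a b ∧ ∀ x, x ∉ K → v0 x = 0
  u0_smooth : ContDiff ℝ (⊤ : ℕ∞) u0
  u0_supp : ∃ K : Set ℝ, IsCompact K ∧ K ⊆ Ioo a b ∧ ∀ x, x ∉ K → u0 x = 0
  Θ0_smooth : ContDiff ℝ (⊤ : ℕ∞) Θ0
  Θ0_pos : ∀ x ∈ Icc a b, 0 < Θ0 x
  Θ0x_supp : ∃ K : Set ℝ, IsCompact K ∧ K ⊆ Ioo a b ∧ ∀ x, x ∉ K → deriv Θ0 x = 0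

/-- Classical solution of the regularized problem (P_ε), of class
`C^{4,1} × C^{2,1} × C^{2,1}(Ω̄ × [0,∞))`, with positive temperature. -/
structure IsClassicalSolEps (a b : ℝ) (f : ℝ → ℝ) (ε : ℝ) (v0 u0 Θ0 : ℝ → ℝ)
    (v u Θ : ℝ → ℝ → ℝ) : Prop where
  diffx_v : ∀ k < 4, ∀ x ∈ Icc a b, ∀ t ∈ Ici (0 : ℝ),
    DifferentiableAt ℝ (fun y => pdx^[k] v y t) x
  difft_v : ∀ x ∈ Icc a b, ∀ t ∈ Ici (0 : ℝ), DifferentiableAt ℝ (fun s => v x s) t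
  cont_v : ∀ k ≤ 4, ContinuousOn (uncurry (pdx^[k] v)) ((Icc a b) ×ˢ (Ici 0))
  contt_v : ContinuousOn (uncurry (pdt v)) ((Icc a b) ×ˢ (Ici 0))
  diffx_u : ∀ k < 2, ∀ x ∈ Icc a b, ∀ t ∈ Ici (0 : ℝ),
    DifferentiableAt ℝ (fun y => pdx^[k] u y t) x
  difft_u : ∀ x ∈ Icc a b, ∀ t ∈ Ici (0 : ℝ), DifferentiableAt ℝ (fun s => u x s) t
  cont_u : ∀ k ≤ 2, ContinuousOn (uncurry (pdx^[k] u)) ((Icc a b) ×ˢ (Ici 0))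
  contt_u : ContinuousOn (uncurry (pdt u)) ((Icc a b) ×ˢ (Ici 0))
  diffx_Θ : ∀ k < 2, ∀ x ∈ Icc a b, ∀ t ∈ Ici (0 : ℝ),
    DifferentiableAt ℝ (fun y => pdx^[k] Θ y t) x
  difft_Θ : ∀ x ∈ Icc a b, ∀ t ∈ Ici (0 : ℝ), DifferentiableAt ℝ (fun s => Θ x s) t
  cont_Θ : ∀ k ≤ 2, ContinuousOn (uncurry (pdx^[k] Θ)) ((Icc a b) ×ˢ (Ici 0))
  contt_Θ : ContinuousOn (uncurry (pdt Θ)) ((Icc a b) ×ˢ (Ici 0))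
  Θ_pos : ∀ x ∈ Icc a b, ∀ t ∈ Ici (0 : ℝ), 0 < Θ x t
  eq_v : ∀ x ∈ Ioo a b, ∀ t ∈ Ioi (0 : ℝ),
    pdt v x t = -ε * pdx^[4] v x t + pdx^[2] u x t - pdx (fun y s => f (Θ y s)) x t
  eq_u : ∀ x ∈ Ioo a b, ∀ t ∈ Ioi (0 : ℝ), pdt u x t = ε * pdx^[2] u x t + v x t
  eq_Θ : ∀ x ∈ Ioo a b, ∀ t ∈ Ioi (0 : ℝ),
    pdt Θ x t = pdx^[2] Θ x t - f (Θ x t) * pdx v x t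
  bc_v : ∀ t ∈ Ioi (0 : ℝ),
    v a t = 0 ∧ v b t = 0 ∧ pdx^[2] v a t = 0 ∧ pdx^[2] v b t = 0
  bc_u : ∀ t ∈ Ioi (0 : ℝ), u a t = 0 ∧ u b t = 0
  bc_Θ : ∀ t ∈ Ioi (0 : ℝ), pdx Θ a t = 0 ∧ pdx Θ b t = 0
  init : ∀ x ∈ Icc a b, v x 0 = v0 x ∧ u x 0 = u0 x ∧ Θ x 0 = Θ0 x

/-- Weak convergence in `L²_loc(Ω̄ × [0,∞))`. -/
def WkL2loc (a b : ℝ) (wj : ℕ → ℝ → ℝ → ℝ) (w : ℝ → ℝ → ℝ) : Prop :=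
  ∀ T > (0 : ℝ), ∀ ψ : ℝ → ℝ → ℝ,
    AEStronglyMeasurable (fun p : ℝ × ℝ => ψ p.1 p.2)
      (volume.restrict ((Icc a b) ×ˢ (Icc 0 T))) →
    IntegrableOn (fun p : ℝ × ℝ => (ψ p.1 p.2) ^ 2) ((Icc a b) ×ˢ (Icc 0 T)) →
    Tendsto (fun j => ∫ p in (Icc a b) ×ˢ (Icc 0 T), wj j p.1 p.2 * ψ p.1 p.2) atTop
      (nhds (∫ p in (Icc a b) ×ˢ (Icc 0 T), w p.1 p.2 * ψ p.1 p.2))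

/-- Cauchy–Schwarz inequality for square-integrable real functions. -/
lemma integral_abs_mul_le_sqrt {α : Type*} [MeasurableSpace α] {μ : Measure α} {f g : α → ℝ}
    (hf : MemLp f 2 μ) (hg : MemLp g 2 μ) :
    ∫ x, |f x * g x| ∂μ ≤ √(∫ x, f x ^ 2 ∂μ) * √(∫ x, g x ^ 2 ∂μ) := by
  have hfg : Integrable (fun x => |f x * g x|) μ := (hf.integrable_mul hg).abs
  have hf2 := hf.integrable_sq
  have hg2 := hg.integrable_sq
  have key : ∀ s : ℝ, 0 ≤ (∫ x, g x ^ 2 ∂μ) * (s * s) + (2 * ∫ x, |f x * g x| ∂μ) * s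
      + ∫ x, f x ^ 2 ∂μ := by
    intro s
    have : ∫ x, (|f x| + s * |g x|) ^ 2 ∂μ = (∫ x, g x ^ 2 ∂μ) * (s * s)
        + (2 * ∫ x, |f x * g x| ∂μ) * s + ∫ x, f x ^ 2 ∂μ := by
      rw [← integral_mul_const, ← integral_const_mul, ← integral_mul_const, ← integral_add,
        ← integral_add]
      · congr 1; ext x; rw [abs_mul]
        nlinarith [sq_abs (f x), sq_abs (g x)]
      · exact (hg2.mul_const _).add ((hfg.const_mul _).mul_const _)
      · exact hf2
      · exact hg2.mul_const _
      · exact (hfg.const_mul _).mul_const _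
    rw [← this]
    exact integral_nonneg fun x => sq_nonneg _
  have hd := discrim_le_zero key
  have h0 : 0 ≤ ∫ x, |f x * g x| ∂μ := integral_nonneg fun x => abs_nonneg _
  rw [← Real.sqrt_mul (integral_nonneg fun x => sq_nonneg _)]
  apply Real.le_sqrt_of_sq_le
  unfold discrim at hd
  nlinarith

lemma abs_integral_mul_le_sqrt {α : Type*} [MeasurableSpace α] {μ : Measure α} {f g : α → ℝ}
    (hf : MemLp f 2 μ) (hg : MemLp g 2 μ) :
    |∫ x, f x * g x ∂μ| ≤ √(∫ x, f x ^ 2 ∂μ) * √(∫ x, g x ^ 2 ∂μ) :=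
  abs_integral_le_integral_abs.trans (integral_abs_mul_le_sqrt hf hg)

lemma ContinuousOn.memLp_two_Icc {a b : ℝ} {f : ℝ → ℝ} (hf : ContinuousOn f (Icc a b)) :
    MemLp f 2 (volume.restrict (Ioc a b)) := by
  rw [memLp_two_iff_integrable_sq]
  · exact ((hf.pow 2).integrableOn_Icc).mono_set Ioc_subset_Icc_self
  · exact (hf.mono Ioc_subset_Icc_self).aestronglyMeasurable measurableSet_Ioc

lemma ContinuousOn.ii {a b : ℝ} (hab : a ≤ b) {f : ℝ → ℝ} (hf : ContinuousOn f (Icc a b)) :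
    IntervalIntegrable f volume a b :=
  ContinuousOn.intervalIntegrable (by rwa [uIcc_of_le hab])

/-- Cauchy–Schwarz inequality on an interval. -/
lemma intervalIntegral_abs_mul_le_sqrt {a b : ℝ} (hab : a ≤ b) {f g : ℝ → ℝ}
    (hf : ContinuousOn f (Icc a b)) (hg : ContinuousOn g (Icc a b)) :
    ∫ x in a..b, |f x * g x| ≤ √(∫ x in a..b, f x ^ 2) * √(∫ x in a..b, g x ^ 2) := by
  simp only [intervalIntegral.integral_of_le hab]
  exact integral_abs_mul_le_sqrt hf.memLp_two_Icc hg.memLp_two_Icc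

lemma ii_sq_nonneg {a b : ℝ} (hab : a ≤ b) (f : ℝ → ℝ) : 0 ≤ ∫ x in a..b, f x ^ 2 :=
  intervalIntegral.integral_nonneg hab fun _ _ => sq_nonneg _

/-- Integration by parts with vanishing boundary terms. -/
lemma integral_parts_zero {a b : ℝ} (hab : a ≤ b) {p p' q q' : ℝ → ℝ}
    (hp : ∀ x ∈ Icc a b, HasDerivAt p (p' x) x) (hq : ∀ x ∈ Icc a b, HasDerivAt q (q' x) x)
    (hp' : ContinuousOn p' (Icc a b)) (hq' : ContinuousOn q' (Icc a b))
    (ha : p a * q a = 0) (hb : p b * q b = 0) :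
    ∫ x in a..b, p x * q' x = - ∫ x in a..b, p' x * q x := by
  have := intervalIntegral.integral_mul_deriv_eq_deriv_mul (a := a) (b := b) (u := p) (v := q)
    (u' := p') (v' := q') (by rwa [uIcc_of_le hab]) (by rwa [uIcc_of_le hab])
    (hp'.ii hab) (hq'.ii hab)
  rw [this, ha, hb]; ring

lemma abs_sub_le_integral_abs_deriv {a b : ℝ} {p p' : ℝ → ℝ}
    (hp : ∀ x ∈ Icc a b, HasDerivAt p (p' x) x) (hp' : ContinuousOn p' (Icc a b))
    {x y : ℝ} (hx : x ∈ Icc a b) (hy : y ∈ Icc a b) (hxy : x ≤ y) :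
    |p y - p x| ≤ ∫ z in x..y, |p' z| := by
  have hs : Icc x y ⊆ Icc a b := Icc_subset_Icc hx.1 hy.2
  rw [← intervalIntegral.integral_eq_sub_of_hasDerivAt (f := p) (f' := p')
    (by rw [uIcc_of_le hxy]; exact fun z hz => hp z (hs hz)) ((hp'.mono hs).ii hxy)]
  exact intervalIntegral.abs_integral_le_integral_abs hxy

lemma integral_mono_interval_of_nonneg {a b x y : ℝ} {g : ℝ → ℝ} (hg : ContinuousOn g (Icc a b))
    (h0 : ∀ z ∈ Icc a b, 0 ≤ g z) (hx : x ∈ Icc a b) (hy : y ∈ Icc a b) (hxy : x ≤ y) :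
    ∫ z in x..y, g z ≤ ∫ z in a..b, g z := by
  have hab : a ≤ b := hx.1.trans hx.2
  refine intervalIntegral.integral_mono_interval hx.1 hxy hy.2 ?_ (hg.ii hab)
  filter_upwards [ae_restrict_mem measurableSet_Ioc] with z hz using h0 z ⟨hz.1.le, hz.2⟩

lemma abs_sub_le_sqrt_mul {a b : ℝ} {p p' : ℝ → ℝ}
    (hp : ∀ x ∈ Icc a b, HasDerivAt p (p' x) x) (hp' : ContinuousOn p' (Icc a b))
    {x y : ℝ} (hx : x ∈ Icc a b) (hy : y ∈ Icc a b) :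
    |p y - p x| ≤ √|y - x| * √(∫ z in a..b, p' z ^ 2) := by
  wlog hxy : x ≤ y generalizing x y
  · rw [abs_sub_comm, abs_sub_comm y]; exact this hy hx (le_of_not_ge hxy)
  have hs : Icc x y ⊆ Icc a b := Icc_subset_Icc hx.1 hy.2
  calc |p y - p x| ≤ ∫ z in x..y, |p' z| := abs_sub_le_integral_abs_deriv hp hp' hx hy hxy
    _ = ∫ z in x..y, |1 * p' z| := by simp
    _ ≤ √(∫ z in x..y, (1 : ℝ) ^ 2) * √(∫ z in x..y, p' z ^ 2) :=
        intervalIntegral_abs_mul_le_sqrt hxy continuousOn_const (hp'.mono hs)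
    _ ≤ √|y - x| * √(∫ z in a..b, p' z ^ 2) := by
        gcongr
        · simp [le_abs_self]
        · exact integral_mono_interval_of_nonneg (hp'.pow 2) (fun _ _ => sq_nonneg _) hx hy hxy

lemma le_average_add {a b : ℝ} (hab : a < b) {g : ℝ → ℝ} (hg : ContinuousOn g (Icc a b)) {R X : ℝ}
    (h : ∀ y ∈ Icc a b, X ≤ g y + R) : X ≤ (b - a)⁻¹ * (∫ y in a..b, g y) + R := by
  have hL : 0 < b - a := sub_pos.2 hab
  have h1 : ∫ _y in a..b, X ≤ ∫ y in a..b, (g y + R) :=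
    intervalIntegral.integral_mono_on hab.le (by simp) ((hg.add continuousOn_const).ii hab.le) h
  rw [intervalIntegral.integral_add (hg.ii hab.le) (by simp)] at h1
  simp only [intervalIntegral.integral_const, smul_eq_mul] at h1
  have : X = (b - a)⁻¹ * ((b - a) * X) := by field_simp
  rw [this]
  calc (b - a)⁻¹ * ((b - a) * X) ≤ (b - a)⁻¹ * ((∫ y in a..b, g y) + (b - a) * R) := by gcongr
    _ = _ := by field_simp

/-- One-dimensional Agmon inequality. -/
lemma sq_le_agmon {a b : ℝ} (hab : a < b) {p p' : ℝ → ℝ}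
    (hp : ∀ x ∈ Icc a b, HasDerivAt p (p' x) x) (hp' : ContinuousOn p' (Icc a b))
    {x : ℝ} (hx : x ∈ Icc a b) :
    p x ^ 2 ≤ (b - a)⁻¹ * (∫ z in a..b, p z ^ 2)
      + 2 * (√(∫ z in a..b, p z ^ 2) * √(∫ z in a..b, p' z ^ 2)) := by
  have hpc : ContinuousOn p (Icc a b) := fun z hz => (hp z hz).continuousAt.continuousWithinAt
  have hd : ∀ z ∈ Icc a b, HasDerivAt (fun z => p z ^ 2) (2 * (p z * p' z)) z := by
    intro z hz
    exact ((hp z hz).pow 2).congr_deriv (by norm_num; ring)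
  have hdc : ContinuousOn (fun z => 2 * (p z * p' z)) (Icc a b) :=
    continuousOn_const.mul (hpc.mul hp')
  have hI : ∀ y ∈ Icc a b, |p x ^ 2 - p y ^ 2| ≤ ∫ z in a..b, |2 * (p z * p' z)| := by
    intro y hy
    rcases le_total x y with h | h
    · rw [abs_sub_comm]
      exact (abs_sub_le_integral_abs_deriv hd hdc hx hy h).trans
        (integral_mono_interval_of_nonneg hdc.abs (fun _ _ => abs_nonneg _) hx hy h)
    · exact (abs_sub_le_integral_abs_deriv hd hdc hy hx h).trans
        (integral_mono_interval_of_nonneg hdc.abs (fun _ _ => abs_nonneg _) hy hx h)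
  have hcs : ∫ z in a..b, |2 * (p z * p' z)|
      ≤ 2 * (√(∫ z in a..b, p z ^ 2) * √(∫ z in a..b, p' z ^ 2)) := by
    simp only [abs_mul, abs_two, intervalIntegral.integral_const_mul]
    simp only [← abs_mul]
    gcongr
    exact intervalIntegral_abs_mul_le_sqrt hab.le hpc hp'
  refine (le_average_add hab (g := fun z => p z ^ 2) (hpc.pow 2) (R := ∫ z in a..b, |2 * (p z * p' z)|) ?_).trans ?_
  · intro y hy
    have := (abs_le.1 (hI y hy)).2
    linarith
  · linarith

lemma abs_le_mean_add {a b : ℝ} (hab : a < b) {p p' : ℝ → ℝ}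
    (hp : ∀ x ∈ Icc a b, HasDerivAt p (p' x) x) (hp' : ContinuousOn p' (Icc a b))
    {x : ℝ} (hx : x ∈ Icc a b) :
    |p x| ≤ (b - a)⁻¹ * (∫ z in a..b, |p z|) + √(b - a) * √(∫ z in a..b, p' z ^ 2) := by
  have hpc : ContinuousOn p (Icc a b) := fun z hz => (hp z hz).continuousAt.continuousWithinAt
  refine le_average_add hab hpc.abs ?_
  intro y hy
  have h1 := abs_sub_le_sqrt_mul hp hp' hy hx
  have h2 : √|x - y| ≤ √(b - a) := by
    apply Real.sqrt_le_sqrt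
    rw [abs_le]; constructor <;> linarith [hx.1, hx.2, hy.1, hy.2]
  have h3 : |p x| ≤ |p y| + |p x - p y| := by
    have := abs_add_le (p y) (p x - p y); simpa using this
  nlinarith [mul_le_mul_of_nonneg_right h2 (Real.sqrt_nonneg (∫ z in a..b, p' z ^ 2))]

/-- A globally defined `C^{1,1}` nonlinearity vanishing at the origin. -/
structure Nonlin (F F' : ℝ → ℝ) (M : ℝ) : Prop where
  deriv : ∀ x, HasDerivAt F (F' x) x
  bound : ∀ x, |F' x| ≤ M
  lip : ∀ x y, |F' x - F' y| ≤ M * |x - y|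
  zero : F 0 = 0

namespace Nonlin
variable {F F' : ℝ → ℝ} {M : ℝ}

lemma nonneg (h : Nonlin F F' M) : 0 ≤ M := (abs_nonneg _).trans (h.bound 0)

lemma continuous (h : Nonlin F F' M) : Continuous F :=
  continuous_iff_continuousAt.2 fun x => (h.deriv x).continuousAt

lemma continuous_deriv (h : Nonlin F F' M) : Continuous F' := by
  have : LipschitzWith M.toNNReal F' := LipschitzWith.of_dist_le_mul fun x y => by
    rw [Real.coe_toNNReal _ h.nonneg, Real.dist_eq, Real.dist_eq]
    exact h.lip x y
  exact this.continuous

lemma abs_sub_le (h : Nonlin F F' M) (x y : ℝ) : |F x - F y| ≤ M * |x - y| := by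
  have := Convex.norm_image_sub_le_of_norm_hasDerivWithin_le (f := F) (f' := F') (C := M)
    (s := univ) (fun z _ => (h.deriv z).hasDerivWithinAt)
    (fun z _ => by simpa using h.bound z) convex_univ (mem_univ y) (mem_univ x)
  simpa using this

lemma abs_le (h : Nonlin F F' M) (x : ℝ) : |F x| ≤ M * |x| := by
  simpa [h.zero] using h.abs_sub_le x 0

lemma abs_flux_le (h : Nonlin F F' M) (p P dp dP : ℝ) :
    |F' p * dp - F' P * dP| ≤ M * |dp - dP| + M * |p - P| * |dP| := by
  have : F' p * dp - F' P * dP = F' p * (dp - dP) + (F' p - F' P) * dP := by ring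
  rw [this]
  refine (abs_add_le _ _).trans ?_
  rw [abs_mul, abs_mul]
  gcongr
  · exact h.bound p
  · exact h.lip p P

end Nonlin

lemma hasDerivAt_continuousOn {a b : ℝ} {p p' : ℝ → ℝ}
    (hp : ∀ x ∈ Icc a b, HasDerivAt p (p' x) x) : ContinuousOn p (Icc a b) :=
  fun z hz => (hp z hz).continuousAt.continuousWithinAt

lemma theta_absorb {M A c m l y p q B S S' : ℝ} (hM : 0 ≤ M) (hA : 0 ≤ A) (hc : 0 ≤ c)
    (hB : 0 ≤ B) (hS' : 0 ≤ S')
    (h : S ^ 2 ≤ c * q ^ 2 + 2 * (q * y)) (h' : S' ≤ m + l * B) :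
    -y ^ 2 + (2 * M * S * (A * y) + M * S ^ 2 * (A * B) + M * S' * (p * y) + M * S * (p * B))
      ≤ -(1 / 4) * y ^ 2 + (8 * M ^ 2 * A ^ 2 * c + 512 * M ^ 4 * A ^ 4 + M * A * c
        + 8 * M ^ 2 * A ^ 2 + 4 * M ^ 2 * (m ^ 2 + l ^ 2) + c + 8 + M ^ 2)
        * ((1 + B ^ 2) * (p ^ 2 + q ^ 2)) := by
  have e1 : 2 * M * S * (A * y) ≤ y ^ 2 / 8 + 8 * M ^ 2 * A ^ 2 * S ^ 2 := by
    nlinarith [sq_nonneg (y - 8 * (M * A * S))]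
  have e2 : 8 * M ^ 2 * A ^ 2 * S ^ 2 ≤ 8 * M ^ 2 * A ^ 2 * (c * q ^ 2 + 2 * (q * y)) := by gcongr
  have e3 : 16 * M ^ 2 * A ^ 2 * (q * y) ≤ y ^ 2 / 8 + 512 * M ^ 4 * A ^ 4 * q ^ 2 := by
    nlinarith [sq_nonneg (y - 64 * (M ^ 2 * A ^ 2 * q))]
  have e4 : M * S ^ 2 * (A * B) ≤ M * (c * q ^ 2 + 2 * (q * y)) * (A * B) := by gcongr
  have e5 : 2 * M * A * B * (q * y) ≤ y ^ 2 / 8 + 8 * M ^ 2 * A ^ 2 * B ^ 2 * q ^ 2 := by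
    nlinarith [sq_nonneg (y - 8 * (M * A * B * q))]
  have e6 : M * S' * (p * y) ≤ y ^ 2 / 8 + 2 * M ^ 2 * p ^ 2 * S' ^ 2 := by
    nlinarith [sq_nonneg (y - 4 * (M * S' * p))]
  have e7 : S' ^ 2 ≤ 2 * (m ^ 2 + l ^ 2) * (1 + B ^ 2) := by
    calc S' ^ 2 ≤ (m + l * B) ^ 2 := by gcongr
      _ ≤ _ := by nlinarith [sq_nonneg (m - l * B), sq_nonneg m, sq_nonneg l, sq_nonneg (m * B)]
  have e8 : 2 * M ^ 2 * p ^ 2 * S' ^ 2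
      ≤ 2 * M ^ 2 * p ^ 2 * (2 * (m ^ 2 + l ^ 2) * (1 + B ^ 2)) := by gcongr
  have e9 : M * S * (p * B) ≤ S ^ 2 + M ^ 2 * p ^ 2 * B ^ 2 := by
    nlinarith [sq_nonneg (S - M * p * B), sq_nonneg (M * p * B), sq_nonneg S]
  have e10 : 2 * (q * y) ≤ y ^ 2 / 8 + 8 * q ^ 2 := by nlinarith [sq_nonneg (y - 8 * q)]
  have e11 : B ≤ 1 + B ^ 2 := by nlinarith [sq_nonneg (B - 1)]
  have hP : 0 ≤ p ^ 2 := sq_nonneg p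
  have hQ : 0 ≤ q ^ 2 := sq_nonneg q
  have hBB : 0 ≤ B ^ 2 := sq_nonneg B
  obtain ⟨E, hE⟩ : ∃ E, E = (1 + B ^ 2) * (p ^ 2 + q ^ 2) := ⟨_, rfl⟩
  rw [← hE]
  have hBP := mul_nonneg hBB hP
  have hBQ := mul_nonneg hBB hQ
  have b1 : q ^ 2 ≤ E := by rw [hE]; linarith
  have b2 : B * q ^ 2 ≤ E := by
    rw [hE]; linarith [mul_le_mul_of_nonneg_right e11 hQ]
  have b3 : B ^ 2 * q ^ 2 ≤ E := by rw [hE]; linarith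
  have b4 : (1 + B ^ 2) * p ^ 2 ≤ E := by rw [hE]; linarith
  have b5 : p ^ 2 * B ^ 2 ≤ E := by rw [hE]; linarith
  have t1 := mul_le_mul_of_nonneg_left b1 (by positivity : 0 ≤ 8 * M ^ 2 * A ^ 2 * c)
  have t2 := mul_le_mul_of_nonneg_left b1 (by positivity : 0 ≤ 512 * M ^ 4 * A ^ 4)
  have t3 := mul_le_mul_of_nonneg_left b2 (by positivity : 0 ≤ M * A * c)
  have t4 := mul_le_mul_of_nonneg_left b3 (by positivity : 0 ≤ 8 * M ^ 2 * A ^ 2)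
  have t5 := mul_le_mul_of_nonneg_left b4 (by positivity : 0 ≤ 4 * M ^ 2 * (m ^ 2 + l ^ 2))
  have t6 := mul_le_mul_of_nonneg_left b1 (by positivity : 0 ≤ c + 8)
  have t7 := mul_le_mul_of_nonneg_left b5 (by positivity : 0 ≤ M ^ 2)
  linarith [sq_nonneg y]

lemma wave_absorb {M c y p q B S : ℝ} (hc : 0 ≤ c)
    (h : S ^ 2 ≤ c * q ^ 2 + 2 * (q * y)) :
    M * (p * y) + M * S * (p * B)
      ≤ (1 / 8) * y ^ 2 + (5 * M ^ 2 + c + 4) * ((1 + B ^ 2) * (p ^ 2 + q ^ 2)) := by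
  have e1 : M * (p * y) ≤ y ^ 2 / 16 + 4 * M ^ 2 * p ^ 2 := by
    nlinarith [sq_nonneg (y - 8 * (M * p))]
  have e9 : M * S * (p * B) ≤ S ^ 2 / 2 + M ^ 2 * p ^ 2 * B ^ 2 / 2 := by
    nlinarith [sq_nonneg (S - M * p * B)]
  have e10 : q * y ≤ y ^ 2 / 16 + 4 * q ^ 2 := by nlinarith [sq_nonneg (y - 8 * q)]
  have hP : 0 ≤ p ^ 2 := sq_nonneg p
  have hQ : 0 ≤ q ^ 2 := sq_nonneg q
  have hBB : 0 ≤ B ^ 2 := sq_nonneg B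
  have hBP := mul_nonneg hBB hP
  have hBQ := mul_nonneg hBB hQ
  obtain ⟨E, hE⟩ : ∃ E, E = (1 + B ^ 2) * (p ^ 2 + q ^ 2) := ⟨_, rfl⟩
  rw [← hE]
  have b0 : p ^ 2 ≤ E := by rw [hE]; linarith
  have b1 : q ^ 2 ≤ E := by rw [hE]; linarith
  have b5 : p ^ 2 * B ^ 2 ≤ E := by rw [hE]; linarith
  have t1 := mul_le_mul_of_nonneg_left b0 (by positivity : 0 ≤ 4 * M ^ 2)
  have t6 := mul_le_mul_of_nonneg_left b1 (by positivity : 0 ≤ c + 4)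
  have t7 := mul_le_mul_of_nonneg_left b5 (by positivity : 0 ≤ M ^ 2)
  have t8 := mul_nonneg hc hQ
  have t9 := mul_nonneg (sq_nonneg M) (mul_nonneg hP hBB)
  linarith

/-- Dissipation estimate for the difference of two temperature profiles. -/
lemma theta_energy {a b : ℝ} (hab : a < b) {F F' : ℝ → ℝ} {M : ℝ} (hF : Nonlin F F' M)
    {A m : ℝ} (hA : 0 ≤ A) : ∃ C, 0 ≤ C ∧ ∀ v dv V dV p dp ddp P dP ddP : ℝ → ℝ,
    (∀ x ∈ Icc a b, HasDerivAt v (dv x) x) → (∀ x ∈ Icc a b, HasDerivAt V (dV x) x) →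
    (∀ x ∈ Icc a b, HasDerivAt p (dp x) x) → (∀ x ∈ Icc a b, HasDerivAt dp (ddp x) x) →
    (∀ x ∈ Icc a b, HasDerivAt P (dP x) x) → (∀ x ∈ Icc a b, HasDerivAt dP (ddP x) x) →
    ContinuousOn dv (Icc a b) → ContinuousOn dV (Icc a b) → ContinuousOn ddp (Icc a b) →
    ContinuousOn ddP (Icc a b) → v a = 0 → v b = 0 → V a = 0 → V b = 0 → dp a = 0 → dp b = 0 →
    dP a = 0 → dP b = 0 → ∫ x in a..b, v x ^ 2 ≤ A ^ 2 → ∫ x in a..b, |P x| ≤ m →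
    ∫ x in a..b, (p x - P x) * ((ddp x - F (p x) * dv x) - (ddP x - F (P x) * dV x))
      ≤ -(1 / 4) * (∫ x in a..b, (dp x - dP x) ^ 2) + C * ((1 + ∫ x in a..b, dP x ^ 2) *
        ((∫ x in a..b, (v x - V x) ^ 2) + ∫ x in a..b, (p x - P x) ^ 2)) := by
  have hL : 0 < b - a := sub_pos.2 hab
  have hM := hF.nonneg
  refine ⟨8 * M ^ 2 * A ^ 2 * (b - a)⁻¹ + 512 * M ^ 4 * A ^ 4 + M * A * (b - a)⁻¹
        + 8 * M ^ 2 * A ^ 2 + 4 * M ^ 2 * (((b - a)⁻¹ * m) ^ 2 + √(b - a) ^ 2) + (b - a)⁻¹ + 8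
        + M ^ 2, by positivity, ?_⟩
  intro v dv V dV p dp ddp P dP ddP hv hV hp hdp hP hdP cdv cdV cddp cddP va vb Va Vb dpa dpb
    dPa dPb hvA hPm
  have cv := hasDerivAt_continuousOn hv
  have cV := hasDerivAt_continuousOn hV
  have cp := hasDerivAt_continuousOn hp
  have cP := hasDerivAt_continuousOn hP
  have cdp := hasDerivAt_continuousOn hdp
  have cdP := hasDerivAt_continuousOn hdP
  have cF := hF.continuous
  have cF' := hF.continuous_deriv
  have hθ : ∀ x ∈ Icc a b, HasDerivAt (fun x => p x - P x) (dp x - dP x) x :=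
    fun x hx => (hp x hx).sub (hP x hx)
  have hθ1 : ∀ x ∈ Icc a b, HasDerivAt (fun x => dp x - dP x) (ddp x - ddP x) x :=
    fun x hx => (hdp x hx).sub (hdP x hx)
  have hw : ∀ x ∈ Icc a b, HasDerivAt (fun x => v x - V x) (dv x - dV x) x :=
    fun x hx => (hv x hx).sub (hV x hx)
  have hFp : ∀ x ∈ Icc a b, HasDerivAt (fun x => F (p x)) (F' (p x) * dp x) x :=
    fun x hx => (hF.deriv (p x)).comp x (hp x hx)
  have hFP : ∀ x ∈ Icc a b, HasDerivAt (fun x => F (P x)) (F' (P x) * dP x) x :=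
    fun x hx => (hF.deriv (P x)).comp x (hP x hx)
  -- integrations by parts
  have i1 : ∫ x in a..b, (p x - P x) * (ddp x - ddP x)
      = - ∫ x in a..b, (dp x - dP x) * (dp x - dP x) :=
    integral_parts_zero hab.le hθ hθ1 (by fun_prop) (by fun_prop) (by simp [dpa, dPa])
      (by simp [dpb, dPb])
  have i2 : ∫ x in a..b, ((p x - P x) * (F (p x) - F (P x))) * dv x
      = - ∫ x in a..b, ((dp x - dP x) * (F (p x) - F (P x))
        + (p x - P x) * (F' (p x) * dp x - F' (P x) * dP x)) * v x :=
    integral_parts_zero hab.le (fun x hx => (hθ x hx).mul ((hFp x hx).sub (hFP x hx))) hv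
      (by fun_prop) (by fun_prop) (by simp [va]) (by simp [vb])
  have i3 : ∫ x in a..b, ((p x - P x) * F (P x)) * (dv x - dV x)
      = - ∫ x in a..b, ((dp x - dP x) * F (P x)
        + (p x - P x) * (F' (P x) * dP x)) * (v x - V x) :=
    integral_parts_zero hab.le (fun x hx => (hθ x hx).mul (hFP x hx)) hw
      (by fun_prop) (by fun_prop) (by simp [va, Va]) (by simp [vb, Vb])
  have hsplit : ∫ x in a..b, (p x - P x) * ((ddp x - F (p x) * dv x) - (ddP x - F (P x) * dV x))
      = (∫ x in a..b, (p x - P x) * (ddp x - ddP x))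
        - (∫ x in a..b, ((p x - P x) * (F (p x) - F (P x))) * dv x)
        - ∫ x in a..b, ((p x - P x) * F (P x)) * (dv x - dV x) := by
    rw [← intervalIntegral.integral_sub, ← intervalIntegral.integral_sub]
    · congr 1; ext x; ring
    all_goals exact ContinuousOn.ii hab.le (by fun_prop)
  set S := √((b - a)⁻¹ * (∫ z in a..b, (p z - P z) ^ 2)
      + 2 * (√(∫ z in a..b, (p z - P z) ^ 2) * √(∫ z in a..b, (dp z - dP z) ^ 2))) with hSdef
  set S' := (b - a)⁻¹ * (∫ z in a..b, |P z|) + √(b - a) * √(∫ z in a..b, dP z ^ 2) with hS'def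
  have n1 := ii_sq_nonneg hab.le (fun z => p z - P z)
  have n2 := ii_sq_nonneg hab.le (fun z => dp z - dP z)
  have n3 := ii_sq_nonneg hab.le dP
  have n4 := ii_sq_nonneg hab.le (fun z => v z - V z)
  have n5 : 0 ≤ ∫ z in a..b, |P z| := intervalIntegral.integral_nonneg hab.le fun _ _ => abs_nonneg _
  have hS0 : 0 ≤ S := Real.sqrt_nonneg _
  have hS2 : S ^ 2 = (b - a)⁻¹ * (∫ z in a..b, (p z - P z) ^ 2)
      + 2 * (√(∫ z in a..b, (p z - P z) ^ 2) * √(∫ z in a..b, (dp z - dP z) ^ 2)) :=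
    Real.sq_sqrt (by positivity)
  have hS'0 : 0 ≤ S' := by positivity
  have hθS : ∀ x ∈ Icc a b, |p x - P x| ≤ S := fun x hx =>
    Real.abs_le_sqrt (sq_le_agmon hab hθ (by fun_prop) hx)
  have hPS : ∀ x ∈ Icc a b, |P x| ≤ S' := fun x hx => abs_le_mean_add hab hP cdP hx
  -- pointwise bound
  have hpt : ∀ x ∈ Icc a b,
      ((dp x - dP x) * (F (p x) - F (P x))
        + (p x - P x) * (F' (p x) * dp x - F' (P x) * dP x)) * v x
      + ((dp x - dP x) * F (P x) + (p x - P x) * (F' (P x) * dP x)) * (v x - V x)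
      ≤ 2 * M * S * |v x * (dp x - dP x)| + M * S ^ 2 * |v x * dP x|
        + M * S' * |(v x - V x) * (dp x - dP x)| + M * S * |(v x - V x) * dP x| := by
    intro x hx
    have h1 := hθS x hx
    have h2 := hPS x hx
    have h3 : |F (p x) - F (P x)| ≤ M * S := (hF.abs_sub_le _ _).trans (by gcongr)
    have h4 : |F (P x)| ≤ M * S' := (hF.abs_le _).trans (by gcongr)
    have h5 : |F' (p x) * dp x - F' (P x) * dP x| ≤ M * |dp x - dP x| + M * S * |dP x| :=
      (hF.abs_flux_le _ _ _ _).trans (by gcongr)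
    have h6 : |F' (P x)| ≤ M := hF.bound _
    refine (le_abs_self _).trans ((abs_add_le _ _).trans ?_)
    simp only [abs_mul]
    have h7 : |(dp x - dP x) * (F (p x) - F (P x))
        + (p x - P x) * (F' (p x) * dp x - F' (P x) * dP x)|
        ≤ |dp x - dP x| * (M * S) + S * (M * |dp x - dP x| + M * S * |dP x|) := by
      refine (abs_add_le _ _).trans ?_
      simp only [abs_mul]
      gcongr
    have h8 : |(dp x - dP x) * F (P x) + (p x - P x) * (F' (P x) * dP x)|
        ≤ |dp x - dP x| * (M * S') + S * (M * |dP x|) := by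
      refine (abs_add_le _ _).trans ?_
      simp only [abs_mul]
      gcongr
    calc _ ≤ (|dp x - dP x| * (M * S) + S * (M * |dp x - dP x| + M * S * |dP x|)) * |v x|
          + (|dp x - dP x| * (M * S') + S * (M * |dP x|)) * |v x - V x| := by gcongr
      _ = _ := by ring
  have h_int := intervalIntegral.integral_mono_on hab.le (ContinuousOn.ii hab.le (by fun_prop))
    (ContinuousOn.ii hab.le (by fun_prop)) hpt
  rw [intervalIntegral.integral_add (ContinuousOn.ii hab.le (by fun_prop))
    (ContinuousOn.ii hab.le (by fun_prop)),
    intervalIntegral.integral_add (ContinuousOn.ii hab.le (by fun_prop))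
    (ContinuousOn.ii hab.le (by fun_prop)),
    intervalIntegral.integral_add (ContinuousOn.ii hab.le (by fun_prop))
    (ContinuousOn.ii hab.le (by fun_prop)),
    intervalIntegral.integral_add (ContinuousOn.ii hab.le (by fun_prop))
    (ContinuousOn.ii hab.le (by fun_prop))] at h_int
  simp only [intervalIntegral.integral_const_mul] at h_int
  have hsv : √(∫ x in a..b, v x ^ 2) ≤ A := Real.sqrt_le_iff.2 ⟨hA, hvA⟩
  have c1 : ∫ x in a..b, |v x * (dp x - dP x)| ≤ A * √(∫ z in a..b, (dp z - dP z) ^ 2) :=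
    (intervalIntegral_abs_mul_le_sqrt hab.le cv (by fun_prop)).trans (by gcongr)
  have c2 : ∫ x in a..b, |v x * dP x| ≤ A * √(∫ z in a..b, dP z ^ 2) :=
    (intervalIntegral_abs_mul_le_sqrt hab.le cv (by fun_prop)).trans (by gcongr)
  have c3 := intervalIntegral_abs_mul_le_sqrt hab.le (f := fun x => v x - V x)
    (g := fun x => dp x - dP x) (by fun_prop) (by fun_prop)
  have c4 := intervalIntegral_abs_mul_le_sqrt hab.le (f := fun x => v x - V x)
    (g := dP) (by fun_prop) (by fun_prop)
  have h_int2 := h_int.trans (add_le_add (add_le_add (add_le_add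
    (mul_le_mul_of_nonneg_left c1 (by positivity : 0 ≤ 2 * M * S))
    (mul_le_mul_of_nonneg_left c2 (by positivity : 0 ≤ M * S ^ 2)))
    (mul_le_mul_of_nonneg_left c3 (by positivity : 0 ≤ M * S')))
    (mul_le_mul_of_nonneg_left c4 (by positivity : 0 ≤ M * S)))
  have fin := theta_absorb (M := M) (A := A) (c := (b - a)⁻¹) (m := (b - a)⁻¹ * m)
    (l := √(b - a)) (y := √(∫ z in a..b, (dp z - dP z) ^ 2))
    (p := √(∫ z in a..b, (v z - V z) ^ 2)) (q := √(∫ z in a..b, (p z - P z) ^ 2))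
    (B := √(∫ z in a..b, dP z ^ 2)) (S := S) (S' := S') hM hA (by positivity) (by positivity) hS'0
    (by rw [hS2, Real.sq_sqrt n1]) (by rw [hS'def]; gcongr)
  rw [Real.sq_sqrt n1, Real.sq_sqrt n2, Real.sq_sqrt n3, Real.sq_sqrt n4] at fin
  rw [hsplit, i1, i2, i3]
  simp only [← pow_two] at *
  linarith

/-- Energy estimate for the difference of two wave components. -/
lemma wave_energy {a b : ℝ} (hab : a < b) {F F' : ℝ → ℝ} {M : ℝ} (hF : Nonlin F F' M) :
    ∃ C, 0 ≤ C ∧ ∀ (ε : ℝ) (w w1 w2 w3 w4 z2 p dp ddp P dP ddP : ℝ → ℝ), 0 ≤ ε →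
    (∀ x ∈ Icc a b, HasDerivAt w (w1 x) x) → (∀ x ∈ Icc a b, HasDerivAt w1 (w2 x) x) →
    (∀ x ∈ Icc a b, HasDerivAt w2 (w3 x) x) → (∀ x ∈ Icc a b, HasDerivAt w3 (w4 x) x) →
    (∀ x ∈ Icc a b, HasDerivAt p (dp x) x) → (∀ x ∈ Icc a b, HasDerivAt dp (ddp x) x) →
    (∀ x ∈ Icc a b, HasDerivAt P (dP x) x) → (∀ x ∈ Icc a b, HasDerivAt dP (ddP x) x) →
    ContinuousOn w4 (Icc a b) → ContinuousOn z2 (Icc a b) →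
    w a = 0 → w b = 0 → w2 a = 0 → w2 b = 0 →
    (∫ x in a..b, w x * (-ε * w4 x + z2 x - (F' (p x) * dp x - F' (P x) * dP x)))
      - (∫ x in a..b, z2 x * (ε * z2 x + w x))
      ≤ (1 / 8) * (∫ x in a..b, (dp x - dP x) ^ 2) + C * ((1 + ∫ x in a..b, dP x ^ 2) *
        ((∫ x in a..b, w x ^ 2) + ∫ x in a..b, (p x - P x) ^ 2)) := by
  have hL : 0 < b - a := sub_pos.2 hab
  have hM := hF.nonneg
  refine ⟨5 * M ^ 2 + (b - a)⁻¹ + 4, by positivity, ?_⟩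
  intro ε w w1 w2 w3 w4 z2 p dp ddp P dP ddP hε hw hw1 hw2 hw3 hp hdp hP hdP cw4 cz2 wa wb w2a w2b
  have cw := hasDerivAt_continuousOn hw
  have cw1 := hasDerivAt_continuousOn hw1
  have cw2 := hasDerivAt_continuousOn hw2
  have cw3 := hasDerivAt_continuousOn hw3
  have cp := hasDerivAt_continuousOn hp
  have cP := hasDerivAt_continuousOn hP
  have cdp := hasDerivAt_continuousOn hdp
  have cdP := hasDerivAt_continuousOn hdP
  have cF := hF.continuous
  have cF' := hF.continuous_deriv
  have hθ : ∀ x ∈ Icc a b, HasDerivAt (fun x => p x - P x) (dp x - dP x) x :=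
    fun x hx => (hp x hx).sub (hP x hx)
  have i1 : ∫ x in a..b, w x * w4 x = - ∫ x in a..b, w1 x * w3 x :=
    integral_parts_zero hab.le hw hw3 (by fun_prop) (by fun_prop) (by simp [wa]) (by simp [wb])
  have i2 : ∫ x in a..b, w1 x * w3 x = - ∫ x in a..b, w2 x * w2 x :=
    integral_parts_zero hab.le hw1 hw2 (by fun_prop) (by fun_prop) (by simp [w2a]) (by simp [w2b])
  have hsplit : (∫ x in a..b, w x * (-ε * w4 x + z2 x - (F' (p x) * dp x - F' (P x) * dP x)))
      - (∫ x in a..b, z2 x * (ε * z2 x + w x))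
      = -ε * (∫ x in a..b, w x * w4 x) - ε * (∫ x in a..b, z2 x * z2 x)
        + ∫ x in a..b, - (w x * (F' (p x) * dp x - F' (P x) * dP x)) := by
    rw [← intervalIntegral.integral_const_mul, ← intervalIntegral.integral_const_mul,
      ← intervalIntegral.integral_sub, ← intervalIntegral.integral_sub,
      ← intervalIntegral.integral_add]
    · congr 1; ext x; ring
    all_goals exact ContinuousOn.ii hab.le (by fun_prop)
  set S := √((b - a)⁻¹ * (∫ z in a..b, (p z - P z) ^ 2)
      + 2 * (√(∫ z in a..b, (p z - P z) ^ 2) * √(∫ z in a..b, (dp z - dP z) ^ 2))) with hSdef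
  have n1 := ii_sq_nonneg hab.le (fun z => p z - P z)
  have n2 := ii_sq_nonneg hab.le (fun z => dp z - dP z)
  have n3 := ii_sq_nonneg hab.le dP
  have n4 := ii_sq_nonneg hab.le w
  have n5 := ii_sq_nonneg hab.le w2
  have n6 := ii_sq_nonneg hab.le z2
  have hS0 : 0 ≤ S := Real.sqrt_nonneg _
  have hS2 : S ^ 2 = (b - a)⁻¹ * (∫ z in a..b, (p z - P z) ^ 2)
      + 2 * (√(∫ z in a..b, (p z - P z) ^ 2) * √(∫ z in a..b, (dp z - dP z) ^ 2)) :=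
    Real.sq_sqrt (by positivity)
  have hθS : ∀ x ∈ Icc a b, |p x - P x| ≤ S := fun x hx =>
    Real.abs_le_sqrt (sq_le_agmon hab hθ (by fun_prop) hx)
  have hpt : ∀ x ∈ Icc a b, - (w x * (F' (p x) * dp x - F' (P x) * dP x))
      ≤ M * |w x * (dp x - dP x)| + M * S * |w x * dP x| := by
    intro x hx
    have h1 := hθS x hx
    have h5 : |F' (p x) * dp x - F' (P x) * dP x| ≤ M * |dp x - dP x| + M * S * |dP x| :=
      (hF.abs_flux_le _ _ _ _).trans (by gcongr)
    refine (neg_le_abs _).trans ?_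
    simp only [abs_mul]
    calc _ ≤ |w x| * (M * |dp x - dP x| + M * S * |dP x|) := by
          rw [← abs_mul, abs_mul]; gcongr
      _ = _ := by ring
  have h_int := intervalIntegral.integral_mono_on hab.le (ContinuousOn.ii hab.le (by fun_prop))
    (ContinuousOn.ii hab.le (by fun_prop)) hpt
  rw [intervalIntegral.integral_add (ContinuousOn.ii hab.le (by fun_prop))
    (ContinuousOn.ii hab.le (by fun_prop))] at h_int
  simp only [intervalIntegral.integral_const_mul] at h_int
  have c3 := intervalIntegral_abs_mul_le_sqrt hab.le (f := w)
    (g := fun x => dp x - dP x) (by fun_prop) (by fun_prop)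
  have c4 := intervalIntegral_abs_mul_le_sqrt hab.le (f := w)
    (g := dP) (by fun_prop) (by fun_prop)
  have h_int2 := h_int.trans (add_le_add
    (mul_le_mul_of_nonneg_left c3 hM) (mul_le_mul_of_nonneg_left c4 (by positivity : 0 ≤ M * S)))
  have fin := wave_absorb (M := M) (c := (b - a)⁻¹)
    (y := √(∫ z in a..b, (dp z - dP z) ^ 2))
    (p := √(∫ z in a..b, w z ^ 2)) (q := √(∫ z in a..b, (p z - P z) ^ 2))
    (B := √(∫ z in a..b, dP z ^ 2)) (S := S) (by positivity)
    (by rw [hS2, Real.sq_sqrt n1])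
  rw [Real.sq_sqrt n1, Real.sq_sqrt n2, Real.sq_sqrt n3, Real.sq_sqrt n4] at fin
  rw [hsplit, i1, i2]
  simp only [← pow_two] at *
  nlinarith [mul_nonneg hε n5, mul_nonneg hε n6]

section
variable {a b : ℝ}

/-- Classical spatial derivative on the closed strip. -/
def DX (a b : ℝ) (w w1 : ℝ → ℝ → ℝ) : Prop :=
  ∀ x ∈ Icc a b, ∀ t ∈ Ici (0 : ℝ), HasDerivAt (fun y => w y t) (w1 x t) x

/-- Classical time derivative on the closed strip. -/
def DT (a b : ℝ) (w wt : ℝ → ℝ → ℝ) : Prop :=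
  ∀ x ∈ Icc a b, ∀ t ∈ Ici (0 : ℝ), HasDerivAt (fun s => w x s) (wt x t) t

/-- Joint continuity on the closed strip. -/
def CC (a b : ℝ) (w : ℝ → ℝ → ℝ) : Prop :=
  ContinuousOn (uncurry w) ((Icc a b) ×ˢ (Ici (0 : ℝ)))


namespace CC

lemma slice {w : ℝ → ℝ → ℝ} (h : CC a b w) {t : ℝ} (ht : 0 ≤ t) :
    ContinuousOn (fun x => w x t) (Icc a b) :=
  ContinuousOn.comp (g := uncurry w) (f := fun x => (x, t)) h (by fun_prop)
    (fun _ hx => ⟨hx, ht⟩)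

lemma slice_t {w : ℝ → ℝ → ℝ} (h : CC a b w) {x : ℝ} (hx : x ∈ Icc a b) :
    ContinuousOn (fun t => w x t) (Ici 0) :=
  ContinuousOn.comp (g := uncurry w) (f := fun t => (x, t)) h (by fun_prop)
    (fun _ ht => ⟨hx, ht⟩)

lemma add {w z : ℝ → ℝ → ℝ} (h : CC a b w) (h' : CC a b z) :
    CC a b (fun x t => w x t + z x t) := ContinuousOn.add h h'

lemma sub {w z : ℝ → ℝ → ℝ} (h : CC a b w) (h' : CC a b z) :
    CC a b (fun x t => w x t - z x t) := ContinuousOn.sub h h'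

lemma mul {w z : ℝ → ℝ → ℝ} (h : CC a b w) (h' : CC a b z) :
    CC a b (fun x t => w x t * z x t) := ContinuousOn.mul h h'

lemma neg {w : ℝ → ℝ → ℝ} (h : CC a b w) : CC a b (fun x t => - w x t) := ContinuousOn.neg h

lemma sq {w : ℝ → ℝ → ℝ} (h : CC a b w) : CC a b (fun x t => w x t ^ 2) := ContinuousOn.pow h 2

lemma const (c : ℝ) : CC a b (fun _ _ => c) := continuousOn_const

lemma comp {w : ℝ → ℝ → ℝ} (h : CC a b w) {F : ℝ → ℝ} (hF : Continuous F) :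
    CC a b (fun x t => F (w x t)) := hF.comp_continuousOn h

/-- A function continuous on the closed strip extends continuously to the plane. -/
lemma extend {w : ℝ → ℝ → ℝ} (h : CC a b w) (hab : a ≤ b) :
    ∃ W : ℝ → ℝ → ℝ, Continuous (uncurry W) ∧ ∀ x ∈ Icc a b, ∀ t, 0 ≤ t → W x t = w x t := by
  refine ⟨fun x t => w (max a (min b x)) (max 0 t), ?_, ?_⟩
  · refine h.comp_continuous (f := fun p : ℝ × ℝ => (max a (min b p.1), max 0 p.2))
      (by fun_prop) fun p => ⟨⟨le_max_left _ _, max_le hab (min_le_left _ _)⟩, mem_Ici.2 (le_max_left _ _)⟩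
  · intro x hx t ht
    simp [min_eq_right hx.2, max_eq_right hx.1, max_eq_right ht]

lemma integral_x {w : ℝ → ℝ → ℝ} (h : CC a b w) (hab : a ≤ b) :
    ContinuousOn (fun t => ∫ x in a..b, w x t) (Ici 0) := by
  obtain ⟨W, hW, hWw⟩ := h.extend hab
  have h1 : Continuous (fun t => ∫ x in a..b, W x t) :=
    intervalIntegral.continuous_parametric_intervalIntegral_of_continuous'
      (f := fun t x => W x t) (hW.comp continuous_swap) a b
  refine h1.continuousOn.congr fun t ht => ?_
  refine intervalIntegral.integral_congr fun x hx => ?_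
  rw [uIcc_of_le hab] at hx
  exact (hWw x hx t ht).symm

lemma bdd {w : ℝ → ℝ → ℝ} (h : CC a b w) (T : ℝ) :
    ∃ B, 0 ≤ B ∧ ∀ x ∈ Icc a b, ∀ t ∈ Icc 0 T, |w x t| ≤ B := by
  obtain ⟨B, hB⟩ := (isCompact_Icc.prod isCompact_Icc).exists_bound_of_continuousOn
    (f := uncurry w) (s := Icc a b ×ˢ Icc 0 T)
    (h.mono (prod_mono le_rfl Icc_subset_Ici_self))
  exact ⟨max B 0, le_max_right _ _, fun x hx t ht => (hB (x, t) ⟨hx, ht⟩).trans (le_max_left _ _)⟩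

end CC

lemma DX.sub {w w1 z z1 : ℝ → ℝ → ℝ} (h : DX a b w w1) (h' : DX a b z z1) :
    DX a b (fun x t => w x t - z x t) (fun x t => w1 x t - z1 x t) :=
  fun x hx t ht => (h x hx t ht).sub (h' x hx t ht)

lemma DT.sub {w w1 z z1 : ℝ → ℝ → ℝ} (h : DT a b w w1) (h' : DT a b z z1) :
    DT a b (fun x t => w x t - z x t) (fun x t => w1 x t - z1 x t) :=
  fun x hx t ht => (h x hx t ht).sub (h' x hx t ht)

/-- Difference quotients in time are bounded by the time derivative. -/
lemma DT.abs_sub_le {y yt : ℝ → ℝ → ℝ} (hy : DT a b y yt) {T B : ℝ}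
    (hB : ∀ x ∈ Icc a b, ∀ t ∈ Icc 0 T, |yt x t| ≤ B) {x s t : ℝ} (hx : x ∈ Icc a b)
    (hs : s ∈ Icc 0 T) (ht : t ∈ Icc 0 T) : |y x s - y x t| ≤ B * |s - t| := by
  have := Convex.norm_image_sub_le_of_norm_hasDerivWithin_le (f := y x) (f' := yt x) (C := B)
    (s := Icc 0 T) (fun z hz => (hy x hx z hz.1).hasDerivWithinAt)
    (fun z hz => by simpa using hB x hx z hz) (convex_Icc 0 T) ht hs
  simpa using this

/-- Convergence of integrated difference quotients in time. -/
lemma tendsto_integral_slope (hab : a ≤ b) {y yt : ℝ → ℝ → ℝ} (hy : DT a b y yt) (cy : CC a b y)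
    (cyt : CC a b yt) {t : ℝ} (ht : 0 ≤ t) {g : ℝ → ℝ → ℝ} {g0 : ℝ → ℝ} {B : ℝ}
    (hg : ∀ s ∈ Ioc t (t + 1), ContinuousOn (fun x => g x s) (Icc a b))
    (hgB : ∀ s ∈ Ioc t (t + 1), ∀ x ∈ Icc a b, |g x s| ≤ B)
    (hlim : ∀ x ∈ Icc a b, Tendsto (g x) (nhdsWithin t (Ioi t)) (nhds (g0 x))) :
    Tendsto (fun s => ∫ x in a..b, (y x s - y x t) / (s - t) * g x s) (nhdsWithin t (Ioi t))
      (nhds (∫ x in a..b, yt x t * g0 x)) := by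
  obtain ⟨D, hD0, hD⟩ := cyt.bdd (t + 1)
  have hev : ∀ᶠ s in nhdsWithin t (Ioi t), s ∈ Ioc t (t + 1) :=
    Ioc_mem_nhdsGT (by linarith)
  refine intervalIntegral.tendsto_integral_filter_of_dominated_convergence (fun _ => D * B)
    ?_ ?_ ?_ ?_
  · filter_upwards [hev] with s hs
    rw [uIoc_of_le hab]
    have h1 := cy.slice (ht.trans hs.1.le)
    have h2 := cy.slice ht
    have h3 := hg s hs
    have : ContinuousOn (fun x => (y x s - y x t) / (s - t) * g x s) (Icc a b) :=
      ((h1.sub h2).div_const _).mul h3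
    exact (this.mono Ioc_subset_Icc_self).aestronglyMeasurable measurableSet_Ioc
  · filter_upwards [hev] with s hs
    refine Eventually.of_forall fun x hx => ?_
    rw [uIoc_of_le hab] at hx
    have hx' := Ioc_subset_Icc_self hx
    have hst : 0 < s - t := sub_pos.2 hs.1
    rw [Real.norm_eq_abs, abs_mul, abs_div, abs_of_pos hst]
    have h1 : |y x s - y x t| / (s - t) ≤ D := by
      rw [div_le_iff₀ hst]
      have := hy.abs_sub_le hD hx' ⟨ht.trans hs.1.le, hs.2⟩ ⟨ht, by linarith⟩
      rwa [abs_of_pos hst] at this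
    have h2 := hgB s hs x hx'
    have h3 : 0 ≤ |y x s - y x t| / (s - t) := by positivity
    exact mul_le_mul h1 h2 (abs_nonneg _) hD0
  · simp
  · refine Eventually.of_forall fun x hx => ?_
    rw [uIoc_of_le hab] at hx
    have hx' := Ioc_subset_Icc_self hx
    refine Tendsto.mul ?_ (hlim x hx')
    have := (hy x hx' t ht).hasDerivWithinAt (s := Ioi t)
    rw [hasDerivWithinAt_iff_tendsto_slope' (by simp)] at this
    refine this.congr fun s => ?_
    rw [slope_def_field]

/-- Right derivative of a quadratic functional of a time-dependent profile. -/
lemma hasDerivWithinAt_quad (hab : a ≤ b) {y yt c : ℝ → ℝ → ℝ} (hy : DT a b y yt) (cy : CC a b y)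
    (cyt : CC a b yt) (cc : CC a b c) {I : ℝ → ℝ}
    (hI : ∀ s t : ℝ, 0 ≤ s → 0 ≤ t →
      I s - I t = ∫ x in a..b, (y x s - y x t) * (c x s + c x t)) {t : ℝ} (ht : 0 ≤ t) :
    HasDerivWithinAt I (2 * ∫ x in a..b, yt x t * c x t) (Ici t) t := by
  rw [← hasDerivWithinAt_Ioi_iff_Ici, hasDerivWithinAt_iff_tendsto_slope' (by simp)]
  obtain ⟨B, hB0, hB⟩ := cc.bdd (t + 1)
  have hev : ∀ᶠ s in nhdsWithin t (Ioi t), s ∈ Ioc t (t + 1) :=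
    Ioc_mem_nhdsGT (by linarith)
  have key := tendsto_integral_slope hab hy cy cyt ht (g := fun x s => c x s + c x t)
    (g0 := fun x => c x t + c x t) (B := B + B)
    (fun s hs => (cc.slice (ht.trans hs.1.le)).add (cc.slice ht))
    (fun s hs x hx => (abs_add_le _ _).trans (add_le_add
      (hB x hx s ⟨ht.trans hs.1.le, hs.2⟩) (hB x hx t ⟨ht, by linarith⟩)))
    (fun x hx => by
      refine Tendsto.add ?_ tendsto_const_nhds
      exact ((cc.slice_t hx) t ht).mono_left
        (nhdsWithin_mono t fun s (hs : t < s) => ht.trans hs.le))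
  have e : ∫ x in a..b, yt x t * (c x t + c x t) = 2 * ∫ x in a..b, yt x t * c x t := by
    rw [← intervalIntegral.integral_const_mul]; congr 1; ext x; ring
  rw [← e]
  refine key.congr' ?_
  filter_upwards [hev] with s hs
  rw [slope_def_field, hI s t (ht.trans hs.1.le) ht, div_eq_inv_mul,
    ← intervalIntegral.integral_const_mul]
  congr 1; ext x; ring

lemma hasDerivWithinAt_sq (hab : a ≤ b) {y yt : ℝ → ℝ → ℝ} (hy : DT a b y yt) (cy : CC a b y)
    (cyt : CC a b yt) {t : ℝ} (ht : 0 ≤ t) :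
    HasDerivWithinAt (fun t => ∫ x in a..b, y x t ^ 2) (2 * ∫ x in a..b, yt x t * y x t)
      (Ici t) t := by
  refine hasDerivWithinAt_quad hab hy cy cyt cy (fun s t hs ht => ?_) ht
  have h1 := cy.slice hs
  have h2 := cy.slice ht
  rw [← intervalIntegral.integral_sub]
  · congr 1; ext x; ring
  all_goals exact ContinuousOn.ii hab (by fun_prop)

lemma hasDerivWithinAt_integral (hab : a ≤ b) {y yt : ℝ → ℝ → ℝ} (hy : DT a b y yt)
    (cy : CC a b y) (cyt : CC a b yt) {t : ℝ} (ht : 0 ≤ t) :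
    HasDerivWithinAt (fun t => ∫ x in a..b, y x t) (∫ x in a..b, yt x t) (Ici t) t := by
  have := hasDerivWithinAt_quad hab hy cy cyt (CC.const (1 / 2))
    (I := fun t => ∫ x in a..b, y x t) (fun s t hs ht => ?_) ht
  · convert this using 1
    rw [← intervalIntegral.integral_const_mul]; congr 1; ext x; ring
  have h1 := cy.slice hs
  have h2 := cy.slice ht
  rw [← intervalIntegral.integral_sub]
  · congr 1; ext x; ring
  all_goals exact ContinuousOn.ii hab (by fun_prop)

lemma hasDerivWithinAt_grad_sq (hab : a ≤ b) {y y1 y2 yt : ℝ → ℝ → ℝ} (hy : DT a b y yt)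
    (cyt : CC a b yt) (cy : CC a b y) (hy1 : DX a b y y1) (hy2 : DX a b y1 y2) (cy1 : CC a b y1)
    (cy2 : CC a b y2) (h0a : ∀ t, 0 ≤ t → y a t = 0) (h0b : ∀ t, 0 ≤ t → y b t = 0)
    {t : ℝ} (ht : 0 ≤ t) :
    HasDerivWithinAt (fun t => ∫ x in a..b, y1 x t ^ 2) (-(2 * ∫ x in a..b, yt x t * y2 x t))
      (Ici t) t := by
  have := hasDerivWithinAt_quad hab hy cy cyt cy2.neg
    (I := fun t => ∫ x in a..b, y1 x t ^ 2) (fun s t hs ht => ?_) ht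
  · convert this using 1
    rw [← mul_neg, ← intervalIntegral.integral_neg]; congr 2; ext x; ring
  have h1 := cy1.slice hs
  have h2 := cy1.slice ht
  have h3 := cy2.slice hs
  have h4 := cy2.slice ht
  have h5 := cy.slice hs
  have h6 := cy.slice ht
  have e := integral_parts_zero hab (p := fun x => y x s - y x t) (p' := fun x => y1 x s - y1 x t)
    (q := fun x => y1 x s + y1 x t) (q' := fun x => y2 x s + y2 x t)
    (fun x hx => (hy1 x hx s hs).sub (hy1 x hx t ht))
    (fun x hx => (hy2 x hx s hs).add (hy2 x hx t ht)) (by fun_prop) (by fun_prop)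
    (by simp [h0a s hs, h0a t ht]) (by simp [h0b s hs, h0b t ht])
  have e2 : ∫ x in a..b, (y x s - y x t) * (-y2 x s + -y2 x t)
      = - ∫ x in a..b, (y x s - y x t) * (y2 x s + y2 x t) := by
    rw [← intervalIntegral.integral_neg]; congr 1; ext x; ring
  rw [e2, e, neg_neg, ← intervalIntegral.integral_sub]
  · congr 1; ext x; ring
  all_goals exact ContinuousOn.ii hab (by fun_prop)

/-- Integrated form of a differential inequality with right derivatives. -/
lemma le_integral_of_right_deriv {I I' g : ℝ → ℝ}
    (hI : ∀ t, 0 ≤ t → HasDerivWithinAt I (I' t) (Ici t) t) (cI : ContinuousOn I (Ici 0))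
    (cg : ContinuousOn g (Ici 0)) {T : ℝ} (hle : ∀ t ∈ Ico 0 T, I' t ≤ g t) (hT : 0 ≤ T) :
    I T ≤ I 0 + ∫ t in (0 : ℝ)..T, g t := by
  obtain ⟨G, hG, hGg⟩ : ∃ G : ℝ → ℝ, Continuous G ∧ ∀ t, 0 ≤ t → G t = g t :=
    ⟨fun t => g (max 0 t), cg.comp_continuous (by fun_prop) (fun t => mem_Ici.2 (le_max_left _ _)),
      fun t ht => by simp [ht]⟩
  have e : ∫ t in (0 : ℝ)..T, g t = ∫ t in (0 : ℝ)..T, G t := by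
    refine intervalIntegral.integral_congr fun t ht => ?_
    rw [uIcc_of_le hT] at ht
    exact (hGg t ht.1).symm
  rw [e]
  refine image_le_of_deriv_right_le_deriv_boundary (f := I) (f' := I')
    (B := fun t => I 0 + ∫ s in (0 : ℝ)..t, G s) (B' := G) (a := 0) (b := T)
    (cI.mono Icc_subset_Ici_self) (fun t ht => hI t ht.1) (by simp) ?_ ?_
    (fun t ht => by rw [hGg t ht.1]; exact hle t ht) ⟨hT, le_rfl⟩
  · exact (continuous_const.add
      (intervalIntegral.continuous_primitive (fun _ _ => hG.intervalIntegrable _ _) 0)).continuousOn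
  · intro t _
    exact ((hG.integral_hasStrictDerivAt 0 t).hasDerivAt.const_add _).hasDerivWithinAt

/-- Grönwall's inequality with a variable coefficient. -/
lemma gronwall_right {E E' k : ℝ → ℝ} {σ : ℝ} (hσ : 0 ≤ σ)
    (hE : ∀ t, 0 ≤ t → HasDerivWithinAt E (E' t) (Ici t) t) (cE : ContinuousOn E (Ici 0))
    (ck : ContinuousOn k (Ici 0)) (hk : ∀ t, 0 ≤ t → 0 ≤ k t) {T : ℝ}
    (hle : ∀ t ∈ Ico 0 T, E' t ≤ k t * E t + σ) (hT : 0 ≤ T) :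
    E T ≤ (E 0 + σ * T) * Real.exp (∫ t in (0 : ℝ)..T, k t) := by
  obtain ⟨G, hG, hGg⟩ : ∃ G : ℝ → ℝ, Continuous G ∧ ∀ t, 0 ≤ t → G t = k t :=
    ⟨fun t => k (max 0 t), ck.comp_continuous (by fun_prop) (fun t => mem_Ici.2 (le_max_left _ _)),
      fun t ht => by simp [ht]⟩
  have e : ∫ t in (0 : ℝ)..T, k t = ∫ t in (0 : ℝ)..T, G t := by
    refine intervalIntegral.integral_congr fun t ht => ?_
    rw [uIcc_of_le hT] at ht
    exact (hGg t ht.1).symm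
  rw [e]
  have hd : ∀ t : ℝ, HasDerivAt (fun t => Real.exp (-∫ s in (0 : ℝ)..t, G s))
      (Real.exp (-∫ s in (0 : ℝ)..t, G s) * -G t) t := fun t =>
    ((hG.integral_hasStrictDerivAt 0 t).hasDerivAt.neg).exp
  have hc : Continuous (fun t => Real.exp (-∫ s in (0 : ℝ)..t, G s)) :=
    continuous_iff_continuousAt.2 fun t => (hd t).continuousAt
  have := le_integral_of_right_deriv
    (I := fun t => E t * Real.exp (-∫ s in (0 : ℝ)..t, G s)) (g := fun _ => σ) (T := T)
    (fun t ht => (hE t ht).mul (hd t).hasDerivWithinAt)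
    (cE.mul hc.continuousOn) continuousOn_const (fun t ht => ?_) hT
  · simp only [intervalIntegral.integral_same, neg_zero, Real.exp_zero, mul_one,
      intervalIntegral.integral_const, sub_zero, smul_eq_mul] at this
    calc E T = E T * Real.exp (-∫ s in (0 : ℝ)..T, G s) * Real.exp (∫ s in (0 : ℝ)..T, G s) := by
          rw [mul_assoc, ← Real.exp_add]; simp
      _ ≤ _ := by rw [mul_comm σ]; gcongr
  · have h1 := hle t ht
    have h2 : 0 ≤ ∫ s in (0 : ℝ)..t, G s :=
      intervalIntegral.integral_nonneg ht.1 fun s hs => by rw [hGg s hs.1]; exact hk s hs.1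
    have h3 : Real.exp (-∫ s in (0 : ℝ)..t, G s) ≤ 1 := Real.exp_le_one_iff.2 (by linarith)
    have h4 := Real.exp_pos (-∫ s in (0 : ℝ)..t, G s)
    rw [hGg t ht.1]
    nlinarith [mul_le_mul_of_nonneg_right h1 h4.le, mul_le_mul_of_nonneg_left h3 hσ]

/-- Velocity, displacement and temperature fields together with their derivatives. -/
structure Tri where
  v : ℝ → ℝ → ℝ
  v1 : ℝ → ℝ → ℝ
  v2 : ℝ → ℝ → ℝ
  v3 : ℝ → ℝ → ℝ
  v4 : ℝ → ℝ → ℝ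
  vt : ℝ → ℝ → ℝ
  u : ℝ → ℝ → ℝ
  u1 : ℝ → ℝ → ℝ
  u2 : ℝ → ℝ → ℝ
  ut : ℝ → ℝ → ℝ
  p : ℝ → ℝ → ℝ
  p1 : ℝ → ℝ → ℝ
  p2 : ℝ → ℝ → ℝ
  pt : ℝ → ℝ → ℝ

namespace Tri

/-- Regularity and boundary conditions on the closed strip. -/
structure Reg (a b : ℝ) (X : Tri) : Prop where
  dv : DX a b X.v X.v1
  dv1 : DX a b X.v1 X.v2
  dv2 : DX a b X.v2 X.v3
  dv3 : DX a b X.v3 X.v4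
  tv : DT a b X.v X.vt
  cv : CC a b X.v
  cv1 : CC a b X.v1
  cv2 : CC a b X.v2
  cv3 : CC a b X.v3
  cv4 : CC a b X.v4
  cvt : CC a b X.vt
  du : DX a b X.u X.u1
  du1 : DX a b X.u1 X.u2
  tu : DT a b X.u X.ut
  cu : CC a b X.u
  cu1 : CC a b X.u1
  cu2 : CC a b X.u2
  cut : CC a b X.ut
  dp : DX a b X.p X.p1
  dp1 : DX a b X.p1 X.p2
  tp : DT a b X.p X.pt
  cp : CC a b X.p
  cp1 : CC a b X.p1
  cp2 : CC a b X.p2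
  cpt : CC a b X.pt
  bva : ∀ t, 0 ≤ t → X.v a t = 0
  bvb : ∀ t, 0 ≤ t → X.v b t = 0
  bv2a : ∀ t, 0 ≤ t → X.v2 a t = 0
  bv2b : ∀ t, 0 ≤ t → X.v2 b t = 0
  bua : ∀ t, 0 ≤ t → X.u a t = 0
  bub : ∀ t, 0 ≤ t → X.u b t = 0
  bp1a : ∀ t, 0 ≤ t → X.p1 a t = 0
  bp1b : ∀ t, 0 ≤ t → X.p1 b t = 0

/-- Classical solutions of the regularized system with globally defined nonlinearity. -/
structure Sol (a b ε : ℝ) (F F' : ℝ → ℝ) (X : Tri) : Prop extends Reg a b X where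
  eqv : ∀ x ∈ Icc a b, ∀ t, 0 ≤ t →
    X.vt x t = -ε * X.v4 x t + X.u2 x t - F' (X.p x t) * X.p1 x t
  equ : ∀ x ∈ Icc a b, ∀ t, 0 ≤ t → X.ut x t = ε * X.u2 x t + X.v x t
  eqp : ∀ x ∈ Icc a b, ∀ t, 0 ≤ t → X.pt x t = X.p2 x t - F (X.p x t) * X.v1 x t

/-- Residual of the velocity equation. -/
def res1 (ε : ℝ) (F' : ℝ → ℝ) (Y : Tri) (x t : ℝ) : ℝ :=
  Y.vt x t + ε * Y.v4 x t - Y.u2 x t + F' (Y.p x t) * Y.p1 x t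

/-- Residual of the displacement equation. -/
def res2 (ε : ℝ) (Y : Tri) (x t : ℝ) : ℝ := Y.ut x t - ε * Y.u2 x t - Y.v x t

/-- Residual of the temperature equation. -/
def res3 (F : ℝ → ℝ) (Y : Tri) (x t : ℝ) : ℝ := Y.pt x t - Y.p2 x t + F (Y.p x t) * Y.v1 x t

/-- Squared distance of two states in the energy norm. -/
def en (a b : ℝ) (X Y : Tri) (t : ℝ) : ℝ :=
  (∫ x in a..b, (X.v x t - Y.v x t) ^ 2) + (∫ x in a..b, (X.u1 x t - Y.u1 x t) ^ 2)
    + ∫ x in a..b, (X.p x t - Y.p x t) ^ 2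

/-- Right time derivative of `Tri.en`. -/
def en' (a b : ℝ) (X Y : Tri) (t : ℝ) : ℝ :=
  2 * (∫ x in a..b, (X.vt x t - Y.vt x t) * (X.v x t - Y.v x t))
    + -(2 * ∫ x in a..b, (X.ut x t - Y.ut x t) * (X.u2 x t - Y.u2 x t))
    + 2 * ∫ x in a..b, (X.pt x t - Y.pt x t) * (X.p x t - Y.p x t)

lemma en_nonneg (hab : a ≤ b) (X Y : Tri) (t : ℝ) : 0 ≤ en a b X Y t :=
  add_nonneg (add_nonneg (ii_sq_nonneg hab _) (ii_sq_nonneg hab _)) (ii_sq_nonneg hab _)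

lemma Reg.continuousOn_en (hab : a ≤ b) {X Y : Tri} (hX : Reg a b X) (hY : Reg a b Y) :
    ContinuousOn (en a b X Y) (Ici 0) :=
  (((hX.cv.sub hY.cv).sq.integral_x hab).add ((hX.cu1.sub hY.cu1).sq.integral_x hab)).add
    ((hX.cp.sub hY.cp).sq.integral_x hab)

lemma Reg.hasDeriv_en (hab : a ≤ b) {X Y : Tri} (hX : Reg a b X) (hY : Reg a b Y) {t : ℝ}
    (ht : 0 ≤ t) : HasDerivWithinAt (en a b X Y) (en' a b X Y t) (Ici t) t :=
  ((hasDerivWithinAt_sq hab (hX.tv.sub hY.tv) (hX.cv.sub hY.cv) (hX.cvt.sub hY.cvt) ht).add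
    (hasDerivWithinAt_grad_sq hab (hX.tu.sub hY.tu) (hX.cut.sub hY.cut) (hX.cu.sub hY.cu)
      (hX.du.sub hY.du) (hX.du1.sub hY.du1) (hX.cu1.sub hY.cu1) (hX.cu2.sub hY.cu2)
      (fun t ht => by simp [hX.bua t ht, hY.bua t ht])
      (fun t ht => by simp [hX.bub t ht, hY.bub t ht]) ht)).add
    (hasDerivWithinAt_sq hab (hX.tp.sub hY.tp) (hX.cp.sub hY.cp) (hX.cpt.sub hY.cpt) ht)

lemma Reg.continuousOn_res1 {Y : Tri} (hY : Reg a b Y) {F F' : ℝ → ℝ} {M : ℝ}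
    (hF : Nonlin F F' M) (ε : ℝ) {t : ℝ} (ht : 0 ≤ t) :
    ContinuousOn (fun x => res1 ε F' Y x t) (Icc a b) := by
  have h1 := hY.cvt.slice ht
  have h2 := hY.cv4.slice ht
  have h3 := hY.cu2.slice ht
  have h4 := hY.cp.slice ht
  have h6 := hF.continuous_deriv
  have h5 := hY.cp1.slice ht
  unfold res1
  fun_prop

lemma Reg.continuousOn_res2 {Y : Tri} (hY : Reg a b Y) (ε : ℝ) {t : ℝ} (ht : 0 ≤ t) :
    ContinuousOn (fun x => res2 ε Y x t) (Icc a b) := by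
  have h1 := hY.cut.slice ht
  have h3 := hY.cu2.slice ht
  have h5 := hY.cv.slice ht
  unfold res2
  fun_prop

lemma Reg.continuousOn_res3 {Y : Tri} (hY : Reg a b Y) {F F' : ℝ → ℝ} {M : ℝ}
    (hF : Nonlin F F' M) {t : ℝ} (ht : 0 ≤ t) :
    ContinuousOn (fun x => res3 F Y x t) (Icc a b) := by
  have h1 := hY.cpt.slice ht
  have h3 := hY.cp2.slice ht
  have h4 := hY.cp.slice ht
  have h6 := hF.continuous
  have h5 := hY.cv1.slice ht
  unfold res3
  fun_prop

/-- Differential inequality for the distance of a solution to a comparison state. -/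
lemma exists_en'_le (hab : a < b) {F F' : ℝ → ℝ} {M : ℝ} (hF : Nonlin F F' M)
    {A m : ℝ} (hA : 0 ≤ A) : ∃ C, 0 ≤ C ∧ ∀ (ε : ℝ) (X Y : Tri), 0 ≤ ε → Sol a b ε F F' X →
    Reg a b Y → ∀ t, 0 ≤ t → ∫ x in a..b, X.v x t ^ 2 ≤ A ^ 2 → ∫ x in a..b, |Y.p x t| ≤ m →
    en' a b X Y t ≤ -(1 / 4) * (∫ x in a..b, (X.p1 x t - Y.p1 x t) ^ 2)
      + C * (1 + ∫ x in a..b, Y.p1 x t ^ 2) * en a b X Y t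
      + 2 * (-(∫ x in a..b, (X.v x t - Y.v x t) * res1 ε F' Y x t)
        + (∫ x in a..b, (X.u2 x t - Y.u2 x t) * res2 ε Y x t)
        - ∫ x in a..b, (X.p x t - Y.p x t) * res3 F Y x t) := by
  obtain ⟨C1, hC1, H1⟩ := theta_energy (m := m) hab hF hA
  obtain ⟨C2, hC2, H2⟩ := wave_energy hab hF
  refine ⟨2 * C1 + 2 * C2, by positivity, ?_⟩
  intro ε X Y hε hX hY t ht hvA hPm
  have k1 := H1 (fun x => X.v x t) (fun x => X.v1 x t) (fun x => Y.v x t) (fun x => Y.v1 x t)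
    (fun x => X.p x t) (fun x => X.p1 x t) (fun x => X.p2 x t)
    (fun x => Y.p x t) (fun x => Y.p1 x t) (fun x => Y.p2 x t)
    (fun x hx => hX.dv x hx t ht) (fun x hx => hY.dv x hx t ht)
    (fun x hx => hX.dp x hx t ht) (fun x hx => hX.dp1 x hx t ht)
    (fun x hx => hY.dp x hx t ht) (fun x hx => hY.dp1 x hx t ht)
    (hX.cv1.slice ht) (hY.cv1.slice ht) (hX.cp2.slice ht) (hY.cp2.slice ht)
    (hX.bva t ht) (hX.bvb t ht) (hY.bva t ht) (hY.bvb t ht)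
    (hX.bp1a t ht) (hX.bp1b t ht) (hY.bp1a t ht) (hY.bp1b t ht) hvA hPm
  have k2 := H2 ε (fun x => X.v x t - Y.v x t) (fun x => X.v1 x t - Y.v1 x t)
    (fun x => X.v2 x t - Y.v2 x t) (fun x => X.v3 x t - Y.v3 x t)
    (fun x => X.v4 x t - Y.v4 x t) (fun x => X.u2 x t - Y.u2 x t)
    (fun x => X.p x t) (fun x => X.p1 x t) (fun x => X.p2 x t)
    (fun x => Y.p x t) (fun x => Y.p1 x t) (fun x => Y.p2 x t) hε
    (fun x hx => hX.dv.sub hY.dv x hx t ht) (fun x hx => hX.dv1.sub hY.dv1 x hx t ht)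
    (fun x hx => hX.dv2.sub hY.dv2 x hx t ht) (fun x hx => hX.dv3.sub hY.dv3 x hx t ht)
    (fun x hx => hX.dp x hx t ht) (fun x hx => hX.dp1 x hx t ht)
    (fun x hx => hY.dp x hx t ht) (fun x hx => hY.dp1 x hx t ht)
    ((hX.cv4.slice ht).sub (hY.cv4.slice ht)) ((hX.cu2.slice ht).sub (hY.cu2.slice ht))
    (by simp [hX.bva t ht, hY.bva t ht]) (by simp [hX.bvb t ht, hY.bvb t ht])
    (by simp [hX.bv2a t ht, hY.bv2a t ht]) (by simp [hX.bv2b t ht, hY.bv2b t ht])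
  have cXv := hX.cv.slice ht
  have cXv1 := hX.cv1.slice ht
  have cXv4 := hX.cv4.slice ht
  have cXu2 := hX.cu2.slice ht
  have cXp := hX.cp.slice ht
  have cXp1 := hX.cp1.slice ht
  have cXp2 := hX.cp2.slice ht
  have cF := hF.continuous
  have cF' := hF.continuous_deriv
  have cYv := hY.cv.slice ht
  have cYv1 := hY.cv1.slice ht
  have cYv4 := hY.cv4.slice ht
  have cYu2 := hY.cu2.slice ht
  have cYp := hY.cp.slice ht
  have cYp1 := hY.cp1.slice ht
  have cYp2 := hY.cp2.slice ht
  have r1 := hY.continuousOn_res1 hF ε ht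
  have r2 := hY.continuousOn_res2 ε ht
  have r3 := hY.continuousOn_res3 hF ht
  have e1 : ∫ x in a..b, (X.vt x t - Y.vt x t) * (X.v x t - Y.v x t)
      = (∫ x in a..b, (X.v x t - Y.v x t) * (-ε * (X.v4 x t - Y.v4 x t) + (X.u2 x t - Y.u2 x t)
          - (F' (X.p x t) * X.p1 x t - F' (Y.p x t) * Y.p1 x t)))
        - ∫ x in a..b, (X.v x t - Y.v x t) * res1 ε F' Y x t := by
    rw [← intervalIntegral.integral_sub]
    · refine intervalIntegral.integral_congr fun x hx => ?_
      rw [uIcc_of_le hab.le] at hx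
      simp only [hX.eqv x hx t ht, res1]; ring
    all_goals exact ContinuousOn.ii hab.le (by fun_prop)
  have e2 : ∫ x in a..b, (X.ut x t - Y.ut x t) * (X.u2 x t - Y.u2 x t)
      = (∫ x in a..b, (X.u2 x t - Y.u2 x t) * (ε * (X.u2 x t - Y.u2 x t) + (X.v x t - Y.v x t)))
        - ∫ x in a..b, (X.u2 x t - Y.u2 x t) * res2 ε Y x t := by
    rw [← intervalIntegral.integral_sub]
    · refine intervalIntegral.integral_congr fun x hx => ?_
      rw [uIcc_of_le hab.le] at hx
      simp only [hX.equ x hx t ht, res2]; ring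
    all_goals exact ContinuousOn.ii hab.le (by fun_prop)
  have e3 : ∫ x in a..b, (X.pt x t - Y.pt x t) * (X.p x t - Y.p x t)
      = (∫ x in a..b, (X.p x t - Y.p x t) * ((X.p2 x t - F (X.p x t) * X.v1 x t)
          - (Y.p2 x t - F (Y.p x t) * Y.v1 x t)))
        - ∫ x in a..b, (X.p x t - Y.p x t) * res3 F Y x t := by
    rw [← intervalIntegral.integral_sub]
    · refine intervalIntegral.integral_congr fun x hx => ?_
      rw [uIcc_of_le hab.le] at hx
      simp only [hX.eqp x hx t ht, res3]; ring
    all_goals exact ContinuousOn.ii hab.le (by fun_prop)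
  have n1 := ii_sq_nonneg hab.le (fun x => X.u1 x t - Y.u1 x t)
  have n2 := ii_sq_nonneg hab.le (fun x => Y.p1 x t)
  unfold en' en
  rw [e1, e2, e3]
  have : 0 ≤ (2 * C1 + 2 * C2) * ((1 + ∫ x in a..b, Y.p1 x t ^ 2)
      * ∫ x in a..b, (X.u1 x t - Y.u1 x t) ^ 2) := by positivity
  linarith

end Tri

/-- A Lipschitz bound in time passes to the time derivative. -/
lemma integral_dt_sq_le (hab : a ≤ b) {y yt : ℝ → ℝ → ℝ} (hy : DT a b y yt) (cy : CC a b y)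
    (cyt : CC a b yt) {t C : ℝ} (ht : 0 ≤ t)
    (h : ∀ h ∈ Ioc (0 : ℝ) 1, ∫ x in a..b, (y x t - y x (t + h)) ^ 2 ≤ C * h ^ 2) :
    ∫ x in a..b, yt x t ^ 2 ≤ C := by
  obtain ⟨D, hD0, hD⟩ := cyt.bdd (t + 1)
  have key := tendsto_integral_slope hab hy cy cyt ht
    (g := fun x s => (y x s - y x t) / (s - t)) (g0 := fun x => yt x t) (B := D)
    (fun s hs => ((cy.slice (ht.trans hs.1.le)).sub (cy.slice ht)).div_const _)
    (fun s hs x hx => by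
      have hst : 0 < s - t := sub_pos.2 hs.1
      rw [abs_div, abs_of_pos hst, div_le_iff₀ hst]
      have := hy.abs_sub_le hD hx ⟨ht.trans hs.1.le, hs.2⟩ ⟨ht, by linarith⟩
      rwa [abs_of_pos hst] at this)
    (fun x hx => by
      have := (hy x hx t ht).hasDerivWithinAt (s := Ioi t)
      rw [hasDerivWithinAt_iff_tendsto_slope' (by simp)] at this
      refine this.congr fun s => ?_
      rw [slope_def_field])
  have e : ∫ x in a..b, yt x t ^ 2 = ∫ x in a..b, yt x t * yt x t := by simp only [pow_two]
  rw [e]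
  refine le_of_tendsto key ?_
  filter_upwards [Ioc_mem_nhdsGT (show t < t + 1 by linarith)] with s hs
  have hst : 0 < s - t := sub_pos.2 hs.1
  have := h (s - t) ⟨hst, by linarith [hs.2]⟩
  rw [show t + (s - t) = s by ring] at this
  calc _ = ((s - t) ^ 2)⁻¹ * ∫ x in a..b, (y x t - y x s) ^ 2 := by
        rw [← intervalIntegral.integral_const_mul]
        congr 1; ext x; field_simp; ring
    _ ≤ ((s - t) ^ 2)⁻¹ * (C * (s - t) ^ 2) := by gcongr
    _ = C := by field_simp

namespace Tri

/-- The trivial state. -/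
def zero : Tri where
  v _ _ := 0
  v1 _ _ := 0
  v2 _ _ := 0
  v3 _ _ := 0
  v4 _ _ := 0
  vt _ _ := 0
  u _ _ := 0
  u1 _ _ := 0
  u2 _ _ := 0
  ut _ _ := 0
  p _ _ := 0
  p1 _ _ := 0
  p2 _ _ := 0
  pt _ _ := 0

lemma reg_zero : Reg a b zero := by
  constructor
  all_goals first
    | exact fun x _ t _ => hasDerivAt_const _ _
    | exact CC.const 0
    | exact fun t _ => rfl

/-- Translation in time. -/
def shift (h : ℝ) (X : Tri) : Tri where
  v x t := X.v x (t + h)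
  v1 x t := X.v1 x (t + h)
  v2 x t := X.v2 x (t + h)
  v3 x t := X.v3 x (t + h)
  v4 x t := X.v4 x (t + h)
  vt x t := X.vt x (t + h)
  u x t := X.u x (t + h)
  u1 x t := X.u1 x (t + h)
  u2 x t := X.u2 x (t + h)
  ut x t := X.ut x (t + h)
  p x t := X.p x (t + h)
  p1 x t := X.p1 x (t + h)
  p2 x t := X.p2 x (t + h)
  pt x t := X.pt x (t + h)

end Tri

lemma DX.shift {w w1 : ℝ → ℝ → ℝ} (H : DX a b w w1) {h : ℝ} (hh : 0 ≤ h) :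
    DX a b (fun x t => w x (t + h)) (fun x t => w1 x (t + h)) :=
  fun x hx t ht => H x hx (t + h) (mem_Ici.2 (add_nonneg ht hh))

lemma DT.shift {w w1 : ℝ → ℝ → ℝ} (H : DT a b w w1) {h : ℝ} (hh : 0 ≤ h) :
    DT a b (fun x t => w x (t + h)) (fun x t => w1 x (t + h)) :=
  fun x hx t ht => (H x hx (t + h) (mem_Ici.2 (add_nonneg ht hh))).comp_add_const t h

lemma CC.shift {w : ℝ → ℝ → ℝ} (H : CC a b w) {h : ℝ} (hh : 0 ≤ h) :
    CC a b (fun x t => w x (t + h)) :=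
  ContinuousOn.comp (g := uncurry w) (f := fun p : ℝ × ℝ => (p.1, p.2 + h)) H (by fun_prop)
    (fun p hp => ⟨hp.1, mem_Ici.2 (add_nonneg hp.2 hh)⟩)

namespace Tri

lemma Reg.shift {X : Tri} (hX : Reg a b X) {h : ℝ} (hh : 0 ≤ h) : Reg a b (X.shift h) where
  dv := hX.dv.shift hh
  dv1 := hX.dv1.shift hh
  dv2 := hX.dv2.shift hh
  dv3 := hX.dv3.shift hh
  tv := hX.tv.shift hh
  cv := hX.cv.shift hh
  cv1 := hX.cv1.shift hh
  cv2 := hX.cv2.shift hh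
  cv3 := hX.cv3.shift hh
  cv4 := hX.cv4.shift hh
  cvt := hX.cvt.shift hh
  du := hX.du.shift hh
  du1 := hX.du1.shift hh
  tu := hX.tu.shift hh
  cu := hX.cu.shift hh
  cu1 := hX.cu1.shift hh
  cu2 := hX.cu2.shift hh
  cut := hX.cut.shift hh
  dp := hX.dp.shift hh
  dp1 := hX.dp1.shift hh
  tp := hX.tp.shift hh
  cp := hX.cp.shift hh
  cp1 := hX.cp1.shift hh
  cp2 := hX.cp2.shift hh
  cpt := hX.cpt.shift hh
  bva _ ht := hX.bva _ (add_nonneg ht hh)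
  bvb _ ht := hX.bvb _ (add_nonneg ht hh)
  bv2a _ ht := hX.bv2a _ (add_nonneg ht hh)
  bv2b _ ht := hX.bv2b _ (add_nonneg ht hh)
  bua _ ht := hX.bua _ (add_nonneg ht hh)
  bub _ ht := hX.bub _ (add_nonneg ht hh)
  bp1a _ ht := hX.bp1a _ (add_nonneg ht hh)
  bp1b _ ht := hX.bp1b _ (add_nonneg ht hh)

/-- Total energy (doubled). -/
def tot (a b : ℝ) (X : Tri) (t : ℝ) : ℝ :=
  (∫ x in a..b, X.v x t ^ 2) + (∫ x in a..b, X.u1 x t ^ 2) + 2 * ∫ x in a..b, X.p x t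

/-- Energy identity, in the form of an inequality. -/
lemma Sol.tot_le (hab : a ≤ b) {F F' : ℝ → ℝ} {M : ℝ} (hF : Nonlin F F' M) {ε : ℝ} {X : Tri}
    (hX : Sol a b ε F F' X) {T : ℝ} (hT : 0 ≤ T) :
    tot a b X T + 2 * (ε * ∫ t in (0 : ℝ)..T,
      ((∫ x in a..b, X.v2 x t ^ 2) + ∫ x in a..b, X.u2 x t ^ 2)) ≤ tot a b X 0 := by
  have hd : ∀ t, 0 ≤ t → HasDerivWithinAt (tot a b X)
      (2 * (∫ x in a..b, X.vt x t * X.v x t) + -(2 * ∫ x in a..b, X.ut x t * X.u2 x t)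
        + 2 * ∫ x in a..b, X.pt x t) (Ici t) t := fun t ht =>
    ((hasDerivWithinAt_sq hab hX.tv hX.cv hX.cvt ht).add
      (hasDerivWithinAt_grad_sq hab hX.tu hX.cut hX.cu hX.du hX.du1 hX.cu1 hX.cu2 hX.bua hX.bub
        ht)).add ((hasDerivWithinAt_integral hab hX.tp hX.cp hX.cpt ht).const_mul 2)
  have hc : ContinuousOn (tot a b X) (Ici 0) :=
    ((hX.cv.sq.integral_x hab).add (hX.cu1.sq.integral_x hab)).add
      ((hX.cp.integral_x hab).const_smul (2 : ℝ))
  have hg : ContinuousOn (fun t => -(2 * ε) * ((∫ x in a..b, X.v2 x t ^ 2)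
      + ∫ x in a..b, X.u2 x t ^ 2)) (Ici 0) :=
    ((hX.cv2.sq.integral_x hab).add (hX.cu2.sq.integral_x hab)).const_smul (-(2 * ε))
  have := le_integral_of_right_deriv hd hc hg (T := T) (fun t ht => le_of_eq ?_) hT
  · rw [intervalIntegral.integral_const_mul] at this
    linarith
  · have ht := ht.1
    have cv := hX.cv.slice ht
    have cv1 := hX.cv1.slice ht
    have cv2 := hX.cv2.slice ht
    have cv3 := hX.cv3.slice ht
    have cv4 := hX.cv4.slice ht
    have cu2 := hX.cu2.slice ht
    have cp := hX.cp.slice ht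
    have cp1 := hX.cp1.slice ht
    have cp2 := hX.cp2.slice ht
    have cF := hF.continuous
    have cF' := hF.continuous_deriv
    have i1 : ∫ x in a..b, X.v x t * X.v4 x t = - ∫ x in a..b, X.v1 x t * X.v3 x t :=
      integral_parts_zero hab (fun x hx => hX.dv x hx t ht) (fun x hx => hX.dv3 x hx t ht)
        (by fun_prop) (by fun_prop) (by simp [hX.bva t ht]) (by simp [hX.bvb t ht])
    have i2 : ∫ x in a..b, X.v1 x t * X.v3 x t = - ∫ x in a..b, X.v2 x t * X.v2 x t :=
      integral_parts_zero hab (fun x hx => hX.dv1 x hx t ht) (fun x hx => hX.dv2 x hx t ht)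
        (by fun_prop) (by fun_prop) (by simp [hX.bv2a t ht]) (by simp [hX.bv2b t ht])
    have i3 : ∫ x in a..b, F (X.p x t) * X.v1 x t
        = - ∫ x in a..b, F' (X.p x t) * X.p1 x t * X.v x t :=
      integral_parts_zero hab (fun x hx => (hF.deriv _).comp x (hX.dp x hx t ht))
        (fun x hx => hX.dv x hx t ht)
        (by fun_prop) (by fun_prop) (by simp [hX.bva t ht]) (by simp [hX.bvb t ht])
    have i4 : ∫ x in a..b, X.p2 x t = 0 := by
      rw [intervalIntegral.integral_eq_sub_of_hasDerivAt (f := fun x => X.p1 x t)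
        (by rw [uIcc_of_le hab]; exact fun x hx => hX.dp1 x hx t ht) (cp2.ii hab),
        hX.bp1a t ht, hX.bp1b t ht, sub_zero]
    have e1 : ∫ x in a..b, X.vt x t * X.v x t = -ε * (∫ x in a..b, X.v x t * X.v4 x t)
        + (∫ x in a..b, X.v x t * X.u2 x t) - ∫ x in a..b, F' (X.p x t) * X.p1 x t * X.v x t := by
      rw [← intervalIntegral.integral_const_mul, ← intervalIntegral.integral_add,
        ← intervalIntegral.integral_sub]
      · refine intervalIntegral.integral_congr fun x hx => ?_
        rw [uIcc_of_le hab] at hx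
        simp only [hX.eqv x hx t ht]; ring
      all_goals exact ContinuousOn.ii hab (by fun_prop)
    have e2 : ∫ x in a..b, X.ut x t * X.u2 x t = ε * (∫ x in a..b, X.u2 x t ^ 2)
        + ∫ x in a..b, X.v x t * X.u2 x t := by
      rw [← intervalIntegral.integral_const_mul, ← intervalIntegral.integral_add]
      · refine intervalIntegral.integral_congr fun x hx => ?_
        rw [uIcc_of_le hab] at hx
        simp only [hX.equ x hx t ht]; ring
      all_goals exact ContinuousOn.ii hab (by fun_prop)
    have e3 : ∫ x in a..b, X.pt x t = (∫ x in a..b, X.p2 x t)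
        - ∫ x in a..b, F (X.p x t) * X.v1 x t := by
      rw [← intervalIntegral.integral_sub]
      · refine intervalIntegral.integral_congr fun x hx => ?_
        rw [uIcc_of_le hab] at hx
        simp only [hX.eqp x hx t ht]
      all_goals exact ContinuousOn.ii hab (by fun_prop)
    rw [e1, e2, e3, i1, i2, i3, i4]
    simp only [← pow_two]
    ring

lemma Sol.shift_res {F F' : ℝ → ℝ} {ε : ℝ} {X : Tri} (hX : Sol a b ε F F' X) {h : ℝ}
    (hh : 0 ≤ h) {x t : ℝ} (hx : x ∈ Icc a b) (ht : 0 ≤ t) :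
    res1 ε F' (X.shift h) x t = 0 ∧ res2 ε (X.shift h) x t = 0 ∧ res3 F (X.shift h) x t = 0 := by
  have h1 := hX.eqv x hx _ (add_nonneg ht hh)
  have h2 := hX.equ x hx _ (add_nonneg ht hh)
  have h3 := hX.eqp x hx _ (add_nonneg ht hh)
  refine ⟨?_, ?_, ?_⟩
  · simp only [res1, Tri.shift, h1]; ring
  · simp only [res2, Tri.shift, h2]; ring
  · simp only [res3, Tri.shift, h3]; ring

lemma zero_res (F F' : ℝ → ℝ) (ε x t : ℝ) :
    res1 ε F' zero x t = 0 ∧ res2 ε zero x t = 0 ∧ res3 F zero x t = 0 := by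
  simp [res1, res2, res3, zero]

lemma integral_mul_eq_zero (hab : a ≤ b) {g r : ℝ → ℝ} (h : ∀ x ∈ Icc a b, r x = 0) :
    ∫ x in a..b, g x * r x = 0 := by
  rw [intervalIntegral.integral_congr (g := fun _ => 0)]
  · simp
  · intro x hx
    rw [uIcc_of_le hab] at hx
    simp [h x hx]

/-- Mass and energy bounds following from the energy identity. -/
lemma Sol.basic (hab : a ≤ b) {F F' : ℝ → ℝ} {M : ℝ} (hF : Nonlin F F' M) {ε A : ℝ} (hε : 0 ≤ ε)
    {X : Tri} (hX : Sol a b ε F F' X) (hp : ∀ x ∈ Icc a b, ∀ t, 0 ≤ t → 0 ≤ X.p x t)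
    (h0 : tot a b X 0 ≤ A ^ 2) {T : ℝ} (hT : 0 ≤ T) :
    ∫ x in a..b, X.v x T ^ 2 ≤ A ^ 2 ∧ ∫ x in a..b, X.u1 x T ^ 2 ≤ A ^ 2 ∧
      ∫ x in a..b, |X.p x T| ≤ A ^ 2 ∧ ε * (∫ t in (0 : ℝ)..T,
      ((∫ x in a..b, X.v2 x t ^ 2) + ∫ x in a..b, X.u2 x t ^ 2)) ≤ A ^ 2 := by
  have h1 := hX.tot_le hab hF hT
  have e : ∫ x in a..b, |X.p x T| = ∫ x in a..b, X.p x T := by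
    refine intervalIntegral.integral_congr fun x hx => ?_
    rw [uIcc_of_le hab] at hx
    exact abs_of_nonneg (hp x hx T hT)
  have n1 := ii_sq_nonneg hab (fun x => X.v x T)
  have n2 := ii_sq_nonneg hab (fun x => X.u1 x T)
  have n3 : 0 ≤ ∫ x in a..b, |X.p x T| := intervalIntegral.integral_nonneg hab fun _ _ => abs_nonneg _
  have n4 : 0 ≤ ε * (∫ t in (0 : ℝ)..T,
      ((∫ x in a..b, X.v2 x t ^ 2) + ∫ x in a..b, X.u2 x t ^ 2)) :=
    mul_nonneg hε (intervalIntegral.integral_nonneg hT fun _ _ =>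
      add_nonneg (ii_sq_nonneg hab _) (ii_sq_nonneg hab _))
  unfold tot at h1 h0
  rw [← e] at h1
  refine ⟨?_, ?_, ?_, ?_⟩ <;> linarith

/-- Uniform bounds from comparison with the trivial state. -/
lemma exists_bound_zero (hab : a < b) {F F' : ℝ → ℝ} {M : ℝ} (hF : Nonlin F F' M) {A : ℝ}
    (hA : 0 ≤ A) {B : ℝ} (hB : 0 ≤ B) {T : ℝ} (hT : 0 ≤ T) : ∃ K, 0 ≤ K ∧ ∀ (ε : ℝ) (X : Tri), 0 ≤ ε →
    Sol a b ε F F' X → (∀ x ∈ Icc a b, ∀ t, 0 ≤ t → 0 ≤ X.p x t) → tot a b X 0 ≤ A ^ 2 →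
    en a b X zero 0 ≤ B → (∀ t ∈ Icc 0 T, en a b X zero t ≤ K) ∧
      ∫ t in (0 : ℝ)..T, ∫ x in a..b, X.p1 x t ^ 2 ≤ K := by
  obtain ⟨C, hC, H⟩ := exists_en'_le hab hF (m := 0) hA
  have hK1 : 0 ≤ B * Real.exp (C * T) := by positivity
  refine ⟨B * Real.exp (C * T) + 4 * (B + C * (B * Real.exp (C * T)) * T), by positivity, ?_⟩
  intro ε X hε hX hp h0 h0'
  have hd : ∀ t, 0 ≤ t → en' a b X zero t
      ≤ -(1 / 4) * (∫ x in a..b, X.p1 x t ^ 2) + C * en a b X zero t := by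
    intro t ht
    have := H ε X zero hε hX reg_zero t ht (hX.basic hab.le hF hε hp h0 ht).1
      (by simp [zero])
    rw [integral_mul_eq_zero hab.le (fun x _ => (zero_res F F' ε x t).1),
      integral_mul_eq_zero hab.le (fun x _ => (zero_res F F' ε x t).2.1),
      integral_mul_eq_zero hab.le (fun x _ => (zero_res F F' ε x t).2.2)] at this
    simpa [zero] using this
  have hcE := hX.continuousOn_en hab.le reg_zero
  have hE : ∀ t ∈ Icc 0 T, en a b X zero t ≤ B * Real.exp (C * T) := by
    intro t ht
    have := gronwall_right (σ := 0) le_rfl (fun t ht => hX.hasDeriv_en hab.le reg_zero ht) hcE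
      (k := fun _ => C) continuousOn_const (fun _ _ => hC) (T := t) (fun s hs => by
        have h1 := hd s hs.1
        have h2 := ii_sq_nonneg hab.le (fun x => X.p1 x s)
        linarith) ht.1
    simp only [zero_mul, add_zero, intervalIntegral.integral_const, sub_zero, smul_eq_mul] at this
    refine this.trans ?_
    have h3 : Real.exp (t * C) ≤ Real.exp (C * T) := by
      rw [Real.exp_le_exp, mul_comm]; exact mul_le_mul_of_nonneg_left ht.2 hC
    exact mul_le_mul h0' h3 (Real.exp_pos _).le hB
  have hcP : ContinuousOn (fun t => ∫ x in a..b, X.p1 x t ^ 2) (Ici 0) :=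
    hX.cp1.sq.integral_x hab.le
  refine ⟨fun t ht => (hE t ht).trans (by
    have : 0 ≤ 4 * (B + C * (B * Real.exp (C * T)) * T) := by positivity
    linarith), ?_⟩
  have h5 := le_integral_of_right_deriv (fun t ht => hX.hasDeriv_en hab.le reg_zero ht) hcE
    (g := fun t => C * (B * Real.exp (C * T)) - (1 / 4) * ∫ x in a..b, X.p1 x t ^ 2) (T := T)
    (continuousOn_const.sub (continuousOn_const.mul hcP)) (fun t ht => by
      have h1 := hd t ht.1
      have h2 := mul_le_mul_of_nonneg_left (hE t ⟨ht.1, ht.2.le⟩) hC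
      linarith) hT
  have hi : IntervalIntegrable (fun t => (1 / 4) * ∫ x in a..b, X.p1 x t ^ 2) volume 0 T :=
    ((hcP.mono Icc_subset_Ici_self).ii hT).const_mul _
  rw [intervalIntegral.integral_sub (by simp) hi, intervalIntegral.integral_const_mul (1 / 4)] at h5
  simp only [intervalIntegral.integral_const, sub_zero, smul_eq_mul] at h5
  have h6 := en_nonneg hab.le X zero T
  linarith

/-- Lipschitz dependence on time translations. -/
lemma exists_bound_shift (hab : a < b) {F F' : ℝ → ℝ} {M : ℝ} (hF : Nonlin F F' M) {A : ℝ}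
    (hA : 0 ≤ A) {B : ℝ} (hB : 0 ≤ B) {T : ℝ} (hT : 0 ≤ T) :
    ∃ K, 0 ≤ K ∧ ∀ (ε : ℝ) (X : Tri), 0 ≤ ε →
    Sol a b ε F F' X → (∀ x ∈ Icc a b, ∀ t, 0 ≤ t → 0 ≤ X.p x t) → tot a b X 0 ≤ A ^ 2 →
    en a b X zero 0 ≤ B → ∀ h ∈ Ioc (0 : ℝ) 1, ∀ t ∈ Icc 0 T,
      en a b X (X.shift h) t ≤ K * en a b X (X.shift h) 0 := by
  obtain ⟨C, hC, H⟩ := exists_en'_le hab hF (m := A ^ 2) hA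
  obtain ⟨K, hK, HK⟩ := exists_bound_zero hab hF hA hB (T := T + 1) (by linarith)
  refine ⟨Real.exp (C * (T + K)), (Real.exp_pos _).le, ?_⟩
  intro ε X hε hX hp h0 h0' h hh t ht
  have hP := (HK ε X hε hX hp h0 h0').2
  have hS := hX.toReg.shift hh.1.le
  have hcP : ContinuousOn (fun t => ∫ x in a..b, X.p1 x t ^ 2) (Ici 0) :=
    hX.cp1.sq.integral_x hab.le
  have hcP' : ContinuousOn (fun t => ∫ x in a..b, (X.shift h).p1 x t ^ 2) (Ici 0) :=
    hS.cp1.sq.integral_x hab.le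
  have hcE := hX.continuousOn_en hab.le hS
  have g := gronwall_right (σ := 0) le_rfl (fun t ht => hX.hasDeriv_en hab.le hS ht) hcE
    (k := fun t => C * (1 + ∫ x in a..b, (X.shift h).p1 x t ^ 2))
    (continuousOn_const.mul (continuousOn_const.add hcP'))
    (fun _ _ => mul_nonneg hC (add_nonneg zero_le_one (ii_sq_nonneg hab.le _))) (T := t)
    (fun s hs => by
      have := H ε X (X.shift h) hε hX hS s hs.1 (hX.basic hab.le hF hε hp h0 hs.1).1
        (hX.basic hab.le hF hε hp h0 (add_nonneg hs.1 hh.1.le)).2.2.1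
      rw [integral_mul_eq_zero hab.le (fun x hx => (hX.shift_res hh.1.le hx hs.1).1),
        integral_mul_eq_zero hab.le (fun x hx => (hX.shift_res hh.1.le hx hs.1).2.1),
        integral_mul_eq_zero hab.le (fun x hx => (hX.shift_res hh.1.le hx hs.1).2.2)] at this
      have h2 := ii_sq_nonneg hab.le (fun x => X.p1 x s - (X.shift h).p1 x s)
      linarith) ht.1
  rw [zero_mul, add_zero, mul_comm] at g
  refine g.trans ?_
  have n0 := en_nonneg hab.le X (X.shift h) 0
  gcongr
  rw [intervalIntegral.integral_const_mul, intervalIntegral.integral_add (by simp)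
    ((hcP'.mono Icc_subset_Ici_self).ii ht.1)]
  have e1 : ∫ s in (0 : ℝ)..t, ∫ x in a..b, (X.shift h).p1 x s ^ 2
      = ∫ s in h..(t + h), ∫ x in a..b, X.p1 x s ^ 2 := by
    have := intervalIntegral.integral_comp_add_right (a := 0) (b := t)
      (fun s => ∫ x in a..b, X.p1 x s ^ 2) h
    simpa [Tri.shift] using this
  have e2 : ∫ s in h..(t + h), ∫ x in a..b, X.p1 x s ^ 2
      ≤ ∫ s in (0 : ℝ)..(T + 1), ∫ x in a..b, X.p1 x s ^ 2 :=
    integral_mono_interval_of_nonneg (hcP.mono Icc_subset_Ici_self)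
      (fun _ _ => ii_sq_nonneg hab.le _) ⟨hh.1.le, by linarith [hh.2]⟩
      ⟨by linarith [hh.1, ht.1], by linarith [hh.2, ht.2]⟩ (by linarith [ht.1])
  simp only [intervalIntegral.integral_const, sub_zero, smul_eq_mul, mul_one]
  rw [e1]
  exact mul_le_mul_of_nonneg_left (by linarith [ht.2]) hC

end Tri

lemma ContDiff.hasDerivAt_iteratedDeriv {g : ℝ → ℝ} (hg : ContDiff ℝ (⊤ : ℕ∞) g) (k : ℕ) (x : ℝ) :
    HasDerivAt (iteratedDeriv k g) (iteratedDeriv (k + 1) g x) x := by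
  rw [iteratedDeriv_succ]
  exact ((hg.differentiable_iteratedDeriv k (by exact_mod_cast WithTop.coe_lt_top k)) x).hasDerivAt

lemma iteratedDeriv_eq_zero_of_support {g : ℝ → ℝ}
    (hg : ∃ K : Set ℝ, IsCompact K ∧ K ⊆ Ioo a b ∧ ∀ x, x ∉ K → g x = 0) (k : ℕ) {x : ℝ}
    (hx : x ∉ Ioo a b) : iteratedDeriv k g x = 0 := by
  obtain ⟨K, hK, hKs, h0⟩ := hg
  have : g =ᶠ[nhds x] fun _ => 0 := by
    filter_upwards [hK.isClosed.isOpen_compl.mem_nhds fun h => hx (hKs h)] with y hy using h0 y hy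
  rw [this.iteratedDeriv_eq k]
  simp

lemma CC.of_continuous {g : ℝ → ℝ} (hg : Continuous g) : CC a b (fun x _ => g x) :=
  (hg.comp continuous_fst).continuousOn

namespace Tri

/-- The time-independent state given by the initial data. -/
def stat (v0 u0 Θ0 : ℝ → ℝ) : Tri where
  v x _ := iteratedDeriv 0 v0 x
  v1 x _ := iteratedDeriv 1 v0 x
  v2 x _ := iteratedDeriv 2 v0 x
  v3 x _ := iteratedDeriv 3 v0 x
  v4 x _ := iteratedDeriv 4 v0 x
  vt _ _ := 0
  u x _ := iteratedDeriv 0 u0 x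
  u1 x _ := iteratedDeriv 1 u0 x
  u2 x _ := iteratedDeriv 2 u0 x
  ut _ _ := 0
  p x _ := iteratedDeriv 0 Θ0 x
  p1 x _ := iteratedDeriv 1 Θ0 x
  p2 x _ := iteratedDeriv 2 Θ0 x
  pt _ _ := 0

lemma reg_stat {v0 u0 Θ0 : ℝ → ℝ} (h : SmoothData a b v0 u0 Θ0) : Reg a b (stat v0 u0 Θ0) := by
  have hΘ : iteratedDeriv 1 Θ0 = deriv Θ0 := iteratedDeriv_one
  have cont : ∀ {g : ℝ → ℝ}, ContDiff ℝ (⊤ : ℕ∞) g → ∀ k, CC a b (fun x _ => iteratedDeriv k g x) :=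
    fun hg k => CC.of_continuous (hg.continuous_iteratedDeriv k (by exact_mod_cast le_top))
  have ha : a ∉ Ioo a b := by simp
  have hb : b ∉ Ioo a b := by simp
  have hpa : ∀ x, x ∉ Ioo a b → iteratedDeriv 1 Θ0 x = 0 := fun x hx => by
    obtain ⟨K, _, hK, h0⟩ := h.Θ0x_supp
    rw [hΘ]
    exact h0 x fun h => hx (hK h)
  exact
    { dv := fun x _ t _ => h.v0_smooth.hasDerivAt_iteratedDeriv 0 x
      dv1 := fun x _ t _ => h.v0_smooth.hasDerivAt_iteratedDeriv 1 x
      dv2 := fun x _ t _ => h.v0_smooth.hasDerivAt_iteratedDeriv 2 x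
      dv3 := fun x _ t _ => h.v0_smooth.hasDerivAt_iteratedDeriv 3 x
      tv := fun x _ t _ => hasDerivAt_const _ _
      cv := cont h.v0_smooth 0
      cv1 := cont h.v0_smooth 1
      cv2 := cont h.v0_smooth 2
      cv3 := cont h.v0_smooth 3
      cv4 := cont h.v0_smooth 4
      cvt := CC.const 0
      du := fun x _ t _ => h.u0_smooth.hasDerivAt_iteratedDeriv 0 x
      du1 := fun x _ t _ => h.u0_smooth.hasDerivAt_iteratedDeriv 1 x
      tu := fun x _ t _ => hasDerivAt_const _ _
      cu := cont h.u0_smooth 0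
      cu1 := cont h.u0_smooth 1
      cu2 := cont h.u0_smooth 2
      cut := CC.const 0
      dp := fun x _ t _ => h.Θ0_smooth.hasDerivAt_iteratedDeriv 0 x
      dp1 := fun x _ t _ => h.Θ0_smooth.hasDerivAt_iteratedDeriv 1 x
      tp := fun x _ t _ => hasDerivAt_const _ _
      cp := cont h.Θ0_smooth 0
      cp1 := cont h.Θ0_smooth 1
      cp2 := cont h.Θ0_smooth 2
      cpt := CC.const 0
      bva := fun _ _ => iteratedDeriv_eq_zero_of_support h.v0_supp 0 ha
      bvb := fun _ _ => iteratedDeriv_eq_zero_of_support h.v0_supp 0 hb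
      bv2a := fun _ _ => iteratedDeriv_eq_zero_of_support h.v0_supp 2 ha
      bv2b := fun _ _ => iteratedDeriv_eq_zero_of_support h.v0_supp 2 hb
      bua := fun _ _ => iteratedDeriv_eq_zero_of_support h.u0_supp 0 ha
      bub := fun _ _ => iteratedDeriv_eq_zero_of_support h.u0_supp 0 hb
      bp1a := fun _ _ => hpa a ha
      bp1b := fun _ _ => hpa b hb }

lemma abs_integral_mul_le_of_bound (hab : a ≤ b) {g r : ℝ → ℝ} (hg : ContinuousOn g (Icc a b))
    (hr : ContinuousOn r (Icc a b)) {N E : ℝ} (hN : 0 ≤ N) (hrN : ∀ x ∈ Icc a b, |r x| ≤ N)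
    (hE : ∫ x in a..b, g x ^ 2 ≤ E) :
    |∫ x in a..b, g x * r x| ≤ √E * (√(b - a) * N) := by
  have h1 : ∫ x in a..b, r x ^ 2 ≤ (b - a) * N ^ 2 := by
    have := intervalIntegral.integral_mono_on hab (g := fun _ => N ^ 2)
      (ContinuousOn.ii hab (hr.pow 2)) (by simp)
      (fun x hx => by
        have := pow_le_pow_left₀ (abs_nonneg _) (hrN x hx) 2
        rwa [sq_abs] at this)
    simpa using this
  have h2 : √(∫ x in a..b, r x ^ 2) ≤ √(b - a) * N := by
    rw [show √(b - a) * N = √((b - a) * N ^ 2) by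
      rw [Real.sqrt_mul (sub_nonneg.2 hab), Real.sqrt_sq hN]]
    exact Real.sqrt_le_sqrt h1
  calc |∫ x in a..b, g x * r x| ≤ ∫ x in a..b, |g x * r x| :=
        intervalIntegral.abs_integral_le_integral_abs hab
    _ ≤ √(∫ x in a..b, g x ^ 2) * √(∫ x in a..b, r x ^ 2) :=
        intervalIntegral_abs_mul_le_sqrt hab hg hr
    _ ≤ _ := by gcongr

/-- The initial growth of a solution is controlled linearly in time. -/
lemma exists_bound_stat (hab : a < b) {F F' : ℝ → ℝ} {M : ℝ} (hF : Nonlin F F' M)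
    {v0 u0 Θ0 : ℝ → ℝ} (hd : SmoothData a b v0 u0 Θ0) {A : ℝ} (hA : 0 ≤ A) :
    ∃ K, 0 ≤ K ∧ ∀ (ε : ℝ) (X : Tri), ε ∈ Ioo (0 : ℝ) 1 → Sol a b ε F F' X →
    (∀ x ∈ Icc a b, ∀ t, 0 ≤ t → 0 ≤ X.p x t) → tot a b X 0 ≤ A ^ 2 →
    en a b X (stat v0 u0 Θ0) 0 = 0 → ∀ h ∈ Ioc (0 : ℝ) 1,
      en a b X (stat v0 u0 Θ0) h ≤ K * h ^ 2 := by
  obtain ⟨C, hC, H⟩ := exists_en'_le hab hF (m := ∫ x in a..b, |Θ0 x|) hA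
  have hY := reg_stat hd
  set Y := stat v0 u0 Θ0 with hYdef
  have cont : ∀ {g : ℝ → ℝ}, ContDiff ℝ (⊤ : ℕ∞) g → ∀ k, Continuous (iteratedDeriv k g) :=
    fun hg k => hg.continuous_iteratedDeriv k (by exact_mod_cast le_top)
  have bd : ∀ {g : ℝ → ℝ}, ContDiff ℝ (⊤ : ℕ∞) g → ∀ k, ∃ B, 0 ≤ B ∧ ∀ x ∈ Icc a b,
      |iteratedDeriv k g x| ≤ B := fun hg k => by
    obtain ⟨B, hB0, hB⟩ := (CC.of_continuous (a := a) (b := b) (cont hg k)).bdd 0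
    exact ⟨B, hB0, fun x hx => hB x hx 0 ⟨le_rfl, le_rfl⟩⟩
  obtain ⟨V0, pV0, hV0⟩ := bd hd.v0_smooth 0
  obtain ⟨V1, pV1, hV1⟩ := bd hd.v0_smooth 1
  obtain ⟨V4, pV4, hV4⟩ := bd hd.v0_smooth 4
  obtain ⟨U2, pU2, hU2⟩ := bd hd.u0_smooth 2
  obtain ⟨U3, pU3, hU3⟩ := bd hd.u0_smooth 3
  obtain ⟨P0, pP0, hP0⟩ := bd hd.Θ0_smooth 0
  obtain ⟨P1, pP1, hP1⟩ := bd hd.Θ0_smooth 1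
  obtain ⟨P2, pP2, hP2⟩ := bd hd.Θ0_smooth 2
  have hM := hF.nonneg
  obtain ⟨N, hN⟩ : ∃ N, N = (V4 + U2 + M * P1) + (U3 + V1) + (P2 + M * P0 * V1) := ⟨_, rfl⟩
  have hN1 : V4 + U2 + M * P1 ≤ N := by
    rw [hN]; linarith [show 0 ≤ (U3 + V1) + (P2 + M * P0 * V1) by positivity]
  have hN2 : U3 + V1 ≤ N := by
    rw [hN]; linarith [show 0 ≤ (V4 + U2 + M * P1) + (P2 + M * P0 * V1) by positivity]
  have hN3 : P2 + M * P0 * V1 ≤ N := by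
    rw [hN]; linarith [show 0 ≤ (V4 + U2 + M * P1) + (U3 + V1) by positivity]
  have hN0 : 0 ≤ N := by rw [hN]; positivity
  set ρ := √(b - a) * N with hρ
  have hρ0 : 0 ≤ ρ := by positivity
  set κ := C * (1 + ∫ x in a..b, iteratedDeriv 1 Θ0 x ^ 2) with hκ
  have hκ0 : 0 ≤ κ := mul_nonneg hC (add_nonneg zero_le_one (ii_sq_nonneg hab.le _))
  refine ⟨9 * ρ ^ 2 * Real.exp (κ + 1), by positivity, ?_⟩
  intro ε X hε hX hp h0 h00 h hh
  have ha : a ∉ Ioo a b := by simp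
  have hb : b ∉ Ioo a b := by simp
  have key : ∀ t, 0 ≤ t → en' a b X Y t ≤ κ * en a b X Y t + 6 * (√(en a b X Y t) * ρ) := by
    intro t ht
    have h1 := H ε X Y hε.1.le hX hY t ht (hX.basic hab.le hF hε.1.le hp h0 ht).1
      (by simp [hYdef, stat])
    have n1 := ii_sq_nonneg hab.le (fun x => X.v x t - Y.v x t)
    have n2 := ii_sq_nonneg hab.le (fun x => X.u1 x t - Y.u1 x t)
    have n3 := ii_sq_nonneg hab.le (fun x => X.p x t - Y.p x t)
    have n4 := ii_sq_nonneg hab.le (fun x => X.p1 x t - Y.p1 x t)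
    have cv := hX.cv.slice ht
    have cv' := hY.cv.slice ht
    have cu := hX.cu1.slice ht
    have cu' := hY.cu1.slice ht
    have cp := hX.cp.slice ht
    have cp' := hY.cp.slice ht
    have cu2 := hX.cu2.slice ht
    have cu2' := hY.cu2.slice ht
    have q1 : |∫ x in a..b, (X.v x t - Y.v x t) * res1 ε F' Y x t| ≤ √(en a b X Y t) * ρ := by
      refine abs_integral_mul_le_of_bound hab.le (by fun_prop) (hY.continuousOn_res1 hF ε ht) hN0
        (fun x hx => ?_) (by unfold en; linarith)
      have e : res1 ε F' Y x t = ε * iteratedDeriv 4 v0 x - iteratedDeriv 2 u0 x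
          + F' (iteratedDeriv 0 Θ0 x) * iteratedDeriv 1 Θ0 x := by simp [res1, hYdef, stat]
      rw [e]
      refine le_trans ?_ hN1
      refine (abs_add_le _ _).trans (add_le_add ((abs_sub _ _).trans (add_le_add ?_ (hU2 x hx))) ?_)
      · rw [abs_mul, abs_of_pos hε.1]
        calc ε * |iteratedDeriv 4 v0 x| ≤ 1 * V4 :=
              mul_le_mul hε.2.le (hV4 x hx) (abs_nonneg _) zero_le_one
          _ = V4 := one_mul _
      · rw [abs_mul]
        exact mul_le_mul (hF.bound _) (hP1 x hx) (abs_nonneg _) hM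
    have q3 : |∫ x in a..b, (X.p x t - Y.p x t) * res3 F Y x t| ≤ √(en a b X Y t) * ρ := by
      refine abs_integral_mul_le_of_bound hab.le (by fun_prop) (hY.continuousOn_res3 hF ht) hN0
        (fun x hx => ?_) (by unfold en; linarith)
      have e : res3 F Y x t = -iteratedDeriv 2 Θ0 x
          + F (iteratedDeriv 0 Θ0 x) * iteratedDeriv 1 v0 x := by simp [res3, hYdef, stat]
      rw [e]
      refine le_trans ?_ hN3
      refine (abs_add_le _ _).trans (add_le_add ((abs_neg _).trans_le (hP2 x hx)) ?_)
      rw [abs_mul]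
      exact mul_le_mul ((hF.abs_le _).trans (mul_le_mul_of_nonneg_left (hP0 x hx) hM)) (hV1 x hx)
        (abs_nonneg _) (by positivity)
    have q2 : |∫ x in a..b, (X.u2 x t - Y.u2 x t) * res2 ε Y x t| ≤ √(en a b X Y t) * ρ := by
      have c3 := cont hd.u0_smooth 3
      have c1 := cont hd.v0_smooth 1
      have c2 := cont hd.u0_smooth 2
      have c0 := cont hd.v0_smooth 0
      have z := fun x (hx : x ∉ Ioo a b) => iteratedDeriv_eq_zero_of_support hd.v0_supp 0 hx
      have z' := fun x (hx : x ∉ Ioo a b) => iteratedDeriv_eq_zero_of_support hd.u0_supp 2 hx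
      have e : ∀ x, res2 ε Y x t = -(ε * iteratedDeriv 2 u0 x) - iteratedDeriv 0 v0 x := by
        intro x; simp [res2, hYdef, stat]
      simp only [e]
      have ip := integral_parts_zero hab.le
        (p := fun x => -(ε * iteratedDeriv 2 u0 x) - iteratedDeriv 0 v0 x)
        (p' := fun x => -(ε * iteratedDeriv 3 u0 x) - iteratedDeriv 1 v0 x)
        (q := fun x => X.u1 x t - Y.u1 x t) (q' := fun x => X.u2 x t - Y.u2 x t)
        (fun x _ => (((hd.u0_smooth.hasDerivAt_iteratedDeriv 2 x).const_mul ε).neg).sub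
          (hd.v0_smooth.hasDerivAt_iteratedDeriv 0 x))
        (fun x hx => (hX.du1 x hx t ht).sub (hY.du1 x hx t ht)) (by fun_prop) (by fun_prop)
        (by simp only [z a ha, z' a ha]; ring) (by simp only [z b hb, z' b hb]; ring)
      have e1 : ∫ x in a..b, (X.u2 x t - Y.u2 x t)
          * (-(ε * iteratedDeriv 2 u0 x) - iteratedDeriv 0 v0 x)
          = - ∫ x in a..b, (X.u1 x t - Y.u1 x t)
            * (-(ε * iteratedDeriv 3 u0 x) - iteratedDeriv 1 v0 x) := by
        simpa only [mul_comm] using ip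
      rw [e1, abs_neg]
      refine abs_integral_mul_le_of_bound hab.le (by fun_prop) (by fun_prop) hN0
        (fun x hx => ?_) (by unfold en; linarith)
      refine le_trans ?_ hN2
      refine (abs_sub _ _).trans (add_le_add ?_ (hV1 x hx))
      rw [abs_neg, abs_mul, abs_of_pos hε.1]
      calc ε * |iteratedDeriv 3 u0 x| ≤ 1 * U3 :=
            mul_le_mul hε.2.le (hU3 x hx) (abs_nonneg _) zero_le_one
        _ = U3 := one_mul _
    have e2 : C * (1 + ∫ x in a..b, Y.p1 x t ^ 2) = κ := rfl
    rw [e2] at h1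
    linarith [(abs_le.1 q1).1, (abs_le.1 q2).2, (abs_le.1 q3).1]
  have g := gronwall_right (σ := 9 * h * ρ ^ 2) (k := fun _ => κ + h⁻¹) (T := h)
    (by have := hh.1; positivity) (fun t ht => hX.hasDeriv_en hab.le hY ht)
    (hX.continuousOn_en hab.le hY) continuousOn_const
    (fun _ _ => add_nonneg hκ0 (inv_nonneg.2 hh.1.le)) (fun t ht => by
      have h1 := key t ht.1
      have h2 := en_nonneg hab.le X Y t
      have h3 := Real.sq_sqrt h2
      have h4 : 6 * (√(en a b X Y t) * ρ) ≤ h⁻¹ * en a b X Y t + 9 * h * ρ ^ 2 := by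
        have h5 : 0 ≤ h⁻¹ * (√(en a b X Y t) - 3 * h * ρ) ^ 2 :=
          mul_nonneg (inv_nonneg.2 hh.1.le) (sq_nonneg _)
        have h6 : h⁻¹ * h = 1 := inv_mul_cancel₀ hh.1.ne'
        have h7 : h⁻¹ * (√(en a b X Y t) - 3 * h * ρ) ^ 2 = h⁻¹ * √(en a b X Y t) ^ 2
            - 6 * (h⁻¹ * h) * (√(en a b X Y t) * ρ) + 9 * (h⁻¹ * h) * h * ρ ^ 2 := by ring
        rw [h7, h6, h3] at h5
        linarith
      linarith) hh.1.le
  rw [h00, zero_add] at g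
  simp only [intervalIntegral.integral_const, sub_zero, smul_eq_mul] at g
  rw [mul_add, mul_inv_cancel₀ hh.1.ne'] at g
  refine g.trans ?_
  have h8 : Real.exp (h * κ + 1) ≤ Real.exp (κ + 1) := by
    rw [Real.exp_le_exp]
    nlinarith [hh.2]
  calc 9 * h * ρ ^ 2 * h * Real.exp (h * κ + 1)
      ≤ 9 * h * ρ ^ 2 * h * Real.exp (κ + 1) := by have := hh.1; gcongr
    _ = _ := by ring

end Tri

namespace Tri

/-- The initial values of a state. -/
def Init (a b : ℝ) (v0 u0 Θ0 : ℝ → ℝ) (X : Tri) : Prop :=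
  ∀ x ∈ Icc a b, X.v x 0 = v0 x ∧ X.u x 0 = u0 x ∧ X.p x 0 = Θ0 x

lemma Init.u1_eq (hab : a < b) {v0 u0 Θ0 : ℝ → ℝ} {X : Tri} (hX : Reg a b X)
    (hi : Init a b v0 u0 Θ0 X) (hd : SmoothData a b v0 u0 Θ0) {x : ℝ} (hx : x ∈ Icc a b) :
    X.u1 x 0 = iteratedDeriv 1 u0 x := by
  have h1 := (hX.du x hx 0 self_mem_Ici).hasDerivWithinAt (s := Icc a b)
  have h2 := (hd.u0_smooth.hasDerivAt_iteratedDeriv 0 x).hasDerivWithinAt (s := Icc a b)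
  have h3 : HasDerivWithinAt (fun y => X.u y 0) (iteratedDeriv 1 u0 x) (Icc a b) x :=
    h2.congr (fun y hy => by simpa using (hi y hy).2.1) (by simpa using (hi x hx).2.1)
  exact (uniqueDiffOn_Icc hab x hx).eq_deriv _ h1 h3

/-- Bounds on a state up to time `T`. -/
structure Bounded (a b T K ε : ℝ) (X : Tri) : Prop where
  v : ∀ t ∈ Icc 0 T, ∫ x in a..b, X.v x t ^ 2 ≤ K
  u1 : ∀ t ∈ Icc 0 T, ∫ x in a..b, X.u1 x t ^ 2 ≤ K
  p : ∀ t ∈ Icc 0 T, ∫ x in a..b, X.p x t ^ 2 ≤ K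
  vt : ∀ t ∈ Icc 0 T, ∫ x in a..b, X.vt x t ^ 2 ≤ K
  pt : ∀ t ∈ Icc 0 T, ∫ x in a..b, X.pt x t ^ 2 ≤ K
  p1 : ∀ t ∈ Icc 0 T, ∫ x in a..b, X.p1 x t ^ 2 ≤ K
  vis : ε * (∫ t in (0 : ℝ)..T,
      ((∫ x in a..b, X.v2 x t ^ 2) + ∫ x in a..b, X.u2 x t ^ 2)) ≤ K

lemma integral_congr_Icc (hab : a ≤ b) {g r : ℝ → ℝ} (h : ∀ x ∈ Icc a b, g x = r x) :
    ∫ x in a..b, g x = ∫ x in a..b, r x :=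
  intervalIntegral.integral_congr fun x hx => h x (by rwa [uIcc_of_le hab] at hx)

lemma Sol.grad_bound (hab : a < b) {F F' : ℝ → ℝ} {M : ℝ} (hF : Nonlin F F' M) {A : ℝ}
    (hA : 0 ≤ A) : ∃ C, 0 ≤ C ∧ ∀ (ε : ℝ) (X : Tri), Sol a b ε F F' X → ∀ t, 0 ≤ t →
    ∫ x in a..b, X.v x t ^ 2 ≤ A ^ 2 →
    ∫ x in a..b, X.p1 x t ^ 2 ≤ 4 * (√(∫ x in a..b, X.p x t ^ 2) * √(∫ x in a..b, X.pt x t ^ 2)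
      + C * ((∫ x in a..b, X.v x t ^ 2) + ∫ x in a..b, X.p x t ^ 2)) := by
  obtain ⟨C, hC, H⟩ := theta_energy (m := 0) hab hF hA
  refine ⟨C, hC, fun ε X hX t ht hv => ?_⟩
  have h1 := H (fun x => X.v x t) (fun x => X.v1 x t) (fun _ => 0) (fun _ => 0)
    (fun x => X.p x t) (fun x => X.p1 x t) (fun x => X.p2 x t) (fun _ => 0) (fun _ => 0)
    (fun _ => 0) (fun x hx => hX.dv x hx t ht) (fun x _ => hasDerivAt_const _ _)
    (fun x hx => hX.dp x hx t ht) (fun x hx => hX.dp1 x hx t ht) (fun x _ => hasDerivAt_const _ _)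
    (fun x _ => hasDerivAt_const _ _) (hX.cv1.slice ht) continuousOn_const (hX.cp2.slice ht)
    continuousOn_const (hX.bva t ht) (hX.bvb t ht) rfl rfl (hX.bp1a t ht) (hX.bp1b t ht) rfl rfl
    hv (by simp)
  simp only [sub_zero, mul_zero, ne_eq, OfNat.ofNat_ne_zero, not_false_eq_true, zero_pow,
    intervalIntegral.integral_zero, add_zero, one_mul] at h1
  have h2 : ∫ x in a..b, X.p x t * (X.p2 x t - F (X.p x t) * X.v1 x t)
      = ∫ x in a..b, X.p x t * X.pt x t :=
    integral_congr_Icc hab.le fun x hx => by rw [hX.eqp x hx t ht]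
  rw [h2] at h1
  have h3 := intervalIntegral_abs_mul_le_sqrt hab.le (hX.cp.slice ht) (hX.cpt.slice ht)
  have h4 := intervalIntegral.abs_integral_le_integral_abs (μ := volume)
    (f := fun x => X.p x t * X.pt x t) hab.le
  have h5 := (abs_le.1 (h4.trans h3)).1
  linarith

/-- Bounds uniform with respect to the regularization parameter. -/
theorem uniform_bounds (hab : a < b) {F F' : ℝ → ℝ} {M : ℝ} (hF : Nonlin F F' M)
    {v0 u0 Θ0 : ℝ → ℝ} (hd : SmoothData a b v0 u0 Θ0) {T : ℝ} (hT : 0 ≤ T) :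
    ∃ K, 0 ≤ K ∧ ∀ (ε : ℝ) (X : Tri), ε ∈ Ioo (0 : ℝ) 1 → Sol a b ε F F' X →
    (∀ x ∈ Icc a b, ∀ t, 0 ≤ t → 0 ≤ X.p x t) → Init a b v0 u0 Θ0 X → Bounded a b T K ε X := by
  have hΘ0 : 0 ≤ ∫ x in a..b, Θ0 x :=
    intervalIntegral.integral_nonneg hab.le fun x hx => (hd.Θ0_pos x hx).le
  set A2 := (∫ x in a..b, v0 x ^ 2) + (∫ x in a..b, iteratedDeriv 1 u0 x ^ 2)
    + 2 * ∫ x in a..b, Θ0 x with hA2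
  set B := (∫ x in a..b, v0 x ^ 2) + (∫ x in a..b, iteratedDeriv 1 u0 x ^ 2)
    + ∫ x in a..b, Θ0 x ^ 2 with hB
  have n1 := ii_sq_nonneg hab.le v0
  have n2 := ii_sq_nonneg hab.le (iteratedDeriv 1 u0)
  have n3 := ii_sq_nonneg hab.le Θ0
  have hA20 : 0 ≤ A2 := by positivity
  have hB0 : 0 ≤ B := by positivity
  set A := √A2 with hAdef
  have hA : 0 ≤ A := Real.sqrt_nonneg _
  have hAA : A ^ 2 = A2 := Real.sq_sqrt hA20
  obtain ⟨K1, pK1, H1⟩ := exists_bound_zero hab hF hA hB0 hT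
  obtain ⟨K2, pK2, H2⟩ := exists_bound_shift hab hF hA hB0 hT
  obtain ⟨K3, pK3, H3⟩ := exists_bound_stat hab hF hd hA
  obtain ⟨C, hC, H4⟩ := Sol.grad_bound hab hF hA
  set K4 := 4 * (√K1 * √(K2 * K3) + C * (A ^ 2 + K1)) with hK4
  have pK4 : 0 ≤ K4 := by positivity
  have pA2 : 0 ≤ A ^ 2 := by positivity
  have pK23 : 0 ≤ K2 * K3 := by positivity
  refine ⟨A ^ 2 + K1 + K2 * K3 + K4, by positivity, ?_⟩
  intro ε X hε hX hp hi
  have iv : ∫ x in a..b, X.v x 0 ^ 2 = ∫ x in a..b, v0 x ^ 2 :=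
    integral_congr_Icc hab.le fun x hx => by rw [(hi x hx).1]
  have iu : ∫ x in a..b, X.u1 x 0 ^ 2 = ∫ x in a..b, iteratedDeriv 1 u0 x ^ 2 :=
    integral_congr_Icc hab.le fun x hx => by rw [hi.u1_eq hab hX.toReg hd hx]
  have ip : ∫ x in a..b, X.p x 0 ^ 2 = ∫ x in a..b, Θ0 x ^ 2 :=
    integral_congr_Icc hab.le fun x hx => by rw [(hi x hx).2.2]
  have ip' : ∫ x in a..b, X.p x 0 = ∫ x in a..b, Θ0 x :=
    integral_congr_Icc hab.le fun x hx => by rw [(hi x hx).2.2]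
  have h0 : tot a b X 0 ≤ A ^ 2 := by unfold tot; rw [hAA, iv, iu, ip']
  have hz : en a b X zero 0 ≤ B := by
    simp only [en, zero, sub_zero]; rw [iv, iu, ip]
  have hs : en a b X (stat v0 u0 Θ0) 0 = 0 := by
    unfold en
    rw [integral_congr_Icc hab.le (g := fun x => (X.v x 0 - (stat v0 u0 Θ0).v x 0) ^ 2)
        (r := fun _ => 0) (fun x hx => by simp [stat, (hi x hx).1]),
      integral_congr_Icc hab.le (g := fun x => (X.u1 x 0 - (stat v0 u0 Θ0).u1 x 0) ^ 2)
        (r := fun _ => 0) (fun x hx => by rw [hi.u1_eq hab hX.toReg hd hx]; simp [stat]),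
      integral_congr_Icc hab.le (g := fun x => (X.p x 0 - (stat v0 u0 Θ0).p x 0) ^ 2)
        (r := fun _ => 0) (fun x hx => by simp [stat, (hi x hx).2.2])]
    simp
  have hsh : ∀ h ∈ Ioc (0 : ℝ) 1, en a b X (X.shift h) 0 ≤ K3 * h ^ 2 := by
    intro h hh
    refine le_of_eq_of_le ?_ (H3 ε X hε hX hp h0 hs h hh)
    unfold en
    congr 1
    · congr 1
      · refine integral_congr_Icc hab.le fun x hx => ?_
        simp only [shift, stat, iteratedDeriv_zero, (hi x hx).1, zero_add]; ring
      · refine integral_congr_Icc hab.le fun x hx => ?_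
        simp only [shift, stat, hi.u1_eq hab hX.toReg hd hx, zero_add]; ring
    · refine integral_congr_Icc hab.le fun x hx => ?_
      simp only [shift, stat, iteratedDeriv_zero, (hi x hx).2.2, zero_add]; ring
  have b0 := H1 ε X hε.1.le hX hp h0 hz
  have b1 : ∀ t ∈ Icc 0 T, ∀ h ∈ Ioc (0 : ℝ) 1, en a b X (X.shift h) t ≤ K2 * K3 * h ^ 2 :=
    fun t ht h hh => (H2 ε X hε.1.le hX hp h0 hz h hh t ht).trans (by
      rw [mul_assoc]; exact mul_le_mul_of_nonneg_left (hsh h hh) pK2)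
  have bp : ∀ t ∈ Icc 0 T, ∫ x in a..b, X.p x t ^ 2 ≤ K1 := fun t ht => by
    have := b0.1 t ht
    simp only [en, zero, sub_zero] at this
    linarith [ii_sq_nonneg hab.le (fun x => X.v x t), ii_sq_nonneg hab.le (fun x => X.u1 x t)]
  have bvt : ∀ t ∈ Icc 0 T, ∫ x in a..b, X.vt x t ^ 2 ≤ K2 * K3 := fun t ht =>
    integral_dt_sq_le hab.le hX.tv hX.cv hX.cvt ht.1 fun h hh => by
      have := b1 t ht h hh
      simp only [en, shift] at this
      linarith [ii_sq_nonneg hab.le (fun x => X.u1 x t - X.u1 x (t + h)),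
        ii_sq_nonneg hab.le (fun x => X.p x t - X.p x (t + h))]
  have bpt : ∀ t ∈ Icc 0 T, ∫ x in a..b, X.pt x t ^ 2 ≤ K2 * K3 := fun t ht =>
    integral_dt_sq_le hab.le hX.tp hX.cp hX.cpt ht.1 fun h hh => by
      have := b1 t ht h hh
      simp only [en, shift] at this
      linarith [ii_sq_nonneg hab.le (fun x => X.u1 x t - X.u1 x (t + h)),
        ii_sq_nonneg hab.le (fun x => X.v x t - X.v x (t + h))]
  have bas := fun t (ht : t ∈ Icc 0 T) => hX.basic hab.le hF hε.1.le hp h0 ht.1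
  refine ⟨fun t ht => ?_, fun t ht => ?_, fun t ht => ?_, fun t ht => ?_, fun t ht => ?_,
    fun t ht => ?_, ?_⟩
  · linarith [(bas t ht).1]
  · linarith [(bas t ht).2.1]
  · linarith [bp t ht]
  · linarith [bvt t ht]
  · linarith [bpt t ht]
  · have h1 := H4 ε X hX t ht.1 (bas t ht).1
    have h2 : √(∫ x in a..b, X.p x t ^ 2) * √(∫ x in a..b, X.pt x t ^ 2) ≤ √K1 * √(K2 * K3) := by
      gcongr
      · exact bp t ht
      · exact bpt t ht
    have h3 : C * ((∫ x in a..b, X.v x t ^ 2) + ∫ x in a..b, X.p x t ^ 2) ≤ C * (A ^ 2 + K1) :=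
      mul_le_mul_of_nonneg_left (add_le_add (bas t ht).1 (bp t ht)) hC
    linarith
  · linarith [(bas T ⟨hT, le_rfl⟩).2.2.2]

end Tri

lemma HypF.exists_nonlin {f f' f'' : ℝ → ℝ} (hf : HypF f f' f'') :
    ∃ (F F' : ℝ → ℝ) (M : ℝ), Nonlin F F' M ∧ (∀ x, 0 ≤ x → F x = f x) ∧
      ∀ x, 0 ≤ x → F' x = f' x := by
  obtain ⟨M, hM⟩ := hf.bdd
  have hlip : ∀ x ∈ Ici (0 : ℝ), ∀ y ∈ Ici (0 : ℝ), |f' y - f' x| ≤ M * |y - x| :=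
    fun x hx y hy => (convex_Ici (0 : ℝ)).norm_image_sub_le_of_norm_hasDerivWithin_le
      hf.hasDeriv₂ (fun z hz => (hM z hz).2) hx hy
  have hM0 : 0 ≤ M := (abs_nonneg _).trans (hM 0 self_mem_Ici).1
  set F' : ℝ → ℝ := fun x => f' (max x 0) with hF'
  have lip : ∀ x y, |F' x - F' y| ≤ M * |x - y| := fun x y =>
    (hlip _ (le_max_right y 0) _ (le_max_right x 0)).trans
      (mul_le_mul_of_nonneg_left (abs_max_sub_max_le_abs _ _ _) hM0)
  have cF' : Continuous F' := by
    have : LipschitzWith M.toNNReal F' := LipschitzWith.of_dist_le_mul fun x y => by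
      rw [Real.coe_toNNReal _ hM0, Real.dist_eq, Real.dist_eq]
      exact lip x y
    exact this.continuous
  refine ⟨fun x => ∫ y in (0 : ℝ)..x, F' y, F', M,
    ⟨fun x => intervalIntegral.integral_hasDerivAt_right (cF'.intervalIntegrable _ _)
      cF'.aestronglyMeasurable.stronglyMeasurableAtFilter cF'.continuousAt,
      fun x => (hM _ (le_max_right x 0)).1, lip, by simp⟩, fun x hx => ?_, fun x hx => ?_⟩
  · beta_reduce
    rw [intervalIntegral.integral_eq_sub_of_hasDeriv_right_of_le hx (f := f)
      (fun y hy => ((hf.hasDeriv₁ y hy.1).continuousWithinAt).mono Icc_subset_Ici_self)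
      (fun y hy => ?_) (cF'.intervalIntegrable _ _), hf.zero, sub_zero]
    have := (hf.hasDeriv₁ y hy.1.le).mono (Ioi_subset_Ici hy.1.le)
    simpa [hF', max_eq_left hy.1.le] using this
  · simp [hF', max_eq_left hx]

lemma CC.eq_of_eq_interior (hab : a < b) {w z : ℝ → ℝ → ℝ} (hw : CC a b w) (hz : CC a b z)
    (h : ∀ x ∈ Ioo a b, ∀ t ∈ Ioi (0 : ℝ), w x t = z x t) :
    ∀ x ∈ Icc a b, ∀ t, 0 ≤ t → w x t = z x t := by
  have : EqOn (uncurry w) (uncurry z) (Icc a b ×ˢ Ici (0 : ℝ)) :=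
    EqOn.of_subset_closure (s := Ioo a b ×ˢ Ioi (0 : ℝ)) (fun q hq => h q.1 hq.1 q.2 hq.2) hw hz
      (prod_mono Ioo_subset_Icc_self Ioi_subset_Ici_self)
      (by rw [closure_prod_eq, closure_Ioo hab.ne, closure_Ioi])
  exact fun x hx t ht => this (mk_mem_prod hx ht : (x, t) ∈ _)

lemma CC.eq_zero_of_pos {w : ℝ → ℝ → ℝ} (hw : CC a b w) {x : ℝ} (hx : x ∈ Icc a b)
    (h : ∀ t ∈ Ioi (0 : ℝ), w x t = 0) : ∀ t, 0 ≤ t → w x t = 0 := by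
  have : EqOn (fun t => w x t) (fun _ => 0) (Ici (0 : ℝ)) :=
    EqOn.of_subset_closure (s := Ioi (0 : ℝ)) h (hw.slice_t hx) continuousOn_const
      Ioi_subset_Ici_self (by rw [closure_Ioi])
  exact fun t ht => this ht

/-- A classical solution together with its partial derivatives. -/
def toTri (v u Θ : ℝ → ℝ → ℝ) : Tri where
  v := v
  v1 := pdx v
  v2 := pdx (pdx v)
  v3 := pdx (pdx (pdx v))
  v4 := pdx (pdx (pdx (pdx v)))
  vt := pdt v
  u := u
  u1 := pdx u
  u2 := pdx (pdx u)
  ut := pdt u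
  p := Θ
  p1 := pdx Θ
  p2 := pdx (pdx Θ)
  pt := pdt Θ

lemma IsClassicalSolEps.reg (hab : a < b) {f : ℝ → ℝ} {ε : ℝ} {v0 u0 Θ0 : ℝ → ℝ}
    {v u Θ : ℝ → ℝ → ℝ} (h : IsClassicalSolEps a b f ε v0 u0 Θ0 v u Θ) :
    Tri.Reg a b (toTri v u Θ) := by
  have ha : a ∈ Icc a b := left_mem_Icc.2 hab.le
  have hb : b ∈ Icc a b := right_mem_Icc.2 hab.le
  have cv0 : CC a b v := h.cont_v 0 (by norm_num)
  have cv2 : CC a b (pdx (pdx v)) := h.cont_v 2 (by norm_num)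
  have cu0 : CC a b u := h.cont_u 0 (by norm_num)
  have cp1 : CC a b (pdx Θ) := h.cont_Θ 1 (by norm_num)
  exact
    { dv := fun x hx t ht => (h.diffx_v 0 (by norm_num) x hx t ht).hasDerivAt
      dv1 := fun x hx t ht => (h.diffx_v 1 (by norm_num) x hx t ht).hasDerivAt
      dv2 := fun x hx t ht => (h.diffx_v 2 (by norm_num) x hx t ht).hasDerivAt
      dv3 := fun x hx t ht => (h.diffx_v 3 (by norm_num) x hx t ht).hasDerivAt
      tv := fun x hx t ht => (h.difft_v x hx t ht).hasDerivAt
      cv := cv0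
      cv1 := h.cont_v 1 (by norm_num)
      cv2 := cv2
      cv3 := h.cont_v 3 (by norm_num)
      cv4 := h.cont_v 4 (by norm_num)
      cvt := h.contt_v
      du := fun x hx t ht => (h.diffx_u 0 (by norm_num) x hx t ht).hasDerivAt
      du1 := fun x hx t ht => (h.diffx_u 1 (by norm_num) x hx t ht).hasDerivAt
      tu := fun x hx t ht => (h.difft_u x hx t ht).hasDerivAt
      cu := cu0
      cu1 := h.cont_u 1 (by norm_num)
      cu2 := h.cont_u 2 (by norm_num)
      cut := h.contt_u
      dp := fun x hx t ht => (h.diffx_Θ 0 (by norm_num) x hx t ht).hasDerivAt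
      dp1 := fun x hx t ht => (h.diffx_Θ 1 (by norm_num) x hx t ht).hasDerivAt
      tp := fun x hx t ht => (h.difft_Θ x hx t ht).hasDerivAt
      cp := h.cont_Θ 0 (by norm_num)
      cp1 := cp1
      cp2 := h.cont_Θ 2 (by norm_num)
      cpt := h.contt_Θ
      bva := cv0.eq_zero_of_pos ha fun t ht => (h.bc_v t ht).1
      bvb := cv0.eq_zero_of_pos hb fun t ht => (h.bc_v t ht).2.1
      bv2a := cv2.eq_zero_of_pos ha fun t ht => (h.bc_v t ht).2.2.1
      bv2b := cv2.eq_zero_of_pos hb fun t ht => (h.bc_v t ht).2.2.2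
      bua := cu0.eq_zero_of_pos ha fun t ht => (h.bc_u t ht).1
      bub := cu0.eq_zero_of_pos hb fun t ht => (h.bc_u t ht).2
      bp1a := cp1.eq_zero_of_pos ha fun t ht => (h.bc_Θ t ht).1
      bp1b := cp1.eq_zero_of_pos hb fun t ht => (h.bc_Θ t ht).2 }

lemma IsClassicalSolEps.sol (hab : a < b) {f : ℝ → ℝ} {ε : ℝ} {v0 u0 Θ0 : ℝ → ℝ}
    {v u Θ : ℝ → ℝ → ℝ} (h : IsClassicalSolEps a b f ε v0 u0 Θ0 v u Θ)
    {F F' : ℝ → ℝ} {M : ℝ} (hF : Nonlin F F' M) (hFf : ∀ x, 0 ≤ x → F x = f x) :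
    Tri.Sol a b ε F F' (toTri v u Θ) := by
  have R := h.reg hab
  refine { R with eqv := ?_, equ := ?_, eqp := ?_ }
  · refine R.cvt.eq_of_eq_interior hab ((((CC.const (-ε)).mul R.cv4).add R.cu2).sub
      ((R.cp.comp hF.continuous_deriv).mul R.cp1)) fun x hx t ht => ?_
    refine (h.eq_v x hx t ht).trans (congrArg₂ (· - ·) rfl ?_)
    have h1 : (fun y => f (Θ y t)) =ᶠ[nhds x] fun y => F (Θ y t) := by
      filter_upwards [isOpen_Ioo.mem_nhds hx] with y hy
      exact (hFf _ (h.Θ_pos y (Ioo_subset_Icc_self hy) t (Ioi_subset_Ici_self ht)).le).symm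
    have h2 := (hF.deriv (Θ x t)).comp x (R.dp x (Ioo_subset_Icc_self hx) t (Ioi_subset_Ici_self ht))
    exact h1.deriv_eq.trans h2.deriv
  · exact R.cut.eq_of_eq_interior hab (((CC.const ε).mul R.cu2).add R.cv) h.eq_u
  · refine R.cpt.eq_of_eq_interior hab (R.cp2.sub ((R.cp.comp hF.continuous).mul R.cv1))
      fun x hx t ht => (h.eq_Θ x hx t ht).trans ?_
    rw [← hFf _ (h.Θ_pos x (Ioo_subset_Icc_self hx) t (Ioi_subset_Ici_self ht)).le]
    rfl

/-- Lebesgue measure on the closed rectangle `[a,b] × [0,T]`. -/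
def rectMeasure (a b T : ℝ) : Measure (ℝ × ℝ) :=
  (volume : Measure (ℝ × ℝ)).restrict (Icc a b ×ˢ Icc 0 T)

lemma rectMeasure_eq_prod (a b T : ℝ) : rectMeasure a b T =
    (volume.restrict (Icc a b)).prod (volume.restrict (Icc 0 T)) := by
  rw [Measure.prod_restrict]; rfl

instance isFiniteMeasure_rectMeasure (a b T : ℝ) : IsFiniteMeasure (rectMeasure a b T) := by
  rw [rectMeasure_eq_prod]; infer_instance

lemma rectMeasure_eq_open (a b T : ℝ) : rectMeasure a b T =
    (volume : Measure (ℝ × ℝ)).restrict (Ioo a b ×ˢ Ioo 0 T) := by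
  rw [rectMeasure_eq_prod, Measure.restrict_congr_set Ioo_ae_eq_Icc.symm,
    Measure.restrict_congr_set (Ioo_ae_eq_Icc (a := (0 : ℝ)) (b := T)).symm,
    Measure.prod_restrict]; rfl

lemma ae_rectMeasure {T : ℝ} {P : ℝ → ℝ → Prop}
    (h : ∀ x ∈ Icc a b, ∀ t ∈ Icc 0 T, P x t) : ∀ᵐ q ∂rectMeasure a b T, P q.1 q.2 :=
  (ae_restrict_iff' (measurableSet_Icc.prod measurableSet_Icc)).2
    (Eventually.of_forall fun q hq => h q.1 hq.1 q.2 hq.2)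

lemma integral_rect_congr {T : ℝ} {g r : ℝ → ℝ → ℝ}
    (h : ∀ x ∈ Icc a b, ∀ t ∈ Icc 0 T, g x t = r x t) :
    ∫ q, g q.1 q.2 ∂rectMeasure a b T = ∫ q, r q.1 q.2 ∂rectMeasure a b T :=
  integral_congr_ae (ae_rectMeasure (P := fun x t => g x t = r x t) h)

lemma CC.aestronglyMeasurable {w : ℝ → ℝ → ℝ} (h : CC a b w) (T : ℝ) :
    AEStronglyMeasurable (fun q : ℝ × ℝ => w q.1 q.2) (rectMeasure a b T) :=
  (ContinuousOn.mono h (prod_mono subset_rfl Icc_subset_Ici_self)).aestronglyMeasurable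
    (measurableSet_Icc.prod measurableSet_Icc)

lemma CC.memLp {w : ℝ → ℝ → ℝ} (h : CC a b w) (T : ℝ) :
    MemLp (fun q : ℝ × ℝ => w q.1 q.2) 2 (rectMeasure a b T) := by
  obtain ⟨B, _, hB⟩ := h.bdd T
  exact MemLp.of_bound (h.aestronglyMeasurable T) B
    (ae_rectMeasure (P := fun x t => ‖w x t‖ ≤ B) hB)

lemma CC.integrable {w : ℝ → ℝ → ℝ} (h : CC a b w) (T : ℝ) :
    Integrable (fun q : ℝ × ℝ => w q.1 q.2) (rectMeasure a b T) :=
  (h.memLp T).integrable one_le_two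

lemma integral_rect_eq_xt (hab : a ≤ b) {T : ℝ} (hT : 0 ≤ T) {g : ℝ → ℝ → ℝ}
    (hg : Integrable (fun q : ℝ × ℝ => g q.1 q.2) (rectMeasure a b T)) :
    ∫ q, g q.1 q.2 ∂rectMeasure a b T = ∫ x in a..b, ∫ t in (0 : ℝ)..T, g x t := by
  rw [rectMeasure_eq_prod] at hg ⊢
  rw [integral_prod _ hg, intervalIntegral.integral_of_le hab, integral_Icc_eq_integral_Ioc]
  simp only [intervalIntegral.integral_of_le hT, integral_Icc_eq_integral_Ioc]

lemma integral_rect_eq_tx (hab : a ≤ b) {T : ℝ} (hT : 0 ≤ T) {g : ℝ → ℝ → ℝ}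
    (hg : Integrable (fun q : ℝ × ℝ => g q.1 q.2) (rectMeasure a b T)) :
    ∫ q, g q.1 q.2 ∂rectMeasure a b T = ∫ t in (0 : ℝ)..T, ∫ x in a..b, g x t := by
  rw [rectMeasure_eq_prod] at hg ⊢
  rw [integral_prod_symm _ hg, intervalIntegral.integral_of_le hT, integral_Icc_eq_integral_Ioc]
  simp only [intervalIntegral.integral_of_le hab, integral_Icc_eq_integral_Ioc]

lemma integral_rect_sq_le (hab : a ≤ b) {T : ℝ} (hT : 0 ≤ T) {w : ℝ → ℝ → ℝ} (h : CC a b w) {K : ℝ}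
    (hK : ∀ t ∈ Icc 0 T, ∫ x in a..b, w x t ^ 2 ≤ K) :
    ∫ q, w q.1 q.2 ^ 2 ∂rectMeasure a b T ≤ T * K := by
  rw [integral_rect_eq_tx hab hT (g := fun x t => w x t ^ 2) (h.sq.integrable T)]
  have := intervalIntegral.integral_mono_on hT (g := fun _ => K)
    (ContinuousOn.ii hT ((h.sq.integral_x hab).mono Icc_subset_Ici_self)) (by simp) hK
  simpa using this

/-- Integration by parts in time. -/
lemma integral_rect_parts_t (hab : a ≤ b) {T : ℝ} (hT : 0 ≤ T) {y yt z zt : ℝ → ℝ → ℝ}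
    (hy : DT a b y yt) (hz : DT a b z zt) (cy : CC a b y) (cyt : CC a b yt) (cz : CC a b z)
    (czt : CC a b zt) :
    ∫ q, yt q.1 q.2 * z q.1 q.2 ∂rectMeasure a b T = (∫ x in a..b, y x T * z x T)
      - (∫ x in a..b, y x 0 * z x 0) - ∫ q, y q.1 q.2 * zt q.1 q.2 ∂rectMeasure a b T := by
  have h1 := integral_add ((cyt.mul cz).integrable T) ((cy.mul czt).integrable T)
  have h2 := integral_rect_eq_xt hab hT
    (g := fun x t => yt x t * z x t + y x t * zt x t) (((cyt.mul cz).add (cy.mul czt)).integrable T)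
  have h3 : ∀ x ∈ Icc a b, ∫ t in (0 : ℝ)..T, (yt x t * z x t + y x t * zt x t)
      = y x T * z x T - y x 0 * z x 0 := by
    intro x hx
    refine intervalIntegral.integral_eq_sub_of_hasDerivAt (f := fun t => y x t * z x t)
      (fun t ht => ?_)
      (ContinuousOn.ii hT ((((cyt.mul cz).add (cy.mul czt)).slice_t hx).mono Icc_subset_Ici_self))
    rw [uIcc_of_le hT] at ht
    exact (hy x hx t ht.1).mul (hz x hx t ht.1)
  rw [Tri.integral_congr_Icc hab h3, intervalIntegral.integral_sub
    (ContinuousOn.ii hab ((cy.mul cz).slice hT)) (ContinuousOn.ii hab ((cy.mul cz).slice le_rfl))]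
    at h2
  linarith

/-- Integration by parts in space. -/
lemma integral_rect_parts_x (hab : a ≤ b) {T : ℝ} (hT : 0 ≤ T) {y y1 z z1 : ℝ → ℝ → ℝ}
    (hy : DX a b y y1) (hz : DX a b z z1) (cy : CC a b y) (cy1 : CC a b y1) (cz : CC a b z)
    (cz1 : CC a b z1) (ha : ∀ t, 0 ≤ t → y a t * z a t = 0)
    (hb : ∀ t, 0 ≤ t → y b t * z b t = 0) :
    ∫ q, y1 q.1 q.2 * z q.1 q.2 ∂rectMeasure a b T
      = - ∫ q, y q.1 q.2 * z1 q.1 q.2 ∂rectMeasure a b T := by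
  have h1 := integral_add ((cy1.mul cz).integrable T) ((cy.mul cz1).integrable T)
  have h2 := integral_rect_eq_tx hab hT
    (g := fun x t => y1 x t * z x t + y x t * z1 x t) (((cy1.mul cz).add (cy.mul cz1)).integrable T)
  have h3 : ∀ t ∈ Icc 0 T, ∫ x in a..b, (y1 x t * z x t + y x t * z1 x t) = 0 := by
    intro t ht
    rw [intervalIntegral.integral_eq_sub_of_hasDerivAt (f := fun x => y x t * z x t)
      (fun x hx => ?_) (ContinuousOn.ii hab (((cy1.mul cz).add (cy.mul cz1)).slice ht.1)),
      ha t ht.1, hb t ht.1, sub_zero]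
    rw [uIcc_of_le hab] at hx
    exact (hy x hx t ht.1).mul (hz x hx t ht.1)
  rw [Tri.integral_congr_Icc hT h3, intervalIntegral.integral_zero] at h2
  linarith

lemma contDiff_pdx {φ : ℝ → ℝ → ℝ} (h : ContDiff ℝ (⊤ : ℕ∞) (uncurry φ)) :
    ContDiff ℝ (⊤ : ℕ∞) (uncurry (pdx φ)) ∧
      ∀ x t, HasDerivAt (fun y => φ y t) (pdx φ x t) x := by
  have h0 : ∀ q : ℝ × ℝ, HasFDerivAt (uncurry φ) (fderiv ℝ (uncurry φ) q) q := fun q =>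
    ((h.differentiable (by simp)) q).hasFDerivAt
  have h1 : ∀ x t, HasDerivAt (fun y => φ y t) (fderiv ℝ (uncurry φ) (x, t) (1, 0)) x :=
    fun x t => (h0 (x, t)).comp_hasDerivAt (f := fun y => (y, t)) x ((hasDerivAt_id x).prodMk (hasDerivAt_const x t))
  have h2 : uncurry (pdx φ) = fun q => fderiv ℝ (uncurry φ) q (1, 0) := by
    ext ⟨x, t⟩; exact (h1 x t).deriv
  refine ⟨?_, fun x t => ((h1 x t).differentiableAt).hasDerivAt⟩
  rw [h2]
  exact (h.fderiv_right (m := (⊤ : ℕ∞)) (by simp)).clm_apply contDiff_const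

lemma contDiff_pdt {φ : ℝ → ℝ → ℝ} (h : ContDiff ℝ (⊤ : ℕ∞) (uncurry φ)) :
    ContDiff ℝ (⊤ : ℕ∞) (uncurry (pdt φ)) ∧
      ∀ x t, HasDerivAt (fun s => φ x s) (pdt φ x t) t := by
  have h0 : ∀ q : ℝ × ℝ, HasFDerivAt (uncurry φ) (fderiv ℝ (uncurry φ) q) q := fun q =>
    ((h.differentiable (by simp)) q).hasFDerivAt
  have h1 : ∀ x t, HasDerivAt (fun s => φ x s) (fderiv ℝ (uncurry φ) (x, t) (0, 1)) t :=
    fun x t => (h0 (x, t)).comp_hasDerivAt (f := fun s => (x, s)) t ((hasDerivAt_const t x).prodMk (hasDerivAt_id t))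
  have h2 : uncurry (pdt φ) = fun q => fderiv ℝ (uncurry φ) q (0, 1) := by
    ext ⟨x, t⟩; exact (h1 x t).deriv
  refine ⟨?_, fun x t => ((h1 x t).differentiableAt).hasDerivAt⟩
  rw [h2]
  exact (h.fderiv_right (m := (⊤ : ℕ∞)) (by simp)).clm_apply contDiff_const

lemma integral_sub_sq_le_time (hab : a ≤ b) {T : ℝ} (hT : 0 ≤ T) {w wt : ℝ → ℝ → ℝ}
    (hw : DT a b w wt) (cw : CC a b w) (ct : CC a b wt) {L : ℝ}
    (hL : ∫ q, wt q.1 q.2 ^ 2 ∂rectMeasure a b T ≤ L) {s t : ℝ} (hs : s ∈ Icc 0 T)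
    (ht : t ∈ Icc 0 T) : ∫ x in a..b, (w x t - w x s) ^ 2 ≤ L * |t - s| := by
  have h_int := ct.sq.integrable T
  rw [integral_rect_eq_xt hab hT (g := fun x t => wt x t ^ 2) h_int] at hL
  have hi : IntervalIntegrable (fun x => ∫ t in (0 : ℝ)..T, wt x t ^ 2) volume a b := by
    rw [rectMeasure_eq_prod] at h_int
    have := h_int.integral_prod_left
    rw [intervalIntegrable_iff_integrableOn_Icc_of_le hab]
    unfold IntegrableOn
    simpa only [intervalIntegral.integral_of_le hT, integral_Icc_eq_integral_Ioc] using this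
  have h1 : ∀ x ∈ Icc a b, (w x t - w x s) ^ 2 ≤ |t - s| * ∫ t in (0 : ℝ)..T, wt x t ^ 2 := by
    intro x hx
    have h2 := abs_sub_le_sqrt_mul (p := fun t => w x t) (p' := fun t => wt x t)
      (fun r hr => hw x hx r hr.1) ((ct.slice_t hx).mono Icc_subset_Ici_self) hs ht
    have h3 := pow_le_pow_left₀ (abs_nonneg _) h2 2
    rwa [sq_abs, mul_pow, Real.sq_sqrt (abs_nonneg _), Real.sq_sqrt (ii_sq_nonneg hT _)] at h3
  have h4 := intervalIntegral.integral_mono_on hab (f := fun x => (w x t - w x s) ^ 2)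
    (ContinuousOn.ii hab (((cw.slice ht.1).sub (cw.slice hs.1)).pow 2)) (hi.const_mul |t - s|) h1
  rw [intervalIntegral.integral_const_mul] at h4
  refine h4.trans ?_
  rw [mul_comm]
  exact mul_le_mul_of_nonneg_right hL (abs_nonneg _)

lemma exists_modulus (hab : a < b) {T K L : ℝ} (hT : 0 ≤ T) (hL0 : 0 ≤ L) :
    ∃ D, 0 ≤ D ∧ ∀ w w1 wt : ℝ → ℝ → ℝ, DX a b w w1 → DT a b w wt → CC a b w → CC a b w1 →
      CC a b wt → (∀ t ∈ Icc 0 T, ∫ x in a..b, w1 x t ^ 2 ≤ K) →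
      ∫ q, wt q.1 q.2 ^ 2 ∂rectMeasure a b T ≤ L → ∀ x ∈ Icc a b, ∀ y ∈ Icc a b,
      ∀ t ∈ Icc 0 T, ∀ s ∈ Icc 0 T, |w x t - w y s| ≤ D * (√|x - y| + √(√|t - s|)) := by
  set E := (b - a)⁻¹ * (L * √T) + 2 * (√L * √(4 * K)) with hE
  have hba : 0 < b - a := sub_pos.2 hab
  have hE0 : 0 ≤ E := by positivity
  refine ⟨√K + √E, by positivity, ?_⟩
  intro w w1 wt dw tw cw cw1 cwt hK hL x hx y hy t ht s hs
  have hx' : |w x t - w y t| ≤ √|x - y| * √K :=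
    (abs_sub_le_sqrt_mul (fun z hz => dw z hz t ht.1) (cw1.slice ht.1) hy hx).trans
      (mul_le_mul_of_nonneg_left (Real.sqrt_le_sqrt (hK t ht)) (Real.sqrt_nonneg _))
  have g0 := integral_sub_sq_le_time hab.le hT tw cw cwt hL hs ht
  have cgt := cw1.slice ht.1
  have cgs := cw1.slice hs.1
  have g1 : ∫ z in a..b, (w1 z t - w1 z s) ^ 2 ≤ 4 * K := by
    have := intervalIntegral.integral_mono_on hab.le (f := fun z => (w1 z t - w1 z s) ^ 2)
      (g := fun z => 2 * w1 z t ^ 2 + 2 * w1 z s ^ 2)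
      (ContinuousOn.ii hab.le ((cgt.sub cgs).pow 2))
      (ContinuousOn.ii hab.le (by fun_prop))
      (fun z _ => show (w1 z t - w1 z s) ^ 2 ≤ 2 * w1 z t ^ 2 + 2 * w1 z s ^ 2 by
        nlinarith [sq_nonneg (w1 z t + w1 z s)])
    rw [intervalIntegral.integral_add (ContinuousOn.ii hab.le (by fun_prop))
      (ContinuousOn.ii hab.le (by fun_prop)), intervalIntegral.integral_const_mul,
      intervalIntegral.integral_const_mul] at this
    linarith [hK t ht, hK s hs]
  have ag := sq_le_agmon hab (p := fun z => w z t - w z s) (p' := fun z => w1 z t - w1 z s)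
    (fun z hz => (dw z hz t ht.1).sub (dw z hz s hs.1)) (cgt.sub cgs) hy
  have hδ : |t - s| ≤ √T * √|t - s| := by
    have : |t - s| ≤ T := by rw [abs_le]; constructor <;> linarith [ht.1, ht.2, hs.1, hs.2]
    calc |t - s| = √|t - s| * √|t - s| := (Real.mul_self_sqrt (abs_nonneg _)).symm
      _ ≤ √T * √|t - s| := by gcongr
  have e1 : √(∫ z in a..b, (w z t - w z s) ^ 2) ≤ √L * √|t - s| := by
    rw [← Real.sqrt_mul hL0]
    exact Real.sqrt_le_sqrt g0
  have hsq : (w y t - w y s) ^ 2 ≤ E * √|t - s| := by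
    refine ag.trans ?_
    have i1 : (b - a)⁻¹ * ∫ z in a..b, (w z t - w z s) ^ 2
        ≤ (b - a)⁻¹ * (L * (√T * √|t - s|)) := by
      gcongr
      exact g0.trans (by gcongr)
    have i2 : √(∫ z in a..b, (w z t - w z s) ^ 2) * √(∫ z in a..b, (w1 z t - w1 z s) ^ 2)
        ≤ (√L * √|t - s|) * √(4 * K) := by
      gcongr
    calc _ ≤ (b - a)⁻¹ * (L * (√T * √|t - s|)) + 2 * ((√L * √|t - s|) * √(4 * K)) := by linarith
      _ = E * √|t - s| := by rw [hE]; ring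
  have ht' : |w y t - w y s| ≤ √E * √(√|t - s|) := by
    rw [← Real.sqrt_mul hE0]
    exact Real.abs_le_sqrt hsq
  have n1 : 0 ≤ √E * √|x - y| := by positivity
  have n2 : 0 ≤ √K * √(√|t - s|) := by positivity
  calc |w x t - w y s| ≤ |w x t - w y t| + |w y t - w y s| := abs_sub_le _ _ _
    _ ≤ √|x - y| * √K + √E * √(√|t - s|) := add_le_add hx' ht'
    _ ≤ _ := by linarith

lemma Equicontinuous.exists_subseq_tendsto {Z : Type*} [TopologicalSpace Z]
    [TopologicalSpace.SeparableSpace Z] {G : ℕ → Z → ℝ} (hG : Equicontinuous G)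
    (hb : ∀ z, ∃ B, ∀ n, |G n z| ≤ B) :
    ∃ (φ : ℕ → ℕ) (g : Z → ℝ), StrictMono φ ∧ Continuous g ∧
      ∀ z, Tendsto (fun n => G (φ n) z) atTop (nhds (g z)) := by
  choose B hB using hb
  obtain ⟨D, hDc, hD⟩ := TopologicalSpace.exists_countable_dense Z
  have : Countable D := hDc.to_subtype
  have hK : IsCompact (Set.pi univ fun d : D => Icc (-B d) (B d)) :=
    isCompact_univ_pi fun _ => isCompact_Icc
  obtain ⟨l, _, φ, hφ, hl⟩ := hK.tendsto_subseq (x := fun n (d : D) => G n d)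
    fun n d _ => abs_le.1 (hB d n)
  rw [tendsto_pi_nhds] at hl
  have hlim : ∀ z, ∃ c, Tendsto (fun n => G (φ n) z) atTop (nhds c) := by
    intro z
    refine cauchySeq_tendsto_of_complete (Metric.cauchySeq_iff'.2 fun ε hε => ?_)
    obtain ⟨d, hd, hdD⟩ := mem_closure_iff_nhds.1 (hD z) _
      (Metric.equicontinuousAt_iff_right.1 (hG z) (ε / 4) (by positivity))
    obtain ⟨N, hN⟩ := Metric.cauchySeq_iff'.1 (hl ⟨d, hdD⟩).cauchySeq (ε / 4) (by positivity)
    refine ⟨N, fun n hn => ?_⟩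
    have h1 := hd (φ n)
    have h2 := hd (φ N)
    have h3 := hN n hn
    simp only [Real.dist_eq, Function.comp] at h1 h2 h3 ⊢
    rw [abs_lt] at *
    constructor <;> linarith [h1.1, h1.2, h2.1, h2.2, h3.1, h3.2]
  choose g hg using hlim
  refine ⟨φ, g, hφ, ?_, hg⟩
  have hG₁ : Equicontinuous fun n => G (φ n) := hG.comp φ
  exact Filter.Tendsto.continuous_of_equicontinuous (tendsto_pi_nhds.2 hg) hG₁

/-- A compactness criterion on the half-infinite strip. -/
lemma CC.exists_subseq_tendsto {w : ℕ → ℝ → ℝ → ℝ}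
    (hb : ∀ T, 0 ≤ T → ∃ B, ∀ n, ∀ x ∈ Icc a b, ∀ t ∈ Icc 0 T, |w n x t| ≤ B)
    (hm : ∀ T, 0 ≤ T → ∃ D, ∀ n, ∀ x ∈ Icc a b, ∀ y ∈ Icc a b, ∀ t ∈ Icc 0 T, ∀ s ∈ Icc 0 T,
      |w n x t - w n y s| ≤ D * (√|x - y| + √(√|t - s|))) :
    ∃ (φ : ℕ → ℕ) (W : ℝ → ℝ → ℝ), StrictMono φ ∧ CC a b W ∧
      ∀ x ∈ Icc a b, ∀ t, 0 ≤ t → Tendsto (fun n => w (φ n) x t) atTop (nhds (W x t)) := by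
  classical
  set S : Set (ℝ × ℝ) := Icc a b ×ˢ Ici (0 : ℝ) with hS
  have heq : Equicontinuous fun (n : ℕ) (z : S) => w n z.1.1 z.1.2 := by
    intro z
    obtain ⟨D, hD⟩ := hm (z.1.2 + 1) (add_nonneg z.2.2 zero_le_one)
    refine Metric.equicontinuousAt_of_continuity_modulus
      (fun y : S => D * (√|z.1.1 - y.1.1| + √(√|z.1.2 - y.1.2|))) ?_ _ ?_
    · have : Continuous fun y : S => D * (√|z.1.1 - y.1.1| + √(√|z.1.2 - y.1.2|)) := by fun_prop
      simpa using this.tendsto z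
    · have h1 : ∀ᶠ y : S in nhds z, y.1.2 < z.1.2 + 1 :=
        (continuous_snd.comp continuous_subtype_val).continuousAt.eventually_lt_const
          (lt_add_one _)
      filter_upwards [h1] with y hy n
      exact hD n _ z.2.1 _ y.2.1 _ ⟨z.2.2, by linarith⟩ _ ⟨y.2.2, hy.le⟩
  obtain ⟨φ, g, hφ, cg, hg⟩ := heq.exists_subseq_tendsto fun z => by
    obtain ⟨B, hB⟩ := hb z.1.2 z.2.2
    exact ⟨B, fun n => hB n _ z.2.1 _ ⟨z.2.2, le_rfl⟩⟩
  refine ⟨φ, fun x t => if h : (x, t) ∈ S then g ⟨(x, t), h⟩ else 0, hφ, ?_, fun x hx t ht => ?_⟩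
  · refine continuousOn_iff_continuous_domRestrict.2 (cg.congr fun z => ?_)
    simp only [Set.domRestrict_apply, uncurry]
    rw [dif_pos z.2]
  · have hz : (x, t) ∈ S := ⟨hx, ht⟩
    simpa only [dif_pos hz] using hg ⟨(x, t), hz⟩

/-- Bounded sequences in a separable Hilbert space have weakly convergent subsequences. -/
lemma exists_subseq_tendsto_weak {H : Type*} [NormedAddCommGroup H] [InnerProductSpace ℝ H]
    [CompleteSpace H] [TopologicalSpace.SeparableSpace H] {g : ℕ → H} {C : ℝ}
    (hg : ∀ n, ‖g n‖ ≤ C) : ∃ (φ : ℕ → ℕ) (G : H), StrictMono φ ∧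
      ∀ l : H →L[ℝ] ℝ, Tendsto (fun n => l (g (φ n))) atTop (nhds (l G)) := by
  set D := InnerProductSpace.toDual ℝ H with hD
  obtain ⟨y, _, φ, hφ, hy⟩ := WeakDual.isSeqCompact_closedBall ℝ H 0 C
    (x := fun n => StrongDual.toWeakDual (D (g n))) (fun n => by simpa using hg n)
  refine ⟨φ, D.symm (WeakDual.toStrongDual y), hφ, fun l => ?_⟩
  have h1 := ((WeakDual.eval_continuous (D.symm l)).tendsto y).comp hy
  have h2 : ∀ z, l z = D z (D.symm l) := by
    intro z
    rw [hD, InnerProductSpace.toDual_apply_apply, real_inner_comm, ← InnerProductSpace.toDual_apply_apply,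
      LinearIsometryEquiv.apply_symm_apply]
  simp only [h2, LinearIsometryEquiv.apply_symm_apply]
  exact h1

/-- Weak convergence in `L²` on every rectangle `[a,b] × [0,T]`. -/
structure Wk (a b : ℝ) (w : ℕ → ℝ → ℝ → ℝ) (W : ℝ → ℝ → ℝ) : Prop where
  memLp : ∀ T, MemLp (fun q : ℝ × ℝ => W q.1 q.2) 2 (rectMeasure a b T)
  tendsto : ∀ T (ψ : ℝ × ℝ → ℝ), MemLp ψ 2 (rectMeasure a b T) →
    Tendsto (fun n => ∫ q, w n q.1 q.2 * ψ q ∂rectMeasure a b T) atTop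
      (nhds (∫ q, W q.1 q.2 * ψ q ∂rectMeasure a b T))

lemma Wk.subseq {w : ℕ → ℝ → ℝ → ℝ} {W : ℝ → ℝ → ℝ} (h : Wk a b w W) {φ : ℕ → ℕ}
    (hφ : StrictMono φ) : Wk a b (fun n => w (φ n)) W :=
  ⟨h.memLp, fun T ψ hψ => (h.tendsto T ψ hψ).comp hφ.tendsto_atTop⟩

lemma rectMeasure_mono {S T : ℝ} (h : S ≤ T) : rectMeasure a b S ≤ rectMeasure a b T :=
  Measure.restrict_mono (prod_mono subset_rfl (Icc_subset_Icc_right h)) le_rfl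

lemma lintegral_enorm_sq {α : Type*} [MeasurableSpace α] {μ : Measure α} {f : α → ℝ}
    (hf : MemLp f 2 μ) : ∫⁻ x, ‖f x‖ₑ ^ (2 : ℝ) ∂μ = ENNReal.ofReal (∫ x, f x ^ 2 ∂μ) := by
  rw [ofReal_integral_eq_lintegral_ofReal hf.integrable_sq (ae_of_all _ fun x => sq_nonneg _)]
  refine lintegral_congr fun x => ?_
  rw [← sq_abs, ENNReal.ofReal_pow (abs_nonneg _), Real.enorm_eq_ofReal_abs]
  norm_cast

lemma exists_subseq_wk {w : ℕ → ℝ → ℝ → ℝ} (hw : ∀ n, CC a b (w n))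
    (hb : ∀ T, 0 ≤ T → ∃ K, ∀ n, ∫ q, w n q.1 q.2 ^ 2 ∂rectMeasure a b T ≤ K) :
    ∃ (φ : ℕ → ℕ) (W : ℝ → ℝ → ℝ), StrictMono φ ∧ Wk a b (fun n => w (φ n)) W := by
  choose! κ hκ using hb
  set c : ℕ → ENNReal := fun k => 2⁻¹ ^ (k + 1) / (ENNReal.ofReal (κ k) + 1) with hc
  have c0 : ∀ k, c k ≠ 0 := fun k => by simp [hc]
  have ctop : ∀ k, c k ≠ ⊤ := fun k =>
    ENNReal.div_ne_top (by simp) (by simp)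
  set ν : Measure (ℝ × ℝ) := Measure.sum fun k : ℕ => c k • rectMeasure a b k with hν
  have hle : ∀ k : ℕ, rectMeasure a b k ≤ (c k)⁻¹ • ν := by
    intro k
    have h1 : c k • rectMeasure a b k ≤ ν := Measure.le_sum (fun k : ℕ => c k • rectMeasure a b k) k
    intro s
    have h2 := h1 s
    simp only [Measure.smul_apply, smul_eq_mul] at h2 ⊢
    rw [mul_comm, ← div_eq_mul_inv, ENNReal.le_div_iff_mul_le (Or.inl (c0 k)) (Or.inl (ctop k)), mul_comm]
    exact h2
  have hleT : ∀ T : ℝ, rectMeasure a b T ≤ (c ⌈T⌉₊)⁻¹ • ν := fun T =>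
    (rectMeasure_mono (Nat.le_ceil T)).trans (hle _)
  have hm : ∀ n, AEStronglyMeasurable (fun q : ℝ × ℝ => w n q.1 q.2) ν := fun n =>
    aestronglyMeasurable_sum_measure_iff.2 fun k =>
      ((hw n).aestronglyMeasurable k).mono_ac (Measure.AbsolutelyContinuous.rfl.smul_left _)
  have hI : ∀ n, ∫⁻ q, ‖w n q.1 q.2‖ₑ ^ (2 : ℝ) ∂ν ≤ 1 := by
    intro n
    rw [hν, lintegral_sum_measure]
    calc _ ≤ ∑' k : ℕ, (2⁻¹ : ENNReal) ^ (k + 1) := by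
          refine ENNReal.tsum_le_tsum fun k => ?_
          rw [lintegral_smul_measure, smul_eq_mul, lintegral_enorm_sq ((hw n).memLp k)]
          calc c k * _ ≤ c k * (ENNReal.ofReal (κ k) + 1) := by
                gcongr
                exact (ENNReal.ofReal_le_ofReal (hκ k k.cast_nonneg n)).trans le_self_add
            _ = 2⁻¹ ^ (k + 1) := ENNReal.div_mul_cancel (by simp) (by simp)
      _ = 1 := by
          rw [ENNReal.tsum_geometric_add_one]
          simp [ENNReal.inv_mul_cancel]
  have hL : ∀ n, eLpNorm (fun q : ℝ × ℝ => w n q.1 q.2) 2 ν ≤ 1 := by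
    intro n
    rw [eLpNorm_eq_lintegral_rpow_enorm_toReal (by norm_num) (by norm_num)]
    simpa using ENNReal.rpow_le_one (hI n) (by norm_num)
  have hM : ∀ n, MemLp (fun q : ℝ × ℝ => w n q.1 q.2) 2 ν := fun n =>
    ⟨hm n, (hL n).trans_lt ENNReal.one_lt_top⟩
  have : SFinite ν := inferInstanceAs
    (SFinite (Measure.sum fun k : ℕ => c k • rectMeasure a b k))
  have : Fact ((2 : ENNReal) ≠ ⊤) := ⟨by norm_num⟩
  obtain ⟨φ, G, hφ, hG⟩ := exists_subseq_tendsto_weak (g := fun n => (hM n).toLp) (C := 1)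
    fun n => by
      rw [Lp.norm_toLp]
      exact ENNReal.toReal_le_of_le_ofReal zero_le_one (by simpa using hL n)
  have hac : ∀ T, rectMeasure a b T ≪ ν := fun T =>
    (Measure.absolutelyContinuous_of_le (hleT T)).trans
      (Measure.AbsolutelyContinuous.rfl.smul_left _)
  have hmem : ∀ (T : ℝ) (g : Lp ℝ 2 ν), MemLp g 2 (rectMeasure a b T) := fun T g =>
    (Lp.memLp g).of_measure_le_smul (ENNReal.inv_ne_top.2 (c0 _)) (hleT T)
  refine ⟨φ, fun x t => G (x, t), hφ, fun T => hmem T G, fun T ψ hψ => ?_⟩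
  set C := √((c ⌈T⌉₊)⁻¹).toReal
  have hbd : ∀ g : Lp ℝ 2 ν, √(∫ q, g q ^ 2 ∂rectMeasure a b T) ≤ C * ‖g‖ := by
    intro g
    have h1 : ∫ q, g q ^ 2 ∂ν = ‖g‖ ^ 2 := by
      rw [← real_inner_self_eq_norm_sq, L2.inner_def]
      simp [sq]
    have h2 : ∫ q, g q ^ 2 ∂rectMeasure a b T ≤ ((c ⌈T⌉₊)⁻¹).toReal * ‖g‖ ^ 2 := by
      rw [← h1, ← smul_eq_mul, ← integral_smul_measure]
      exact integral_mono_measure (hleT T) (ae_of_all _ fun q => sq_nonneg _)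
        ((Lp.memLp g).integrable_sq.smul_measure (ENNReal.inv_ne_top.2 (c0 _)))
    refine (Real.sqrt_le_sqrt h2).trans_eq ?_
    rw [Real.sqrt_mul ENNReal.toReal_nonneg, Real.sqrt_sq (norm_nonneg _)]
  let l : Lp ℝ 2 ν →L[ℝ] ℝ := LinearMap.mkContinuous
    { toFun := fun g => ∫ q, g q * ψ q ∂rectMeasure a b T
      map_add' := fun g h => by
        rw [← integral_add (f := fun q => g q * ψ q) (g := fun q => h q * ψ q) ((hmem T g).integrable_mul hψ) ((hmem T h).integrable_mul hψ)]
        refine integral_congr_ae ?_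
        filter_upwards [(hac T).ae_eq (Lp.coeFn_add g h)] with q hq
        rw [hq, Pi.add_apply, add_mul]
      map_smul' := fun r g => by
        rw [RingHom.id_apply, smul_eq_mul, ← integral_const_mul]
        refine integral_congr_ae ?_
        filter_upwards [(hac T).ae_eq (Lp.coeFn_smul r g)] with q hq
        rw [hq, Pi.smul_apply, smul_eq_mul, mul_assoc] }
    (C * √(∫ q, ψ q ^ 2 ∂rectMeasure a b T)) fun g => by
      rw [Real.norm_eq_abs]
      refine (abs_integral_mul_le_sqrt (hmem T g) hψ).trans ?_
      calc _ ≤ (C * ‖g‖) * √(∫ q, ψ q ^ 2 ∂rectMeasure a b T) := by gcongr; exact hbd g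
        _ = _ := by ring
  refine (hG l).congr fun n => integral_congr_ae ?_
  filter_upwards [(hac T).ae_eq (hM (φ n)).coeFn_toLp] with q hq
  rw [hq]

namespace Tri

lemma Bounded.rect_vis (hab : a ≤ b) {T K ε : ℝ} (hT : 0 ≤ T) (hε : 0 ≤ ε) {X : Tri}
    (h : Bounded a b T K ε X) (c2 : CC a b X.v2) (d2 : CC a b X.u2) :
    ε * ∫ q, X.v2 q.1 q.2 ^ 2 ∂rectMeasure a b T ≤ K ∧
      ε * ∫ q, X.u2 q.1 q.2 ^ 2 ∂rectMeasure a b T ≤ K := by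
  have h1 := h.vis
  rw [intervalIntegral.integral_add
    (ContinuousOn.ii hT ((c2.sq.integral_x hab).mono Icc_subset_Ici_self))
    (ContinuousOn.ii hT ((d2.sq.integral_x hab).mono Icc_subset_Ici_self)),
    ← integral_rect_eq_tx hab hT (g := fun x t => X.v2 x t ^ 2) (c2.sq.integrable T),
    ← integral_rect_eq_tx hab hT (g := fun x t => X.u2 x t ^ 2) (d2.sq.integrable T),
    mul_add] at h1
  have p1 : 0 ≤ ε * ∫ q, X.v2 q.1 q.2 ^ 2 ∂rectMeasure a b T :=
    mul_nonneg hε (integral_nonneg fun q => sq_nonneg _)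
  have p2 : 0 ≤ ε * ∫ q, X.u2 q.1 q.2 ^ 2 ∂rectMeasure a b T :=
    mul_nonneg hε (integral_nonneg fun q => sq_nonneg _)
  constructor <;> linarith

lemma Sol.rect_ut (hab : a ≤ b) {T K ε : ℝ} (hT : 0 ≤ T) (hε : ε ∈ Ioo (0 : ℝ) 1) {X : Tri}
    {F F' : ℝ → ℝ} (hX : Sol a b ε F F' X) (h : Bounded a b T K ε X) :
    ∫ q, X.ut q.1 q.2 ^ 2 ∂rectMeasure a b T ≤ 2 * K + 2 * (T * K) := by
  have h1 := (h.rect_vis hab hT hε.1.le hX.cv2 hX.cu2).2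
  have h2 := integral_rect_sq_le hab hT hX.cv h.v
  have h3 : ∫ q, X.ut q.1 q.2 ^ 2 ∂rectMeasure a b T ≤
      ∫ q, (2 * (ε * X.u2 q.1 q.2 ^ 2) + 2 * X.v q.1 q.2 ^ 2) ∂rectMeasure a b T := by
    refine integral_mono_ae (hX.cut.sq.integrable T)
      ((((hX.cu2.sq.integrable T).const_mul ε).const_mul 2).add
        ((hX.cv.sq.integrable T).const_mul 2)) (ae_rectMeasure
          (P := fun x t => X.ut x t ^ 2 ≤ 2 * (ε * X.u2 x t ^ 2) + 2 * X.v x t ^ 2)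
          fun x hx t ht => ?_)
    rw [hX.equ x hx t ht.1]
    have : ε * (ε * X.u2 x t ^ 2) ≤ 1 * (ε * X.u2 x t ^ 2) :=
      mul_le_mul_of_nonneg_right hε.2.le (mul_nonneg hε.1.le (sq_nonneg _))
    nlinarith [sq_nonneg (ε * X.u2 x t - X.v x t)]
  rw [integral_add (((hX.cu2.sq.integrable T).const_mul ε).const_mul 2)
    ((hX.cv.sq.integrable T).const_mul 2), integral_const_mul, integral_const_mul,
    integral_const_mul] at h3
  linarith

lemma Bounded.abs_u_le (hab : a ≤ b) {T K ε : ℝ} {X : Tri} (hX : Reg a b X)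
    (h : Bounded a b T K ε X) {x t : ℝ} (hx : x ∈ Icc a b) (ht : t ∈ Icc 0 T) :
    |X.u x t| ≤ √(b - a) * √K := by
  have h1 := abs_sub_le_sqrt_mul (fun z hz => hX.du z hz t ht.1) (hX.cu1.slice ht.1)
    (left_mem_Icc.2 hab) hx
  rw [hX.bua t ht.1, sub_zero] at h1
  refine h1.trans (mul_le_mul (Real.sqrt_le_sqrt ?_) (Real.sqrt_le_sqrt (h.u1 t ht))
    (Real.sqrt_nonneg _) (Real.sqrt_nonneg _))
  rw [abs_of_nonneg (sub_nonneg.2 hx.1)]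
  linarith [hx.2]

lemma Bounded.abs_p_le (hab : a < b) {T K ε : ℝ} {X : Tri} (hX : Reg a b X)
    (h : Bounded a b T K ε X) {x t : ℝ} (hx : x ∈ Icc a b) (ht : t ∈ Icc 0 T) :
    |X.p x t| ≤ √((b - a)⁻¹ * K + 2 * (√K * √K)) := by
  have hba : 0 < b - a := sub_pos.2 hab
  have h1 := sq_le_agmon hab (fun z hz => hX.dp z hz t ht.1) (hX.cp1.slice ht.1) hx
  refine Real.abs_le_sqrt (h1.trans ?_)
  gcongr
  · exact h.p t ht
  · exact h.p t ht
  · exact h.p1 t ht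

/-- A family of solutions along vanishing regularization parameters. -/
structure Approx (a b : ℝ) (F F' : ℝ → ℝ) (v0 u0 Θ0 : ℝ → ℝ) (ε : ℕ → ℝ) (X : ℕ → Tri) :
    Prop where
  eps : ∀ n, ε n ∈ Ioo (0 : ℝ) 1
  lim : Tendsto ε atTop (nhds 0)
  sol : ∀ n, Sol a b (ε n) F F' (X n)
  pos : ∀ n, ∀ x ∈ Icc a b, ∀ t, 0 ≤ t → 0 ≤ (X n).p x t
  init : ∀ n, Init a b v0 u0 Θ0 (X n)
  bdd : ∀ T, 0 ≤ T → ∃ K, 0 ≤ K ∧ ∀ n, Bounded a b T K (ε n) (X n)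

/-- Limits of an approximating family. -/
structure Limit (a b : ℝ) (X : ℕ → Tri) (U Ux V Vt W Wx : ℝ → ℝ → ℝ) : Prop where
  cU : CC a b U
  cW : CC a b W
  u : ∀ x ∈ Icc a b, ∀ t, 0 ≤ t → Tendsto (fun n => (X n).u x t) atTop (nhds (U x t))
  p : ∀ x ∈ Icc a b, ∀ t, 0 ≤ t → Tendsto (fun n => (X n).p x t) atTop (nhds (W x t))
  u1 : Wk a b (fun n => (X n).u1) Ux
  v : Wk a b (fun n => (X n).v) V
  vt : Wk a b (fun n => (X n).vt) Vt
  p1 : Wk a b (fun n => (X n).p1) Wx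

variable {F F' v0 u0 Θ0 : ℝ → ℝ} {ε : ℕ → ℝ} {X : ℕ → Tri}

lemma Approx.subseq (h : Approx a b F F' v0 u0 Θ0 ε X) {φ : ℕ → ℕ} (hφ : StrictMono φ) :
    Approx a b F F' v0 u0 Θ0 (fun n => ε (φ n)) (fun n => X (φ n)) where
  eps n := h.eps _
  lim := h.lim.comp hφ.tendsto_atTop
  sol n := h.sol _
  pos n := h.pos _
  init n := h.init _
  bdd T hT := by
    obtain ⟨K, hK, hb⟩ := h.bdd T hT
    exact ⟨K, hK, fun n => hb _⟩

lemma Approx.exists_limit (hab : a < b) (h : Approx a b F F' v0 u0 Θ0 ε X) :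
    ∃ (φ : ℕ → ℕ) (U Ux V Vt W Wx : ℝ → ℝ → ℝ), StrictMono φ ∧
      Limit a b (fun n => X (φ n)) U Ux V Vt W Wx := by
  obtain ⟨φ₁, U, hφ₁, cU, hU⟩ := CC.exists_subseq_tendsto (a := a) (b := b)
    (w := fun n => (X n).u) (fun T hT => by
      obtain ⟨K, _, hb⟩ := h.bdd T hT
      exact ⟨_, fun n x hx t ht => (hb n).abs_u_le hab.le (h.sol n).toReg hx ht⟩) (fun T hT => by
      obtain ⟨K, hK, hb⟩ := h.bdd T hT
      obtain ⟨D, _, hD⟩ := exists_modulus hab (K := K) (L := 2 * K + 2 * (T * K)) hT (by positivity)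
      exact ⟨D, fun n => hD _ _ _ (h.sol n).du (h.sol n).tu (h.sol n).cu (h.sol n).cu1
        (h.sol n).cut (hb n).u1 ((h.sol n).rect_ut hab.le hT (h.eps n) (hb n))⟩)
  have h₁ := h.subseq hφ₁
  obtain ⟨φ₂, W, hφ₂, cW, hW⟩ := CC.exists_subseq_tendsto (a := a) (b := b)
    (w := fun n => (X (φ₁ n)).p) (fun T hT => by
      obtain ⟨K, _, hb⟩ := h₁.bdd T hT
      exact ⟨_, fun n x hx t ht => (hb n).abs_p_le hab (h₁.sol n).toReg hx ht⟩) (fun T hT => by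
      obtain ⟨K, hK, hb⟩ := h₁.bdd T hT
      obtain ⟨D, _, hD⟩ := exists_modulus hab (K := K) (L := T * K) hT (by positivity)
      exact ⟨D, fun n => hD _ _ _ (h₁.sol n).dp (h₁.sol n).tp (h₁.sol n).cp (h₁.sol n).cp1
        (h₁.sol n).cpt (hb n).p1 (integral_rect_sq_le hab.le hT (h₁.sol n).cpt (hb n).pt)⟩)
  have h₂ := h₁.subseq hφ₂
  obtain ⟨φ₃, Ux, hφ₃, hUx⟩ := exists_subseq_wk (fun n => (h₂.sol n).cu1) (fun T hT => by
    obtain ⟨K, _, hb⟩ := h₂.bdd T hT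
    exact ⟨_, fun n => integral_rect_sq_le hab.le hT (h₂.sol n).cu1 (hb n).u1⟩)
  have h₃ := h₂.subseq hφ₃
  obtain ⟨φ₄, V, hφ₄, hV⟩ := exists_subseq_wk (fun n => (h₃.sol n).cv) (fun T hT => by
    obtain ⟨K, _, hb⟩ := h₃.bdd T hT
    exact ⟨_, fun n => integral_rect_sq_le hab.le hT (h₃.sol n).cv (hb n).v⟩)
  have h₄ := h₃.subseq hφ₄
  obtain ⟨φ₅, Vt, hφ₅, hVt⟩ := exists_subseq_wk (fun n => (h₄.sol n).cvt) (fun T hT => by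
    obtain ⟨K, _, hb⟩ := h₄.bdd T hT
    exact ⟨_, fun n => integral_rect_sq_le hab.le hT (h₄.sol n).cvt (hb n).vt⟩)
  have h₅ := h₄.subseq hφ₅
  obtain ⟨φ₆, Wx, hφ₆, hWx⟩ := exists_subseq_wk (fun n => (h₅.sol n).cp1) (fun T hT => by
    obtain ⟨K, _, hb⟩ := h₅.bdd T hT
    exact ⟨_, fun n => integral_rect_sq_le hab.le hT (h₅.sol n).cp1 (hb n).p1⟩)
  have m5 := hφ₅.comp hφ₆
  have m4 := hφ₄.comp m5
  have m3 := hφ₃.comp m4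
  have m2 := hφ₂.comp m3
  refine ⟨_, U, Ux, V, Vt, W, Wx, hφ₁.comp m2, ?_⟩
  exact
    { cU := cU
      cW := cW
      u := fun x hx t ht => (hU x hx t ht).comp m2.tendsto_atTop
      p := fun x hx t ht => (hW x hx t ht).comp m3.tendsto_atTop
      u1 := hUx.subseq m4
      v := hV.subseq m5
      vt := hVt.subseq hφ₆
      p1 := hWx }

end Tri

lemma MeasureTheory.MemLp.mul_cc {T : ℝ} {s r : ℝ → ℝ → ℝ}
    (hs : MemLp (fun q : ℝ × ℝ => s q.1 q.2) 2 (rectMeasure a b T)) (hr : CC a b r) :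
    MemLp (fun q : ℝ × ℝ => s q.1 q.2 * r q.1 q.2) 2 (rectMeasure a b T) := by
  obtain ⟨B, hB0, hB⟩ := hr.bdd T
  refine hs.of_le_mul (c := B) (hs.1.mul (hr.aestronglyMeasurable T)) ?_
  filter_upwards [ae_rectMeasure (P := fun x t => |r x t| ≤ B) hB] with q hq
  rw [norm_mul, mul_comm]
  exact mul_le_mul_of_nonneg_right hq (norm_nonneg _)

lemma MeasureTheory.MemLp.integrable_fun_mul {α : Type*} [MeasurableSpace α] {μ : Measure α}
    {f g : α → ℝ} (hf : MemLp f 2 μ) (hg : MemLp g 2 μ) : Integrable (fun q => f q * g q) μ :=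
  hf.integrable_mul hg

lemma MeasureTheory.MemLp.fun_sub {α : Type*} [MeasurableSpace α] {μ : Measure α}
    {f g : α → ℝ} (hf : MemLp f 2 μ) (hg : MemLp g 2 μ) : MemLp (fun q => f q - g q) 2 μ :=
  hf.sub hg

/-- Strong convergence in `L²([a,b] × [0,T])`. -/
structure Sg (a b T : ℝ) (s : ℕ → ℝ → ℝ → ℝ) (S : ℝ → ℝ → ℝ) : Prop where
  memLp : ∀ n, MemLp (fun q : ℝ × ℝ => s n q.1 q.2) 2 (rectMeasure a b T)
  memLp_limit : MemLp (fun q : ℝ × ℝ => S q.1 q.2) 2 (rectMeasure a b T)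
  lim : Tendsto (fun n => ∫ q, (s n q.1 q.2 - S q.1 q.2) ^ 2 ∂rectMeasure a b T) atTop (nhds 0)

namespace Sg

lemma sqrt_lim {T : ℝ} {s : ℕ → ℝ → ℝ → ℝ} {S : ℝ → ℝ → ℝ} (h : Sg a b T s S) :
    Tendsto (fun n => √(∫ q, (s n q.1 q.2 - S q.1 q.2) ^ 2 ∂rectMeasure a b T)) atTop
      (nhds 0) := by
  simpa using h.lim.sqrt

lemma tendsto {T : ℝ} {s : ℕ → ℝ → ℝ → ℝ} {S : ℝ → ℝ → ℝ} (h : Sg a b T s S)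
    {ψ : ℝ × ℝ → ℝ} (hψ : MemLp ψ 2 (rectMeasure a b T)) :
    Tendsto (fun n => ∫ q, s n q.1 q.2 * ψ q ∂rectMeasure a b T) atTop
      (nhds (∫ q, S q.1 q.2 * ψ q ∂rectMeasure a b T)) := by
  rw [tendsto_iff_norm_sub_tendsto_zero]
  have h1 := h.sqrt_lim.mul_const √(∫ q, ψ q ^ 2 ∂rectMeasure a b T)
  rw [zero_mul] at h1
  refine squeeze_zero (fun _ => norm_nonneg _) (fun n => ?_) h1
  rw [← integral_sub ((h.memLp n).integrable_fun_mul hψ) (h.memLp_limit.integrable_fun_mul hψ)]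
  refine le_trans (le_of_eq ?_) (abs_integral_mul_le_sqrt ((h.memLp n).fun_sub h.memLp_limit) hψ)
  rw [Real.norm_eq_abs]
  congr 2
  ext q
  ring

lemma of_pointwise {T B : ℝ} {s : ℕ → ℝ → ℝ → ℝ} {S : ℝ → ℝ → ℝ} (hs : ∀ n, CC a b (s n))
    (hS : CC a b S) (hB : ∀ n, ∀ x ∈ Icc a b, ∀ t ∈ Icc 0 T, |s n x t| ≤ B)
    (hl : ∀ x ∈ Icc a b, ∀ t, 0 ≤ t → Tendsto (fun n => s n x t) atTop (nhds (S x t))) :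
    Sg a b T s S := by
  obtain ⟨B', _, hB'⟩ := hS.bdd T
  refine ⟨fun n => (hs n).memLp T, hS.memLp T, ?_⟩
  have := tendsto_integral_of_dominated_convergence (μ := rectMeasure a b T)
    (F := fun n q => (s n q.1 q.2 - S q.1 q.2) ^ 2) (f := fun _ => 0) (fun _ => (B + B') ^ 2)
    (fun n => ((hs n).sub hS).sq.aestronglyMeasurable T) (integrable_const _)
    (fun n => ae_rectMeasure (P := fun x t => ‖(s n x t - S x t) ^ 2‖ ≤ (B + B') ^ 2)
      fun x hx t ht => ?_)
    (ae_rectMeasure (P := fun x t => Tendsto (fun n => (s n x t - S x t) ^ 2) atTop (nhds 0))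
      fun x hx t ht => ?_)
  · simpa using this
  · rw [norm_pow, Real.norm_eq_abs]
    gcongr
    exact (abs_sub _ _).trans (add_le_add (hB n x hx t ht) (hB' x hx t ht))
  · simpa using ((hl x hx t ht.1).sub_const (S x t)).pow 2

lemma mul_bdd {T B : ℝ} {s r : ℕ → ℝ → ℝ → ℝ} {S R : ℝ → ℝ → ℝ} (h : Sg a b T s S)
    (hr : ∀ n, CC a b (r n)) (hR : CC a b R)
    (hB : ∀ n, ∀ x ∈ Icc a b, ∀ t ∈ Icc 0 T, |r n x t| ≤ B)
    (hl : ∀ x ∈ Icc a b, ∀ t, 0 ≤ t → Tendsto (fun n => r n x t) atTop (nhds (R x t))) :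
    Sg a b T (fun n x t => s n x t * r n x t) (fun x t => S x t * R x t) := by
  obtain ⟨B', _, hB'⟩ := hR.bdd T
  refine ⟨fun n => (h.memLp n).mul_cc (hr n), h.memLp_limit.mul_cc hR, ?_⟩
  have i2 : ∀ n, Integrable (fun q : ℝ × ℝ => (S q.1 q.2 * (r n q.1 q.2 - R q.1 q.2)) ^ 2)
      (rectMeasure a b T) := fun n => (h.memLp_limit.mul_cc ((hr n).sub hR)).integrable_sq
  have i3 : ∀ n, Integrable (fun q : ℝ × ℝ => (s n q.1 q.2 * r n q.1 q.2
      - S q.1 q.2 * R q.1 q.2) ^ 2) (rectMeasure a b T) := fun n =>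
    (((h.memLp n).mul_cc (hr n)).fun_sub (h.memLp_limit.mul_cc hR)).integrable_sq
  have h1 := tendsto_integral_of_dominated_convergence (μ := rectMeasure a b T)
    (F := fun n q => (S q.1 q.2 * (r n q.1 q.2 - R q.1 q.2)) ^ 2) (f := fun _ => 0)
    (fun q => (B + B') ^ 2 * S q.1 q.2 ^ 2)
    (fun n => (i2 n).aestronglyMeasurable)
    (h.memLp_limit.integrable_sq.const_mul _)
    (fun n => ae_rectMeasure (P := fun x t => ‖(S x t * (r n x t - R x t)) ^ 2‖
      ≤ (B + B') ^ 2 * S x t ^ 2) fun x hx t ht => ?_)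
    (ae_rectMeasure (P := fun x t =>
      Tendsto (fun n => (S x t * (r n x t - R x t)) ^ 2) atTop (nhds 0)) fun x hx t ht => ?_)
  · have h2 := (h.lim.const_mul (2 * B ^ 2)).add (h1.const_mul 2)
    simp only [integral_zero, mul_zero, add_zero] at h2
    refine squeeze_zero (fun _ => integral_nonneg fun _ => sq_nonneg _) (fun n => ?_) h2
    have i1 : Integrable (fun q : ℝ × ℝ => (s n q.1 q.2 - S q.1 q.2) ^ 2) (rectMeasure a b T) :=
      ((h.memLp n).fun_sub h.memLp_limit).integrable_sq
    rw [← integral_const_mul, ← integral_const_mul,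
      ← integral_add (i1.const_mul _) ((i2 n).const_mul _)]
    refine integral_mono_ae (i3 n)
      ((i1.const_mul _).add ((i2 n).const_mul _)) (ae_rectMeasure
        (P := fun x t => (s n x t * r n x t - S x t * R x t) ^ 2 ≤ 2 * B ^ 2 * (s n x t - S x t) ^ 2
          + 2 * (S x t * (r n x t - R x t)) ^ 2) fun x hx t ht => ?_)
    have h3 : r n x t ^ 2 ≤ B ^ 2 := sq_le_sq' (abs_le.1 (hB n x hx t ht)).1
      (abs_le.1 (hB n x hx t ht)).2
    have h4 := mul_le_mul_of_nonneg_right h3 (sq_nonneg (s n x t - S x t))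
    nlinarith [sq_nonneg (r n x t * (s n x t - S x t) - S x t * (r n x t - R x t))]
  · rw [norm_pow, norm_mul, Real.norm_eq_abs, Real.norm_eq_abs, mul_pow, sq_abs (S x t), mul_comm]
    gcongr
    exact (abs_sub _ _).trans (add_le_add (hB n x hx t ht) (hB' x hx t ht))
  · simpa using (((hl x hx t ht.1).sub_const (R x t)).const_mul (S x t)).pow 2

lemma mul_cc {T : ℝ} {s : ℕ → ℝ → ℝ → ℝ} {S R : ℝ → ℝ → ℝ} (h : Sg a b T s S) (hR : CC a b R) :
    Sg a b T (fun n x t => s n x t * R x t) (fun x t => S x t * R x t) := by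
  obtain ⟨B, _, hB⟩ := hR.bdd T
  exact h.mul_bdd (fun _ => hR) hR (fun _ => hB) fun _ _ _ _ => tendsto_const_nhds

end Sg

lemma Wk.mul_strong {w : ℕ → ℝ → ℝ → ℝ} {W : ℝ → ℝ → ℝ} (h : Wk a b w W) {T K : ℝ}
    (hw : ∀ n, CC a b (w n)) (hK : ∀ n, ∫ q, w n q.1 q.2 ^ 2 ∂rectMeasure a b T ≤ K)
    {s : ℕ → ℝ → ℝ → ℝ} {S : ℝ → ℝ → ℝ} (hs : Sg a b T s S) :
    Tendsto (fun n => ∫ q, w n q.1 q.2 * s n q.1 q.2 ∂rectMeasure a b T) atTop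
      (nhds (∫ q, W q.1 q.2 * S q.1 q.2 ∂rectMeasure a b T)) := by
  have h1 := h.tendsto T _ hs.memLp_limit
  have h2 : Tendsto (fun n => ∫ q, w n q.1 q.2 * (s n q.1 q.2 - S q.1 q.2) ∂rectMeasure a b T)
      atTop (nhds 0) := by
    have h3 := hs.sqrt_lim.const_mul √K
    rw [mul_zero] at h3
    refine squeeze_zero_norm (fun n => ?_) h3
    refine (abs_integral_mul_le_sqrt ((hw n).memLp T) ((hs.memLp n).fun_sub hs.memLp_limit)).trans ?_
    exact mul_le_mul_of_nonneg_right (Real.sqrt_le_sqrt (hK n)) (Real.sqrt_nonneg _)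
  have h4 := h1.add h2
  rw [add_zero] at h4
  refine h4.congr fun n => ?_
  rw [← integral_add (((hw n).memLp T).integrable_fun_mul hs.memLp_limit)
    (((hw n).memLp T).integrable_fun_mul ((hs.memLp n).fun_sub hs.memLp_limit))]
  refine integral_congr_ae (ae_of_all _ fun q => ?_)
  ring

lemma DT.affine_mul {w wt : ℝ → ℝ → ℝ} (h : DT a b w wt) (S : ℝ) :
    DT a b (fun x t => (S - t) * w x t) (fun x t => (S - t) * wt x t - w x t) := by
  intro x hx t ht
  refine (((hasDerivAt_id t).const_sub S).mul (h x hx t ht)).congr_deriv ?_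
  simp only [id]
  ring

lemma CC.time (g : ℝ → ℝ) (hg : Continuous g) : CC a b (fun _ t => g t) :=
  (show Continuous (uncurry fun _ t : ℝ => g t) from hg.comp continuous_snd).continuousOn

namespace Tri
variable {F F' v0 u0 Θ0 : ℝ → ℝ} {ε : ℕ → ℝ} {X : ℕ → Tri} {U Ux V Vt W Wx : ℝ → ℝ → ℝ}

lemma Approx.sg_vanishing (h : Approx a b F F' v0 u0 Θ0 ε X) {T K : ℝ} {w : ℕ → ℝ → ℝ → ℝ}
    (cw : ∀ n, CC a b (w n)) (hw : ∀ n, ε n * ∫ q, w n q.1 q.2 ^ 2 ∂rectMeasure a b T ≤ K) :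
    Sg a b T (fun n x t => ε n * w n x t) (fun _ _ => 0) := by
  refine ⟨fun n => ((CC.const (ε n)).mul (cw n)).memLp T, (CC.const 0).memLp T, ?_⟩
  have h1 := h.lim.mul_const K
  rw [zero_mul] at h1
  refine squeeze_zero (fun _ => integral_nonneg fun _ => sq_nonneg _) (fun n => ?_) h1
  have : ∫ q, (ε n * w n q.1 q.2 - 0) ^ 2 ∂rectMeasure a b T
      = ε n * (ε n * ∫ q, w n q.1 q.2 ^ 2 ∂rectMeasure a b T) := by
    rw [← mul_assoc, ← integral_const_mul]
    congr 1
    ext q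
    ring
  rw [this]
  exact mul_le_mul_of_nonneg_left (hw n) (h.eps n).1.le

variable (hab : a < b) (h : Approx a b F F' v0 u0 Θ0 ε X) (hL : Limit a b X U Ux V Vt W Wx)
  {T : ℝ} (hT : 0 ≤ T)
include hab h hT

lemma Approx.sg_u2 : Sg a b T (fun n x t => ε n * (X n).u2 x t) (fun _ _ => 0) := by
  obtain ⟨K, _, hb⟩ := h.bdd T hT
  exact h.sg_vanishing (fun n => (h.sol n).cu2)
    fun n => ((hb n).rect_vis hab.le hT (h.eps n).1.le (h.sol n).cv2 (h.sol n).cu2).2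

lemma Approx.sg_v2 : Sg a b T (fun n x t => ε n * (X n).v2 x t) (fun _ _ => 0) := by
  obtain ⟨K, _, hb⟩ := h.bdd T hT
  exact h.sg_vanishing (fun n => (h.sol n).cv2)
    fun n => ((hb n).rect_vis hab.le hT (h.eps n).1.le (h.sol n).cv2 (h.sol n).cu2).1

include hL

lemma Approx.sg_u : Sg a b T (fun n => (X n).u) U := by
  obtain ⟨K, _, hb⟩ := h.bdd T hT
  exact Sg.of_pointwise (fun n => (h.sol n).cu) hL.cU
    (fun n x hx t ht => (hb n).abs_u_le hab.le (h.sol n).toReg hx ht) hL.u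

lemma Approx.sg_p : Sg a b T (fun n => (X n).p) W := by
  obtain ⟨K, _, hb⟩ := h.bdd T hT
  exact Sg.of_pointwise (fun n => (h.sol n).cp) hL.cW
    (fun n x hx t ht => (hb n).abs_p_le hab (h.sol n).toReg hx ht) hL.p

lemma Approx.tendsto_v_mul {s : ℕ → ℝ → ℝ → ℝ} {S : ℝ → ℝ → ℝ} (hs : Sg a b T s S) :
    Tendsto (fun n => ∫ q, (X n).v q.1 q.2 * s n q.1 q.2 ∂rectMeasure a b T) atTop
      (nhds (∫ q, V q.1 q.2 * S q.1 q.2 ∂rectMeasure a b T)) := by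
  obtain ⟨K, _, hb⟩ := h.bdd T hT
  exact hL.v.mul_strong (fun n => (h.sol n).cv)
    (fun n => integral_rect_sq_le hab.le hT (h.sol n).cv (hb n).v) hs

lemma Approx.tendsto_vt_mul {s : ℕ → ℝ → ℝ → ℝ} {S : ℝ → ℝ → ℝ} (hs : Sg a b T s S) :
    Tendsto (fun n => ∫ q, (X n).vt q.1 q.2 * s n q.1 q.2 ∂rectMeasure a b T) atTop
      (nhds (∫ q, Vt q.1 q.2 * S q.1 q.2 ∂rectMeasure a b T)) := by
  obtain ⟨K, _, hb⟩ := h.bdd T hT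
  exact hL.vt.mul_strong (fun n => (h.sol n).cvt)
    (fun n => integral_rect_sq_le hab.le hT (h.sol n).cvt (hb n).vt) hs

lemma Approx.tendsto_p1_mul {s : ℕ → ℝ → ℝ → ℝ} {S : ℝ → ℝ → ℝ} (hs : Sg a b T s S) :
    Tendsto (fun n => ∫ q, (X n).p1 q.1 q.2 * s n q.1 q.2 ∂rectMeasure a b T) atTop
      (nhds (∫ q, Wx q.1 q.2 * S q.1 q.2 ∂rectMeasure a b T)) := by
  obtain ⟨K, _, hb⟩ := h.bdd T hT
  exact hL.p1.mul_strong (fun n => (h.sol n).cp1)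
    (fun n => integral_rect_sq_le hab.le hT (h.sol n).cp1 (hb n).p1) hs

omit hL in
lemma Approx.parts_affine (m n : ℕ) :
    ∫ q, (X m).v q.1 q.2 * ((X n).v q.1 q.2 * (T - q.2)) ∂rectMeasure a b T
      = - (T * ∫ x in a..b, v0 x * u0 x) + (∫ q, (X m).v q.1 q.2 * (X n).u q.1 q.2 ∂rectMeasure a b T)
        - (∫ q, (X m).vt q.1 q.2 * ((X n).u q.1 q.2 * (T - q.2)) ∂rectMeasure a b T)
        - ∫ q, (X m).v q.1 q.2 * (ε n * (X n).u2 q.1 q.2 * (T - q.2)) ∂rectMeasure a b T := by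
  have hτ : CC a b (fun _ t => T - t) := CC.time _ (by fun_prop)
  have hm := h.sol m
  have hn := h.sol n
  have h1 := integral_rect_parts_t hab.le hT hm.tv (hn.tu.affine_mul T) hm.cv hm.cvt
    (hτ.mul hn.cu) ((hτ.mul hn.cut).sub hn.cu)
  have e0 : ∫ x in a..b, (X m).v x 0 * ((T - 0) * (X n).u x 0) = T * ∫ x in a..b, v0 x * u0 x := by
    rw [← intervalIntegral.integral_const_mul]
    refine integral_congr_Icc hab.le fun x hx => ?_
    rw [(h.init m x hx).1, (h.init n x hx).2.1]
    ring
  have e1 : ∫ q, (X m).v q.1 q.2 * ((T - q.2) * (X n).ut q.1 q.2 - (X n).u q.1 q.2) ∂rectMeasure a b T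
      = (∫ q, (X m).v q.1 q.2 * ((X n).v q.1 q.2 * (T - q.2)) ∂rectMeasure a b T)
        + (∫ q, (X m).v q.1 q.2 * (ε n * (X n).u2 q.1 q.2 * (T - q.2)) ∂rectMeasure a b T)
        - ∫ q, (X m).v q.1 q.2 * (X n).u q.1 q.2 ∂rectMeasure a b T := by
    have i1 := (hm.cv.mul (hn.cv.mul hτ)).integrable T
    have i2 := (hm.cv.mul (((CC.const (ε n)).mul hn.cu2).mul hτ)).integrable T
    have i3 := (hm.cv.mul hn.cu).integrable T
    rw [← integral_add i1 i2, ← integral_sub (i1.fun_add i2) i3]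
    refine integral_rect_congr
      (g := fun x t => (X m).v x t * ((T - t) * (X n).ut x t - (X n).u x t))
      (r := fun x t => (X m).v x t * ((X n).v x t * (T - t))
        + (X m).v x t * (ε n * (X n).u2 x t * (T - t)) - (X m).v x t * (X n).u x t)
      fun x hx t ht => ?_
    rw [hn.equ x hx t ht.1]
    ring
  have e2 : ∫ q, (X m).vt q.1 q.2 * ((X n).u q.1 q.2 * (T - q.2)) ∂rectMeasure a b T
      = ∫ q, (X m).vt q.1 q.2 * ((T - q.2) * (X n).u q.1 q.2) ∂rectMeasure a b T := by
    congr 1; ext q; ring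
  rw [e2, h1, e0, e1]
  simp only [sub_self, zero_mul, mul_zero, intervalIntegral.integral_zero]
  ring

lemma Approx.tendsto_affine_sq :
    Tendsto (fun n => ∫ q, ((X n).v q.1 q.2 - V q.1 q.2) ^ 2 * (T - q.2) ∂rectMeasure a b T) atTop
      (nhds 0) := by
  have hτ : CC a b (fun _ t => T - t) := CC.time _ (by fun_prop)
  have su := h.sg_u hab hL hT
  have suτ := su.mul_cc hτ
  have s2τ := (h.sg_u2 hab hT).mul_cc hτ
  set L := - (T * ∫ x in a..b, v0 x * u0 x) + (∫ q, V q.1 q.2 * U q.1 q.2 ∂rectMeasure a b T)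
    - ∫ q, Vt q.1 q.2 * (U q.1 q.2 * (T - q.2)) ∂rectMeasure a b T with hLdef
  have hVτ : MemLp (fun q : ℝ × ℝ => V q.1 q.2 * (T - q.2)) 2 (rectMeasure a b T) :=
    (hL.v.memLp T).mul_cc hτ
  have A : Tendsto (fun n => ∫ q, (X n).v q.1 q.2 * ((X n).v q.1 q.2 * (T - q.2)) ∂rectMeasure a b T)
      atTop (nhds L) := by
    have h1 := (((h.tendsto_v_mul hab hL hT su).const_add (- (T * ∫ x in a..b, v0 x * u0 x))).sub
      (h.tendsto_vt_mul hab hL hT suτ)).sub (h.tendsto_v_mul hab hL hT s2τ)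
    simp only [zero_mul, mul_zero, integral_zero, sub_zero] at h1
    exact h1.congr fun n => (h.parts_affine hab hT n n).symm
  have B : ∀ m, ∫ q, (X m).v q.1 q.2 * (V q.1 q.2 * (T - q.2)) ∂rectMeasure a b T
      = - (T * ∫ x in a..b, v0 x * u0 x) + (∫ q, (X m).v q.1 q.2 * U q.1 q.2 ∂rectMeasure a b T)
        - ∫ q, (X m).vt q.1 q.2 * (U q.1 q.2 * (T - q.2)) ∂rectMeasure a b T := by
    intro m
    have h1 := hL.v.tendsto T _ (((h.sol m).cv.mul hτ).memLp T)
    have h2 := su.tendsto ((h.sol m).cv.memLp T)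
    have h3 := suτ.tendsto ((h.sol m).cvt.memLp T)
    have h4 := s2τ.tendsto ((h.sol m).cv.memLp T)
    have h5 := ((h2.const_add (- (T * ∫ x in a..b, v0 x * u0 x))).sub h3).sub h4
    simp only [zero_mul, integral_zero, sub_zero] at h5
    have h6 := tendsto_nhds_unique h1 (h5.congr fun n => ?_)
    · calc _ = ∫ q, V q.1 q.2 * ((X m).v q.1 q.2 * (T - q.2)) ∂rectMeasure a b T := by
            congr 1; ext q; ring
        _ = _ := h6
        _ = _ := by
          congr 2
          · congr 1; ext q; ring
          · ext q; ring
    · have h7 := h.parts_affine hab hT m n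
      have c1 : ∀ s : ℝ × ℝ → ℝ, ∫ q, s q * (X m).v q.1 q.2 ∂rectMeasure a b T
        = ∫ q, (X m).v q.1 q.2 * s q ∂rectMeasure a b T := fun s => by simp only [mul_comm]
      have c2 : ∀ s : ℝ × ℝ → ℝ, ∫ q, s q * (X m).vt q.1 q.2 ∂rectMeasure a b T
        = ∫ q, (X m).vt q.1 q.2 * s q ∂rectMeasure a b T := fun s => by simp only [mul_comm]
      rw [c1 fun q => (X n).u q.1 q.2, c2 fun q => (X n).u q.1 q.2 * (T - q.2),
        c1 fun q => ε n * (X n).u2 q.1 q.2 * (T - q.2), ← h7]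
      congr 1; ext q; ring
  have C := hL.v.tendsto T _ hVτ
  have D : ∫ q, V q.1 q.2 * (V q.1 q.2 * (T - q.2)) ∂rectMeasure a b T = L := by
    refine tendsto_nhds_unique C ?_
    have h1 := ((hL.v.tendsto T _ su.memLp_limit).const_add (- (T * ∫ x in a..b, v0 x * u0 x))).sub
      (hL.vt.tendsto T _ suτ.memLp_limit)
    exact h1.congr fun m => (B m).symm
  rw [D] at C
  have E := (A.sub (C.const_mul 2)).add_const L
  rw [show L - 2 * L + L = 0 by ring] at E
  refine E.congr fun n => ?_
  have cv := (h.sol n).cv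
  have i1 := (cv.mul (cv.mul hτ)).integrable T
  have i2 := (cv.memLp T).integrable_fun_mul hVτ
  have i3 := (hL.v.memLp T).integrable_fun_mul hVτ
  have i4 : Integrable (fun q : ℝ × ℝ => (X n).v q.1 q.2 * ((X n).v q.1 q.2 * (T - q.2))
      - 2 * ((X n).v q.1 q.2 * (V q.1 q.2 * (T - q.2)))) (rectMeasure a b T) :=
    i1.sub (i2.const_mul 2)
  rw [← D, ← integral_const_mul, ← integral_sub i1 (i2.const_mul 2), ← integral_add i4 i3]
  congr 1; ext q; ring

omit T hT in
lemma Approx.sg_v {T : ℝ} (hT : 0 ≤ T) : Sg a b T (fun n => (X n).v) V := by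
  refine ⟨fun n => (h.sol n).cv.memLp T, hL.v.memLp T, ?_⟩
  refine squeeze_zero (fun _ => integral_nonneg fun _ => sq_nonneg _) (fun n => ?_)
    (h.tendsto_affine_sq hab hL (T := T + 1) (by linarith))
  have hτ : CC a b (fun _ t => T + 1 - t) := CC.time _ (by fun_prop)
  have i1 : ∀ S, MemLp (fun q : ℝ × ℝ => (X n).v q.1 q.2 - V q.1 q.2) 2 (rectMeasure a b S) :=
    fun S => ((h.sol n).cv.memLp S).fun_sub (hL.v.memLp S)
  have i2 : ∀ S, Integrable (fun q : ℝ × ℝ => ((X n).v q.1 q.2 - V q.1 q.2) ^ 2 * (T + 1 - q.2))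
      (rectMeasure a b S) := fun S => by
    have := (i1 S).integrable_fun_mul ((MemLp.mul_cc (s := fun x t => (X n).v x t - V x t) (i1 S)) hτ)
    refine this.congr (ae_of_all _ fun q => ?_)
    simp only
    ring
  calc _ ≤ ∫ q, ((X n).v q.1 q.2 - V q.1 q.2) ^ 2 * (T + 1 - q.2) ∂rectMeasure a b T := by
        refine integral_mono_ae (i1 T).integrable_sq (i2 T) (ae_rectMeasure
          (P := fun x t => ((X n).v x t - V x t) ^ 2 ≤ ((X n).v x t - V x t) ^ 2 * (T + 1 - t))
          fun x hx t ht => ?_)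
        exact le_mul_of_one_le_right (sq_nonneg _) (by linarith [ht.2])
    _ ≤ _ := by
        refine integral_mono_measure (rectMeasure_mono (by linarith)) ?_ (i2 _)
        exact ae_rectMeasure (P := fun x t => 0 ≤ ((X n).v x t - V x t) ^ 2 * (T + 1 - t))
          fun x hx t ht => mul_nonneg (sq_nonneg _) (by linarith [ht.2])

end Tri

lemma CC.of_contDiff {φ : ℝ → ℝ → ℝ} (h : ContDiff ℝ (⊤ : ℕ∞) (uncurry φ)) : CC a b φ :=
  h.continuous.continuousOn

lemma DX.of_contDiff {φ : ℝ → ℝ → ℝ} (h : ContDiff ℝ (⊤ : ℕ∞) (uncurry φ)) : DX a b φ (pdx φ) :=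
  fun x _ t _ => (contDiff_pdx h).2 x t

lemma DT.of_contDiff {φ : ℝ → ℝ → ℝ} (h : ContDiff ℝ (⊤ : ℕ∞) (uncurry φ)) : DT a b φ (pdt φ) :=
  fun x _ t _ => (contDiff_pdt h).2 x t

lemma pdx_eq_zero_of_notMem {φ : ℝ → ℝ → ℝ} {K : Set ℝ} (hK : IsCompact K)
    (h : ∀ x t, x ∉ K → φ x t = 0) : ∀ x t, x ∉ K → pdx φ x t = 0 := by
  intro x t hx
  have : (fun y => φ y t) =ᶠ[nhds x] fun _ => 0 := by
    filter_upwards [hK.isClosed.isOpen_compl.mem_nhds hx] with y hy using h y t hy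
  simpa [pdx] using this.deriv_eq

lemma pdt_eq_zero_of_lt {φ : ℝ → ℝ → ℝ} {T' : ℝ} (h : ∀ x t, T' ≤ t → φ x t = 0) :
    ∀ x t, T' < t → pdt φ x t = 0 := by
  intro x t ht
  have : (fun s => φ x s) =ᶠ[nhds t] fun _ => 0 := by
    filter_upwards [Ioi_mem_nhds ht] with s hs using h x s hs.le
  simpa [pdt] using this.deriv_eq

namespace Tri
variable {F F' v0 u0 Θ0 : ℝ → ℝ}

section
variable {ε M T : ℝ} {X : Tri} {φ : ℝ → ℝ → ℝ} (hab : a ≤ b) (hF : Nonlin F F' M)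
  (h : Sol a b ε F F' X) (hi : Init a b v0 u0 Θ0 X) (hT : 0 ≤ T)
  (hφ : ContDiff ℝ (⊤ : ℕ∞) (uncurry φ))
include hab h hT hφ

/-- The displacement equation tested against a smooth function. -/
lemma Sol.test_u (hi : Init a b v0 u0 Θ0 X) (hφT : ∀ x, φ x T = 0) :
    (∫ q, ε * X.u2 q.1 q.2 * φ q.1 q.2 ∂rectMeasure a b T)
        + ∫ q, X.v q.1 q.2 * φ q.1 q.2 ∂rectMeasure a b T
      = - (∫ x in a..b, u0 x * φ x 0) - ∫ q, X.u q.1 q.2 * pdt φ q.1 q.2 ∂rectMeasure a b T := by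
  have cφ : CC a b φ := .of_contDiff hφ
  have h1 := integral_rect_parts_t hab hT h.tu (DT.of_contDiff hφ) h.cu h.cut cφ
    (.of_contDiff (contDiff_pdt hφ).1)
  have h2 : ∫ x in a..b, X.u x 0 * φ x 0 = ∫ x in a..b, u0 x * φ x 0 :=
    Tri.integral_congr_Icc hab fun x hx => by rw [(hi x hx).2.1]
  simp only [hφT, mul_zero, intervalIntegral.integral_zero, zero_sub, h2] at h1
  rw [← h1, ← integral_add ((((CC.const ε).mul h.cu2).mul cφ).integrable T)
    ((h.cv.mul cφ).integrable T)]
  refine integral_rect_congr (g := fun x t => ε * X.u2 x t * φ x t + X.v x t * φ x t)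
    (r := fun x t => X.ut x t * φ x t) fun x hx t ht => ?_
  rw [h.equ x hx t ht.1]
  ring

include hF

/-- The momentum equation tested against a smooth function. -/
lemma Sol.test_v (hi : Init a b v0 u0 Θ0 X) (hφT : ∀ x, φ x T = 0) (hφT' : ∀ x, pdt φ x T = 0)
    (ha : ∀ t, φ a t = 0) (hb : ∀ t, φ b t = 0) (ha' : ∀ t, pdx φ a t = 0)
    (hb' : ∀ t, pdx φ b t = 0) :
    (∫ q, X.u q.1 q.2 * pdt (pdt φ) q.1 q.2 ∂rectMeasure a b T)
        - (∫ x in a..b, v0 x * φ x 0) + (∫ x in a..b, u0 x * pdt φ x 0)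
        + ∫ q, ε * X.u2 q.1 q.2 * pdt φ q.1 q.2 ∂rectMeasure a b T
      = - (∫ q, ε * X.v2 q.1 q.2 * pdx (pdx φ) q.1 q.2 ∂rectMeasure a b T)
        - (∫ q, X.u1 q.1 q.2 * pdx φ q.1 q.2 ∂rectMeasure a b T)
        - ∫ q, X.p1 q.1 q.2 * (F' (X.p q.1 q.2) * φ q.1 q.2) ∂rectMeasure a b T := by
  obtain ⟨sx, dx⟩ := contDiff_pdx hφ
  obtain ⟨st, dt⟩ := contDiff_pdt hφ
  have cφ : CC a b φ := .of_contDiff hφ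
  have cx : CC a b (pdx φ) := .of_contDiff sx
  have cxx : CC a b (pdx (pdx φ)) := .of_contDiff (contDiff_pdx sx).1
  have h0 := h.test_u hab hT st hi hφT'
  have h1 := integral_rect_parts_t hab hT h.tv (DT.of_contDiff hφ) h.cv h.cvt cφ
    (.of_contDiff st)
  have h2 : ∫ x in a..b, X.v x 0 * φ x 0 = ∫ x in a..b, v0 x * φ x 0 :=
    Tri.integral_congr_Icc hab fun x hx => by rw [(hi x hx).1]
  simp only [hφT, mul_zero, intervalIntegral.integral_zero, zero_sub, h2] at h1
  have h3 := integral_rect_parts_x hab hT h.du1 (DX.of_contDiff hφ) h.cu1 h.cu2 cφ cx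
    (fun t _ => by simp [ha]) (fun t _ => by simp [hb])
  have h4 := integral_rect_parts_x hab hT h.dv3 (DX.of_contDiff hφ) h.cv3 h.cv4 cφ cx
    (fun t _ => by simp [ha]) (fun t _ => by simp [hb])
  have h5 := integral_rect_parts_x hab hT h.dv2 (DX.of_contDiff sx) h.cv2 h.cv3 cx cxx
    (fun t _ => by simp [ha']) (fun t _ => by simp [hb'])
  have i4 := ((h.cv4.mul cφ).integrable T).const_mul (-ε)
  have i2 := (h.cu2.mul cφ).integrable T
  have i1 := (h.cp1.mul ((h.cp.comp hF.continuous_deriv).mul cφ)).integrable T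
  have h6 : ∫ q, X.vt q.1 q.2 * φ q.1 q.2 ∂rectMeasure a b T
      = -ε * (∫ q, X.v4 q.1 q.2 * φ q.1 q.2 ∂rectMeasure a b T)
        + (∫ q, X.u2 q.1 q.2 * φ q.1 q.2 ∂rectMeasure a b T)
        - ∫ q, X.p1 q.1 q.2 * (F' (X.p q.1 q.2) * φ q.1 q.2) ∂rectMeasure a b T := by
    have i5 := i4.add i2
    rw [← integral_const_mul, ← integral_add i4 i2, ← integral_sub (i4.fun_add i2) i1]
    refine integral_rect_congr (g := fun x t => X.vt x t * φ x t)
      (r := fun x t => -ε * (X.v4 x t * φ x t) + X.u2 x t * φ x t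
        - X.p1 x t * (F' (X.p x t) * φ x t)) fun x hx t ht => ?_
    rw [h.eqv x hx t ht.1]
    ring
  have h7 : ∫ q, ε * X.v2 q.1 q.2 * pdx (pdx φ) q.1 q.2 ∂rectMeasure a b T
      = ε * ∫ q, X.v2 q.1 q.2 * pdx (pdx φ) q.1 q.2 ∂rectMeasure a b T := by
    simp only [mul_assoc, integral_const_mul]
  rw [h4, h5, h3] at h6
  rw [h7]
  linarith

/-- The heat equation tested against a smooth function. -/
lemma Sol.test_p (hi : Init a b v0 u0 Θ0 X) (hφT : ∀ x, φ x T = 0) :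
    - (∫ q, X.p q.1 q.2 * pdt φ q.1 q.2 ∂rectMeasure a b T) - (∫ x in a..b, Θ0 x * φ x 0)
      = - (∫ q, X.p1 q.1 q.2 * pdx φ q.1 q.2 ∂rectMeasure a b T)
        + (∫ q, X.p1 q.1 q.2 * (X.v q.1 q.2 * (F' (X.p q.1 q.2) * φ q.1 q.2))
            ∂rectMeasure a b T)
        + ∫ q, X.v q.1 q.2 * (F (X.p q.1 q.2) * pdx φ q.1 q.2) ∂rectMeasure a b T := by
  obtain ⟨sx, dx⟩ := contDiff_pdx hφ
  obtain ⟨st, dt⟩ := contDiff_pdt hφ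
  have cφ : CC a b φ := .of_contDiff hφ
  have cx : CC a b (pdx φ) := .of_contDiff sx
  have cF := h.cp.comp hF.continuous
  have cF' := h.cp.comp hF.continuous_deriv
  have h1 := integral_rect_parts_t hab hT h.tp (DT.of_contDiff hφ) h.cp h.cpt cφ
    (.of_contDiff st)
  have h2 : ∫ x in a..b, X.p x 0 * φ x 0 = ∫ x in a..b, Θ0 x * φ x 0 :=
    Tri.integral_congr_Icc hab fun x hx => by rw [(hi x hx).2.2]
  simp only [hφT, mul_zero, intervalIntegral.integral_zero, zero_sub, h2] at h1
  have h3 := integral_rect_parts_x hab hT h.dp1 (DX.of_contDiff hφ) h.cp1 h.cp2 cφ cx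
    (fun t ht => by simp [h.bp1a t ht]) (fun t ht => by simp [h.bp1b t ht])
  have d4 : DX a b (fun x t => F (X.p x t) * φ x t)
      (fun x t => F' (X.p x t) * X.p1 x t * φ x t + F (X.p x t) * pdx φ x t) := fun x hx t ht =>
    ((hF.deriv (X.p x t)).comp x (h.dp x hx t ht)).mul (dx x t)
  have h4 := integral_rect_parts_x hab hT h.dv d4 h.cv h.cv1 (cF.mul cφ)
    (((cF'.mul h.cp1).mul cφ).add (cF.mul cx))
    (fun t ht => by simp [h.bva t ht]) (fun t ht => by simp [h.bvb t ht])
  have h5 : ∫ q, X.v q.1 q.2 * (F' (X.p q.1 q.2) * X.p1 q.1 q.2 * φ q.1 q.2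
        + F (X.p q.1 q.2) * pdx φ q.1 q.2) ∂rectMeasure a b T
      = (∫ q, X.p1 q.1 q.2 * (X.v q.1 q.2 * (F' (X.p q.1 q.2) * φ q.1 q.2)) ∂rectMeasure a b T)
        + ∫ q, X.v q.1 q.2 * (F (X.p q.1 q.2) * pdx φ q.1 q.2) ∂rectMeasure a b T := by
    rw [← integral_add ((h.cp1.mul (h.cv.mul (cF'.mul cφ))).integrable T)
      ((h.cv.mul (cF.mul cx)).integrable T)]
    congr 1; ext q; ring
  have h6 : ∫ q, X.pt q.1 q.2 * φ q.1 q.2 ∂rectMeasure a b T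
      = (∫ q, X.p2 q.1 q.2 * φ q.1 q.2 ∂rectMeasure a b T)
        - ∫ q, X.v1 q.1 q.2 * (F (X.p q.1 q.2) * φ q.1 q.2) ∂rectMeasure a b T := by
    rw [← integral_sub ((h.cp2.mul cφ).integrable T) ((h.cv1.mul (cF.mul cφ)).integrable T)]
    refine integral_rect_congr (g := fun x t => X.pt x t * φ x t)
      (r := fun x t => X.p2 x t * φ x t - X.v1 x t * (F (X.p x t) * φ x t)) fun x hx t ht => ?_
    rw [h.eqp x hx t ht.1]
    ring
  rw [h3, h4, h5] at h6
  linarith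

end

variable {M : ℝ} {ε : ℕ → ℝ} {X : ℕ → Tri} {U Ux V Vt W Wx : ℝ → ℝ → ℝ}
  (hab : a < b) (hF : Nonlin F F' M) (h : Approx a b F F' v0 u0 Θ0 ε X)
  (hL : Limit a b X U Ux V Vt W Wx) {T : ℝ} (hT : 0 ≤ T) {φ : ℝ → ℝ → ℝ}
  (hφ : ContDiff ℝ (⊤ : ℕ∞) (uncurry φ))
include hab h hL hT hφ

lemma Approx.limit_u (hφ0 : ∀ x, φ x 0 = 0) (hφT : ∀ x, φ x T = 0) :
    ∫ q, U q.1 q.2 * pdt φ q.1 q.2 ∂rectMeasure a b T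
      = - ∫ q, V q.1 q.2 * φ q.1 q.2 ∂rectMeasure a b T := by
  have cφ : CC a b φ := .of_contDiff hφ
  have ct : CC a b (pdt φ) := .of_contDiff (contDiff_pdt hφ).1
  have h1 := ((h.sg_u2 hab hT).tendsto (cφ.memLp T)).add (hL.v.tendsto T _ (cφ.memLp T))
  have h2 := ((h.sg_u hab hL hT).tendsto (ct.memLp T)).neg
  have h3 := tendsto_nhds_unique (h1.congr fun n => ?_) h2
  · simp only [zero_mul, integral_zero, zero_add] at h3
    linarith
  · rw [(h.sol n).test_u hab.le hT hφ (h.init n) hφT]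
    simp [hφ0]

include hF

lemma Approx.limit_v (hφT : ∀ x, φ x T = 0) (hφT' : ∀ x, pdt φ x T = 0)
    (ha : ∀ t, φ a t = 0) (hb : ∀ t, φ b t = 0) (ha' : ∀ t, pdx φ a t = 0)
    (hb' : ∀ t, pdx φ b t = 0) :
    (∫ q, U q.1 q.2 * pdt (pdt φ) q.1 q.2 ∂rectMeasure a b T)
        - (∫ x in a..b, v0 x * φ x 0) + (∫ x in a..b, u0 x * pdt φ x 0)
      = - (∫ q, Ux q.1 q.2 * pdx φ q.1 q.2 ∂rectMeasure a b T)
        - ∫ q, Wx q.1 q.2 * (F' (W q.1 q.2) * φ q.1 q.2) ∂rectMeasure a b T := by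
  obtain ⟨sx, -⟩ := contDiff_pdx hφ
  obtain ⟨st, -⟩ := contDiff_pdt hφ
  have cφ : CC a b φ := .of_contDiff hφ
  have cx : CC a b (pdx φ) := .of_contDiff sx
  have ct : CC a b (pdt φ) := .of_contDiff st
  have cxx : CC a b (pdx (pdx φ)) := .of_contDiff (contDiff_pdx sx).1
  have ctt : CC a b (pdt (pdt φ)) := .of_contDiff (contDiff_pdt st).1
  have g : Sg a b T (fun n x t => F' ((X n).p x t) * φ x t) (fun x t => F' (W x t) * φ x t) :=
    (Sg.of_pointwise (fun n => (h.sol n).cp.comp hF.continuous_deriv)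
      (hL.cW.comp hF.continuous_deriv) (fun n x hx t ht => hF.bound _)
      (fun x hx t ht => (hF.continuous_deriv.tendsto _).comp (hL.p x hx t ht))).mul_cc cφ
  have h1 := ((((h.sg_u hab hL hT).tendsto (ctt.memLp T)).sub_const
    (∫ x in a..b, v0 x * φ x 0)).add_const (∫ x in a..b, u0 x * pdt φ x 0)).add
    ((h.sg_u2 hab hT).tendsto (ct.memLp T))
  have h2 := (((h.sg_v2 hab hT).tendsto (cxx.memLp T)).neg.sub
    (hL.u1.tendsto T _ (cx.memLp T))).sub (h.tendsto_p1_mul hab hL hT g)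
  have h3 := tendsto_nhds_unique (h1.congr fun n => ?_) h2
  · simpa only [zero_mul, integral_zero, neg_zero, zero_sub, add_zero] using h3
  · exact (h.sol n).test_v hab.le hF hT hφ (h.init n) hφT hφT' ha hb ha' hb'

lemma Approx.sg_v_mul_deriv : Sg a b T (fun n x t => (X n).v x t * (F' ((X n).p x t) * φ x t))
    (fun x t => V x t * (F' (W x t) * φ x t)) := by
  have := ((h.sg_v hab hL hT).mul_bdd (fun n => (h.sol n).cp.comp hF.continuous_deriv)
      (hL.cW.comp hF.continuous_deriv) (fun n x hx t ht => hF.bound _)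
      (fun x hx t ht => (hF.continuous_deriv.tendsto _).comp (hL.p x hx t ht))).mul_cc
        (.of_contDiff hφ)
  simpa only [mul_assoc] using this

lemma Approx.limit_p (hφT : ∀ x, φ x T = 0) :
    - (∫ q, W q.1 q.2 * pdt φ q.1 q.2 ∂rectMeasure a b T) - (∫ x in a..b, Θ0 x * φ x 0)
      = - (∫ q, Wx q.1 q.2 * pdx φ q.1 q.2 ∂rectMeasure a b T)
        + (∫ q, Wx q.1 q.2 * (V q.1 q.2 * (F' (W q.1 q.2) * φ q.1 q.2)) ∂rectMeasure a b T)
        + ∫ q, V q.1 q.2 * (F (W q.1 q.2) * pdx φ q.1 q.2) ∂rectMeasure a b T := by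
  have cx : CC a b (pdx φ) := .of_contDiff (contDiff_pdx hφ).1
  have ct : CC a b (pdt φ) := .of_contDiff (contDiff_pdt hφ).1
  have g : Sg a b T (fun n x t => F ((X n).p x t) * pdx φ x t)
      (fun x t => F (W x t) * pdx φ x t) := by
    obtain ⟨K, _, hb⟩ := h.bdd T hT
    exact (Sg.of_pointwise (fun n => (h.sol n).cp.comp hF.continuous)
      (hL.cW.comp hF.continuous) (fun n x hx t ht => (hF.abs_le _).trans
        (mul_le_mul_of_nonneg_left ((hb n).abs_p_le hab (h.sol n).toReg hx ht) hF.nonneg))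
      (fun x hx t ht => (hF.continuous.tendsto _).comp (hL.p x hx t ht))).mul_cc cx
  have h1 := ((h.sg_p hab hL hT).tendsto (ct.memLp T)).neg.sub_const
    (∫ x in a..b, Θ0 x * φ x 0)
  have h2 := ((hL.p1.tendsto T _ (cx.memLp T)).neg.add
    (h.tendsto_p1_mul hab hL hT (h.sg_v_mul_deriv hab hF hL hT hφ))).add
    (h.tendsto_v_mul hab hL hT g)
  exact tendsto_nhds_unique (h1.congr fun n =>
    (h.sol n).test_p hab.le hF hT hφ (h.init n) hφT) h2

end Tri

/-- Integration by parts for a function with integrable derivative. -/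
lemma integral_mul_deriv_of_primitive (hab : a ≤ b) {y g : ℝ → ℝ}
    (hg : IntervalIntegrable g volume a b) (hy : ∀ x ∈ Icc a b, y x = y a + ∫ z in a..x, g z)
    {ψ : ℝ → ℝ} (hψ : ContDiff ℝ (⊤ : ℕ∞) ψ) :
    ∫ x in a..b, y x * deriv ψ x = y b * ψ b - y a * ψ a - ∫ x in a..b, g x * ψ x := by
  have hG := hg.absolutelyContinuousOnInterval_intervalIntegral (c := a) left_mem_uIcc
  have hP : AbsolutelyContinuousOnInterval ψ a b :=
    (hψ.of_le (by simp)).contDiffOn.absolutelyContinuousOnInterval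
  have h1 := hG.integral_mul_deriv_eq_deriv_mul hP
  have h2 : ∫ x in a..b, deriv (fun x => ∫ z in a..x, g z) x * ψ x = ∫ x in a..b, g x * ψ x := by
    refine intervalIntegral.integral_congr_ae ?_
    filter_upwards [hg.ae_hasDerivAt_integral] with x hx hx'
    rw [(hx (uIoc_subset_uIcc hx') a left_mem_uIcc).deriv]
  have c1 : ContinuousOn (fun x => ∫ z in a..x, g z) (Icc a b) := by
    have := intervalIntegral.continuousOn_primitive_interval' hg left_mem_uIcc
    rwa [uIcc_of_le hab] at this
  have c2 : Continuous (deriv ψ) := hψ.continuous_deriv (by simp)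
  have h3 : ∫ x in a..b, y x * deriv ψ x
      = y a * (∫ x in a..b, deriv ψ x) + ∫ x in a..b, (∫ z in a..x, g z) * deriv ψ x := by
    have i1 : IntervalIntegrable (fun x => (∫ z in a..x, g z) * deriv ψ x) volume a b :=
      ContinuousOn.ii hab (c1.mul c2.continuousOn)
    rw [← intervalIntegral.integral_const_mul, ← intervalIntegral.integral_add
      ((c2.intervalIntegrable _ _).const_mul _) i1]
    refine Tri.integral_congr_Icc hab fun x hx => ?_
    rw [hy x hx]
    ring
  have h4 : ∫ x in a..b, deriv ψ x = ψ b - ψ a :=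
    intervalIntegral.integral_deriv_eq_sub (fun x _ => hψ.differentiable (by simp) x)
      (c2.intervalIntegrable _ _)
  rw [h3, h4, h1, h2, intervalIntegral.integral_same, hy b (right_mem_Icc.2 hab)]
  ring

/-- Integration against the indicator of a product set in a rectangle. -/
lemma integral_rect_indicator {T x₀ : ℝ} (hx₀ : x₀ ∈ Icc a b) {w : ℝ → ℝ → ℝ}
    (hw : Integrable (fun q : ℝ × ℝ => w q.1 q.2) (rectMeasure a b T)) {A : Set ℝ}
    (hA : MeasurableSet A) :
    Integrable (fun t => ∫ x in a..x₀, w x t) (volume.restrict (Icc 0 T)) ∧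
      ∫ q, w q.1 q.2 * (Icc a x₀ ×ˢ A).indicator (fun _ => 1) q ∂rectMeasure a b T
        = ∫ t in A, (∫ x in a..x₀, w x t) ∂volume.restrict (Icc 0 T) := by
  have hm : (volume.restrict (Icc a b)).restrict (Icc a x₀) = volume.restrict (Icc a x₀) := by
    rw [Measure.restrict_restrict measurableSet_Icc,
      inter_eq_left.2 (Icc_subset_Icc le_rfl hx₀.2)]
  have key : ∀ B : Set ℝ, (rectMeasure a b T).restrict (Icc a x₀ ×ˢ B)
      = (volume.restrict (Icc a x₀)).prod ((volume.restrict (Icc 0 T)).restrict B) := fun B => by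
    rw [rectMeasure_eq_prod, ← Measure.prod_restrict, hm]
  have hI : ∀ t, ∫ x in a..x₀, w x t = ∫ x in Icc a x₀, w x t := fun t => by
    rw [intervalIntegral.integral_of_le hx₀.1, integral_Icc_eq_integral_Ioc]
  simp only [hI]
  constructor
  · have h1 := hw.restrict (s := Icc a x₀ ×ˢ univ)
    rw [key, Measure.restrict_univ] at h1
    exact h1.integral_prod_right
  · have h1 := hw.restrict (s := Icc a x₀ ×ˢ A)
    rw [key] at h1
    rw [← integral_prod_symm _ h1, ← key, ← integral_indicator (measurableSet_Icc.prod hA)]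
    refine integral_congr_ae (ae_of_all _ fun q => ?_)
    by_cases hq : q ∈ Icc a x₀ ×ˢ A <;> simp [hq]

/-- The fundamental theorem of calculus passes to weak limits on almost every time slice. -/
lemma Wk.slice (hab : a ≤ b) {T B : ℝ} {y y1 : ℕ → ℝ → ℝ → ℝ} {Y Yx : ℝ → ℝ → ℝ}
    (h : Wk a b y1 Yx) (hd : ∀ n, DX a b (y n) (y1 n)) (cy : ∀ n, CC a b (y n))
    (cy1 : ∀ n, CC a b (y1 n)) (cY : CC a b Y)
    (hB : ∀ n, ∀ x ∈ Icc a b, ∀ t ∈ Icc 0 T, |y n x t| ≤ B)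
    (hl : ∀ x ∈ Icc a b, ∀ t, 0 ≤ t → Tendsto (fun n => y n x t) atTop (nhds (Y x t)))
    {x₀ : ℝ} (hx₀ : x₀ ∈ Icc a b) :
    ∀ᵐ t ∂volume.restrict (Icc 0 T), Y x₀ t - Y a t = ∫ x in a..x₀, Yx x t := by
  have ha : a ∈ Icc a b := left_mem_Icc.2 hab
  have hYx := (h.memLp T).integrable one_le_two
  have iY : Integrable (fun t => Y x₀ t - Y a t) (volume.restrict (Icc 0 T)) :=
    (((cY.slice_t hx₀).sub (cY.slice_t ha)).mono Icc_subset_Ici_self).integrableOn_Icc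
  refine Integrable.ae_eq_of_forall_setIntegral_eq _ _ iY
    (integral_rect_indicator hx₀ hYx MeasurableSet.univ).1 fun A hA _ => ?_
  have hψ : MemLp ((Icc a x₀ ×ˢ A).indicator (fun _ => (1 : ℝ))) 2 (rectMeasure a b T) :=
    (memLp_const 1).indicator (measurableSet_Icc.prod hA)
  have h1 := h.tendsto T _ hψ
  rw [(integral_rect_indicator hx₀ hYx hA).2] at h1
  refine tendsto_nhds_unique ?_ h1
  have hin : ∀ᵐ t ∂(volume.restrict (Icc 0 T)).restrict A, t ∈ Icc 0 T :=
    ae_restrict_of_ae (ae_restrict_mem measurableSet_Icc)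
  have h2 : ∀ n, ∫ q, y1 n q.1 q.2 * (Icc a x₀ ×ˢ A).indicator (fun _ => 1) q ∂rectMeasure a b T
      = ∫ t in A, (y n x₀ t - y n a t) ∂volume.restrict (Icc 0 T) := fun n => by
    rw [(integral_rect_indicator hx₀ ((cy1 n).integrable T) hA).2]
    refine integral_congr_ae ?_
    filter_upwards [hin] with t ht
    refine intervalIntegral.integral_eq_sub_of_hasDerivAt (f := fun x => y n x t)
      (fun x hx => hd n x ?_ t ht.1) (ContinuousOn.ii hx₀.1
        (((cy1 n).slice ht.1).mono (Icc_subset_Icc le_rfl hx₀.2)))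
    rw [uIcc_of_le hx₀.1] at hx
    exact ⟨hx.1, hx.2.trans hx₀.2⟩
  simp only [h2]
  refine tendsto_integral_of_dominated_convergence (fun _ => B + B) (fun n => ?_)
    (integrable_const _) (fun n => ?_) ?_
  · exact (((((cy n).slice_t hx₀).sub ((cy n).slice_t ha)).mono
      Icc_subset_Ici_self).aestronglyMeasurable measurableSet_Icc).mono_measure
        Measure.restrict_le_self
  · filter_upwards [hin] with t ht
    exact (abs_sub _ _).trans (add_le_add (hB n _ hx₀ t ht) (hB n _ ha t ht))
  · filter_upwards [hin] with t ht
    exact (hl _ hx₀ t ht.1).sub (hl _ ha t ht.1)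

lemma ae_integrable_slice {T : ℝ} {w : ℝ → ℝ → ℝ} (hab : a ≤ b)
    (hw : Integrable (fun q : ℝ × ℝ => w q.1 q.2) (rectMeasure a b T)) :
    ∀ᵐ t ∂volume.restrict (Icc 0 T), IntervalIntegrable (fun x => w x t) volume a b := by
  rw [rectMeasure_eq_prod] at hw
  filter_upwards [hw.prod_left_ae] with t ht
  exact (intervalIntegrable_iff_integrableOn_Icc_of_le hab).2 ht

lemma Wk.slices (hab : a ≤ b) {T B : ℝ} {y y1 : ℕ → ℝ → ℝ → ℝ} {Y Yx : ℝ → ℝ → ℝ}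
    (h : Wk a b y1 Yx) (hd : ∀ n, DX a b (y n) (y1 n)) (cy : ∀ n, CC a b (y n))
    (cy1 : ∀ n, CC a b (y1 n)) (cY : CC a b Y)
    (hB : ∀ n, ∀ x ∈ Icc a b, ∀ t ∈ Icc 0 T, |y n x t| ≤ B)
    (hl : ∀ x ∈ Icc a b, ∀ t, 0 ≤ t → Tendsto (fun n => y n x t) atTop (nhds (Y x t))) :
    ∀ᵐ t ∂volume.restrict (Icc 0 T), IntervalIntegrable (fun x => Yx x t) volume a b ∧
      ∀ x ∈ Icc a b, Y x t = Y a t + ∫ z in a..x, Yx z t := by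
  have hc : ∀ x : ℝ, max a (min b x) ∈ Icc a b := fun x =>
    ⟨le_max_left _ _, max_le hab (min_le_left _ _)⟩
  have h1 : ∀ᵐ t ∂volume.restrict (Icc 0 T), ∀ r : ℚ, Y (max a (min b (r : ℝ))) t - Y a t
      = ∫ x in a..(max a (min b (r : ℝ))), Yx x t :=
    ae_all_iff.2 fun r => h.slice hab hd cy cy1 cY hB hl (hc r)
  filter_upwards [h1, ae_integrable_slice hab ((h.memLp T).integrable one_le_two),
    ae_restrict_mem measurableSet_Icc] with t ht hi htT
  refine ⟨hi, fun x hx => ?_⟩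
  have c1 : Continuous fun x => Y (max a (min b x)) t - Y a t :=
    ((cY.slice htT.1).comp_continuous (f := fun x => max a (min b x)) (by fun_prop) hc).sub
      continuous_const
  have c2 : Continuous fun x => ∫ z in a..(max a (min b x)), Yx z t := by
    have := intervalIntegral.continuousOn_primitive_interval' hi left_mem_uIcc
    rw [uIcc_of_le hab] at this
    exact this.comp_continuous (f := fun x => max a (min b x)) (by fun_prop) hc
  have := congrFun (Rat.denseRange_cast.equalizer c1 c2 (funext ht)) x
  simp only [min_eq_right hx.2, max_eq_right hx.1] at this
  linarith

lemma intOm_eq (hab : a ≤ b) (g : ℝ → ℝ) : intOm a b g = ∫ x in a..b, g x := by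
  rw [intOm, intervalIntegral.integral_of_le hab, integral_Ioc_eq_integral_Ioo]

lemma intOmT_eq (T : ℝ) (g : ℝ → ℝ → ℝ) :
    intOmT a b T g = ∫ q, g q.1 q.2 ∂rectMeasure a b T := by
  rw [rectMeasure_eq_open, intOmT]

lemma integrableOn_open_iff {T : ℝ} {g : ℝ × ℝ → ℝ} :
    IntegrableOn g (Ioo a b ×ˢ Ioo 0 T) ↔ Integrable g (rectMeasure a b T) := by
  rw [rectMeasure_eq_open, IntegrableOn]

lemma CC.tendsto_L1 (hab : a ≤ b) {w : ℝ → ℝ → ℝ} (h : CC a b w) {T t₀ : ℝ} (ht₀ : t₀ ∈ Icc 0 T) :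
    Tendsto (fun t => ∫ x in Ioo a b, |w x t - w x t₀|) (nhdsWithin t₀ (Icc 0 T)) (nhds 0) := by
  have c0 : CC a b (fun x _ => w x t₀) :=
    (h.slice ht₀.1).comp continuousOn_fst fun q hq => hq.1
  have c1 := ((((h.sub c0).comp continuous_abs).integral_x hab) t₀ ht₀.1).mono_left
    (nhdsWithin_mono t₀ (Icc_subset_Ici_self : Icc 0 T ⊆ Ici 0))
  simpa [intervalIntegral.integral_of_le hab, integral_Ioc_eq_integral_Ioo] using c1

lemma WkL2loc.of_tendsto {w : ℕ → ℝ → ℝ → ℝ} {W : ℝ → ℝ → ℝ}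
    (h : ∀ T, 0 ≤ T → ∀ ψ : ℝ × ℝ → ℝ, MemLp ψ 2 (rectMeasure a b T) →
      Tendsto (fun n => ∫ q, w n q.1 q.2 * ψ q ∂rectMeasure a b T) atTop
        (nhds (∫ q, W q.1 q.2 * ψ q ∂rectMeasure a b T))) : WkL2loc a b w W :=
  fun T hT _ hm hi => h T hT.le _ ((memLp_two_iff_integrable_sq hm).2 hi)

lemma weakDerivZ_of_primitive (hab : a ≤ b) {y g : ℝ → ℝ}
    (hg : IntervalIntegrable g volume a b) (hy : ∀ x ∈ Icc a b, y x = y a + ∫ z in a..x, g z)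
    (ha : y a = 0) (hb : y b = 0) : WeakDerivZ a b y g := by
  intro ψ hψ
  have := integral_mul_deriv_of_primitive hab hg hy hψ
  simp only [intervalIntegral.integral_of_le hab, integral_Ioc_eq_integral_Ioo] at this
  rw [this, ha, hb]
  ring

lemma weakDerivI_of_primitive (hab : a ≤ b) {y g : ℝ → ℝ}
    (hg : IntervalIntegrable g volume a b) (hy : ∀ x ∈ Icc a b, y x = y a + ∫ z in a..x, g z) :
    WeakDerivI a b y g := by
  intro ψ hψ hs
  have := integral_mul_deriv_of_primitive hab hg hy hψ
  simp only [intervalIntegral.integral_of_le hab, integral_Ioc_eq_integral_Ioo] at this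
  rw [this, image_eq_zero_of_notMem_tsupport fun h => lt_irrefl a (hs h).1,
    image_eq_zero_of_notMem_tsupport fun h => lt_irrefl b (hs h).2]
  ring

namespace Tri
variable {F F' v0 u0 Θ0 : ℝ → ℝ} {M : ℝ} {ε : ℕ → ℝ} {X : ℕ → Tri} {U Ux V Vt W Wx : ℝ → ℝ → ℝ}

/-- The limit of an approximating family is a weak solution of (P). -/
theorem Approx.isWeakSol (hab : a < b) (hF : Nonlin F F' M) (h : Approx a b F F' v0 u0 Θ0 ε X)
    (hL : Limit a b X U Ux V Vt W Wx) {f f' : ℝ → ℝ} (hf : ∀ x, 0 ≤ x → F x = f x)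
    (hf' : ∀ x, 0 ≤ x → F' x = f' x) {T : ℝ} (hT : 0 ≤ T) :
    IsWeakSol a b T f f' u0 v0 Θ0 U V Ux W Wx := by
  have haI : a ∈ Icc a b := left_mem_Icc.2 hab.le
  have hbI : b ∈ Icc a b := right_mem_Icc.2 hab.le
  have hUa : ∀ t, 0 ≤ t → U a t = 0 := fun t ht => tendsto_nhds_unique (hL.u a haI t ht)
    (tendsto_const_nhds.congr fun n => ((h.sol n).bua t ht).symm)
  have hUb : ∀ t, 0 ≤ t → U b t = 0 := fun t ht => tendsto_nhds_unique (hL.u b hbI t ht)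
    (tendsto_const_nhds.congr fun n => ((h.sol n).bub t ht).symm)
  have hW : ∀ x ∈ Icc a b, ∀ t, 0 ≤ t → 0 ≤ W x t := fun x hx t ht =>
    ge_of_tendsto' (hL.p x hx t ht) fun n => h.pos n x hx t ht
  have hWae : ∀ᵐ q ∂rectMeasure a b T, 0 ≤ W q.1 q.2 :=
    ae_rectMeasure (P := fun x t => 0 ≤ W x t) fun x hx t ht => hW x hx t ht.1
  have cF : CC a b (fun x t => F (W x t)) := hL.cW.comp hF.continuous
  have cF' : CC a b (fun x t => F' (W x t)) := hL.cW.comp hF.continuous_deriv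
  obtain ⟨K, _, hbd⟩ := h.bdd T hT
  refine
    { u_sliceL1 := fun t ht => ((hL.cU.slice ht.1).integrableOn_Icc).mono_set Ioo_subset_Icc_self
      u_contL1 := fun t₀ ht₀ => hL.cU.tendsto_L1 hab.le ht₀
      u_int := integrableOn_open_iff.2 (hL.cU.integrable T)
      ux_int := integrableOn_open_iff.2 ((hL.u1.memLp T).integrable one_le_two)
      u_W0 := ?_
      Θ_int := integrableOn_open_iff.2 (hL.cW.integrable T)
      Θx_int := integrableOn_open_iff.2 ((hL.p1.memLp T).integrable one_le_two)
      Θ_W := ?_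
      Θ_nonneg := by rwa [rectMeasure_eq_open] at hWae
      ut_weak := ?_
      ut_int := integrableOn_open_iff.2 ((hL.v.memLp T).integrable one_le_two)
      g1_int := ?_
      g2_int := ?_
      g3_int := ?_
      weak_u := ?_
      weak_Θ := ?_ }
  · have h1 := hL.u1.slices hab.le (fun n => (h.sol n).du) (fun n => (h.sol n).cu)
      (fun n => (h.sol n).cu1) hL.cU
      (fun n x hx t ht => (hbd n).abs_u_le hab.le (h.sol n).toReg hx ht) hL.u
    filter_upwards [ae_restrict_of_ae_restrict_of_subset Ioo_subset_Icc_self h1,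
      ae_restrict_mem measurableSet_Ioo] with t ht h0
    exact weakDerivZ_of_primitive hab.le ht.1 ht.2 (hUa t h0.1.le) (hUb t h0.1.le)
  · have h1 := hL.p1.slices hab.le (fun n => (h.sol n).dp) (fun n => (h.sol n).cp)
      (fun n => (h.sol n).cp1) hL.cW
      (fun n x hx t ht => (hbd n).abs_p_le hab (h.sol n).toReg hx ht) hL.p
    filter_upwards [ae_restrict_of_ae_restrict_of_subset Ioo_subset_Icc_self h1] with t ht
    exact weakDerivI_of_primitive hab.le ht.1 ht.2
  · rintro φ ⟨hφ, -, K, -, hK, h0⟩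
    rw [intOmT_eq, intOmT_eq]
    exact h.limit_u hab hL hT hφ (fun x => h0 x 0 fun hm => lt_irrefl _ (hK hm).1)
      (fun x => h0 x T fun hm => lt_irrefl _ (hK hm).2)
  · refine integrableOn_open_iff.2 ((((hL.p1.memLp T).mul_cc cF').integrable one_le_two).congr ?_)
    filter_upwards [hWae] with q hq
    rw [hf' _ hq, mul_comm]
  · refine integrableOn_open_iff.2
      ((((hL.p1.memLp T).mul_cc cF').integrable_fun_mul (hL.v.memLp T)).congr ?_)
    filter_upwards [hWae] with q hq
    rw [hf' _ hq, mul_comm (f' _)]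
  · refine integrableOn_open_iff.2 ((((hL.v.memLp T).mul_cc cF).integrable one_le_two).congr ?_)
    filter_upwards [hWae] with q hq
    rw [hf _ hq, mul_comm]
  · rintro φ ⟨hφ, ⟨K, hKc, hK, h0⟩, T', hT', h1⟩
    have ha : a ∉ K := fun hm => lt_irrefl _ (hK hm).1
    have hb : b ∉ K := fun hm => lt_irrefl _ (hK hm).2
    have hx := pdx_eq_zero_of_notMem hKc h0
    have key := h.limit_v hab hF hL hT hφ (fun x => h1 x T hT'.le)
      (fun x => pdt_eq_zero_of_lt h1 x T hT') (fun t => h0 a t ha) (fun t => h0 b t hb)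
      (fun t => hx a t ha) (fun t => hx b t hb)
    simp only [intOmT_eq, intOm_eq hab.le]
    rw [key]
    refine congrArg₂ _ rfl (integral_congr_ae ?_)
    filter_upwards [hWae] with q hq
    rw [hf' _ hq]
    ring
  · rintro φ ⟨hφ, T', hT', h1⟩
    have key := h.limit_p hab hF hL hT hφ (fun x => h1 x T hT'.le)
    simp only [intOmT_eq, intOm_eq hab.le]
    rw [key]
    refine congrArg₂ _ (congrArg₂ _ rfl (integral_congr_ae ?_)) (integral_congr_ae ?_)
    · filter_upwards [hWae] with q hq
      rw [hf' _ hq]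
      ring
    · filter_upwards [hWae] with q hq
      rw [hf _ hq]
      ring

end Tri

end

/-- Lemma 4.2: approximation of a global weak solution of (P) by
solutions of the regularized problems along a vanishing sequence of ε. -/
theorem statement11
    (a b : ℝ) (hab : a < b)
    (f f' f'' : ℝ → ℝ) (hf : HypF f f' f'')
    (v0 u0 Θ0 : ℝ → ℝ) (hdata : SmoothData a b v0 u0 Θ0)
    (v u Θ : ℝ → ℝ → ℝ → ℝ)
    (hsol : ∀ ε ∈ Ioo (0 : ℝ) 1, IsClassicalSolEps a b f ε v0 u0 Θ0 (v ε) (u ε) (Θ ε)) :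
    ∃ (εj : ℕ → ℝ) (U Ut Ux W Wx : ℝ → ℝ → ℝ),
      (∀ j, εj j ∈ Ioo (0 : ℝ) 1) ∧ StrictAnti εj ∧ Tendsto εj atTop (nhds 0) ∧
      (∀ T > (0 : ℝ), IsWeakSol a b T f f' u0 v0 Θ0 U Ut Ux W Wx) ∧
      WkL2loc a b (fun j => u (εj j)) U ∧
      WkL2loc a b (fun j => pdx (u (εj j))) Ux ∧
      WkL2loc a b (fun j => v (εj j)) Ut ∧
      WkL2loc a b (fun j => Θ (εj j)) W ∧
      WkL2loc a b (fun j => pdx (Θ (εj j))) Wx := by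
  obtain ⟨F, F', M, hF, hFf, hFf'⟩ := hf.exists_nonlin
  have hε : ∀ n : ℕ, 1 / ((n : ℝ) + 2) ∈ Ioo (0 : ℝ) 1 := fun n =>
    ⟨by positivity, (div_lt_one (by positivity)).2 (by linarith [n.cast_nonneg (α := ℝ)])⟩
  have hanti : StrictAnti fun n : ℕ => 1 / ((n : ℝ) + 2) := fun m n hmn =>
    one_div_lt_one_div_of_lt (by positivity) (by simpa using hmn)
  have hlim : Tendsto (fun n : ℕ => 1 / ((n : ℝ) + 2)) atTop (nhds 0) :=
    tendsto_const_nhds.div_atTop (tendsto_natCast_atTop_atTop.atTop_add tendsto_const_nhds)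
  have hA : Tri.Approx a b F F' v0 u0 Θ0 (fun n : ℕ => 1 / ((n : ℝ) + 2)) fun n : ℕ =>
      toTri (v (1 / ((n : ℝ) + 2))) (u (1 / ((n : ℝ) + 2))) (Θ (1 / ((n : ℝ) + 2))) :=
    { eps := hε
      lim := hlim
      sol := fun n => (hsol _ (hε n)).sol hab hF hFf
      pos := fun n x hx t ht => ((hsol _ (hε n)).Θ_pos x hx t ht).le
      init := fun n => (hsol _ (hε n)).init
      bdd := fun T hT => by
        obtain ⟨K, hK, hb⟩ := Tri.uniform_bounds hab hF hdata hT
        exact ⟨K, hK, fun n => hb _ _ (hε n) ((hsol _ (hε n)).sol hab hF hFf)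
          (fun x hx t ht => ((hsol _ (hε n)).Θ_pos x hx t ht).le) (hsol _ (hε n)).init⟩ }
  obtain ⟨φ, U, Ux, V, Vt, W, Wx, hφ, hL⟩ := hA.exists_limit hab
  have hB := hA.subseq hφ
  exact ⟨fun j => 1 / ((φ j : ℝ) + 2), U, V, Ux, W, Wx, fun j => hε _, hanti.comp_strictMono hφ,
    hlim.comp hφ.tendsto_atTop, fun T hT => hB.isWeakSol hab hF hL hFf hFf' hT.le,
    .of_tendsto fun T hT ψ hψ => (hB.sg_u hab hL hT).tendsto hψ,
    .of_tendsto fun T _ ψ hψ => hL.u1.tendsto T ψ hψ,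
    .of_tendsto fun T _ ψ hψ => hL.v.tendsto T ψ hψ,
    .of_tendsto fun T hT ψ hψ => (hB.sg_p hab hL hT).tendsto hψ,
    .of_tendsto fun T _ ψ hψ => hL.p1.tendsto T ψ hψ⟩
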